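/- Let θ be a unital completely positive map on a nuclear unital C*-algebra A and define Voiculescu's topological entropy ht(θ) = sup_{Ω,ε} lim sup_n (1/n) log rcp(Ω ∪ θ(Ω) ∪ … ∪ θⁿ(Ω), ε). If θ = Φ^p is the canonical shift on a higher-rank graph algebra O_Λ and the approximation estimate rcp(ω_l^{(n)}, δ) ≤ C_l · w_{n+l} holds for all n (where ω_l^{(n)} = ⋃_{k ≤ n̄, plus shifts} Φ^k(ω_l), C_l a constant depending only on l, and w is the word count), then ht(Φ^p) ≤ lim sup_n (1/n) log w_{l̄+np} = log r(M^p) in the Robertson–Steger case. -/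

import Mathlib

/-- A rank-`r` graph: a small category graded by `ℤ₊^r` (morphisms of each shape form a type)
satisfying the unique factorisation property. -/
structure HigherRankGraph (r : ℕ) where
  /-- objects (vertices) -/
  Obj : Type
  /-- morphisms (words) of each shape `l ∈ ℤ₊^r` -/
  Mor : (Fin r → ℕ) → Type
  /-- origin (range) of a morphism -/
  src : ∀ {l : Fin r → ℕ}, Mor l → Obj
  /-- terminus (source) of a morphism -/
  tgt : ∀ {l : Fin r → ℕ}, Mor l → Obj
  /-- identity morphisms -/
  id' : Obj → Mor 0
  /-- composition of compatible morphisms -/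
  comp : ∀ {l m : Fin r → ℕ} (u : Mor l) (v : Mor m), tgt u = src v → Mor (l + m)
  src_comp : ∀ {l m : Fin r → ℕ} (u : Mor l) (v : Mor m) (h : tgt u = src v),
    src (comp u v h) = src u
  tgt_comp : ∀ {l m : Fin r → ℕ} (u : Mor l) (v : Mor m) (h : tgt u = src v),
    tgt (comp u v h) = tgt v
  src_id : ∀ a, src (id' a) = a
  tgt_id : ∀ a, tgt (id' a) = a
  /-- the unique factorisation property -/
  factor : ∀ (l m : Fin r → ℕ) (w : Mor (l + m)),
    ∃! uv : Σ' (u : Mor l) (v : Mor m), tgt u = src v, comp uv.1 uv.2.1 uv.2.2 = w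

/-- A linear map between star algebras is unital and completely positive: it maps `1` to `1`
and all the canonical "matrix compressions" of its values are positive (positivity expressed
via sums of squares `∑ star c · c`). -/
def IsUCP {A B : Type*} [Ring A] [StarRing A] [Module ℂ A]
    [Ring B] [Star B] [Module ℂ B] (φ : A →ₗ[ℂ] B) : Prop :=
  φ 1 = 1 ∧ ∀ (n : ℕ) (a : Fin n → A) (b : Fin n → B),
    ∃ (m : ℕ) (c : Fin m → B),
      ∑ i, ∑ j, star (b i) * φ (star (a i) * a j) * b j = ∑ t, star (c t) * c t

/-- Voiculescu's completely positive approximation rank `rcp(Ω, ε)`: the minimal rank of a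
finite-dimensional C*-algebra `C = ⊕ᵢ M_{dᵢ}` admitting ucp maps `ψ : A → C`, `φ : C → A`
with `‖φ(ψ(a)) − a‖ < ε` for all `a ∈ Ω`. -/
noncomputable def rcp (A : Type*) [NormedRing A] [StarRing A] [NormedAlgebra ℂ A]
    (Ω : Set A) (ε : ℝ) : ℕ :=
  sInf {k : ℕ | ∃ (t : ℕ) (d : Fin t → ℕ)
    (ψ : A →ₗ[ℂ] (∀ i, Matrix (Fin (d i)) (Fin (d i)) ℂ))
    (φ : (∀ i, Matrix (Fin (d i)) (Fin (d i)) ℂ) →ₗ[ℂ] A),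
    IsUCP ψ ∧ IsUCP φ ∧ (∀ a ∈ Ω, ‖φ (ψ a) - a‖ < ε) ∧ k = ∑ i, d i}

section Part1
open scoped ComplexOrder InnerProductSpace ComplexConjugate

section NumRange
variable {H : Type*} [NormedAddCommGroup H] [InnerProductSpace ℂ H] [CompleteSpace H]

/-- A unital contractive functional on `B(H)`. -/
def StateBH (H : Type*) [NormedAddCommGroup H] [InnerProductSpace ℂ H] [CompleteSpace H]
    (G : (H →L[ℂ] H) →L[ℂ] ℂ) : Prop := ‖G‖ ≤ 1 ∧ G 1 = 1

theorem StateBH.re_nonneg {G : (H →L[ℂ] H) →L[ℂ] ℂ} (hG : StateBH H G) (X : H →L[ℂ] H)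
    (hX : ∀ k : H, 0 ≤ (⟪k, X k⟫_ℂ).re) : 0 ≤ (G X).re := by
  set M := ‖X‖
  -- norm bound
  have key : ∀ c : ℝ, 0 ≤ c → ‖(c : ℂ) • (1 : H →L[ℂ] H) - X‖ ≤ Real.sqrt (c ^ 2 + M ^ 2) := by
    intro c hc
    refine ContinuousLinearMap.opNorm_le_bound _ (Real.sqrt_nonneg _) fun k => ?_
    have h1 : ‖((c : ℂ) • (1 : H →L[ℂ] H) - X) k‖ ^ 2 ≤ (c ^ 2 + M ^ 2) * ‖k‖ ^ 2 := by
      have : ((c : ℂ) • (1 : H →L[ℂ] H) - X) k = (c : ℂ) • k - X k := by simp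
      rw [this, @norm_sub_sq ℂ]
      have h2 : RCLike.re (⟪(c : ℂ) • k, X k⟫_ℂ) = c * (⟪k, X k⟫_ℂ).re := by
        rw [inner_smul_left]; simp
      rw [h2, norm_smul]
      have h3 : ‖X k‖ ≤ M * ‖k‖ := X.le_opNorm k
      have h4 : ‖(c : ℂ)‖ = c := by simp [abs_of_nonneg hc]
      rw [h4]
      have h5 := mul_nonneg hc (hX k)
      have h6 : ‖X k‖ ^ 2 ≤ (M * ‖k‖) ^ 2 := by gcongr
      nlinarith
    have h7 : ‖((c : ℂ) • (1 : H →L[ℂ] H) - X) k‖ ≤ Real.sqrt ((c ^ 2 + M ^ 2) * ‖k‖ ^ 2) :=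
      Real.le_sqrt_of_sq_le h1
    rwa [Real.sqrt_mul (by positivity), Real.sqrt_sq (norm_nonneg _)] at h7
  by_contra hneg
  push Not at hneg
  set d := -(G X).re with hd
  have hdpos : 0 < d := by linarith
  have : ∀ c : ℝ, 0 ≤ c → (c + d) ^ 2 ≤ c ^ 2 + M ^ 2 := by
    intro c hc
    have h1 : ‖G ((c : ℂ) • (1 : H →L[ℂ] H) - X)‖ ≤ Real.sqrt (c ^ 2 + M ^ 2) := by
      calc _ ≤ ‖G‖ * ‖(c : ℂ) • (1 : H →L[ℂ] H) - X‖ := G.le_opNorm _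
        _ ≤ 1 * Real.sqrt (c ^ 2 + M ^ 2) := by
          gcongr
          · exact hG.1
          · exact key c hc
        _ = _ := one_mul _
    have h2 : c + d ≤ ‖G ((c : ℂ) • (1 : H →L[ℂ] H) - X)‖ := by
      refine le_trans ?_ (Complex.re_le_norm _)
      simp [hG.2, hd]
    calc (c + d) ^ 2 ≤ (Real.sqrt (c ^ 2 + M ^ 2)) ^ 2 := by
          gcongr; exact h2.trans h1
      _ = _ := Real.sq_sqrt (by positivity)
  have h := this (M ^ 2 / d) (by positivity)
  have e : M ^ 2 / d * d = M ^ 2 := by field_simp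
  nlinarith [sq_nonneg M, sq_nonneg d, mul_pos hdpos hdpos]

theorem StateBH.nonneg {G : (H →L[ℂ] H) →L[ℂ] ℂ} (hG : StateBH H G) (X : H →L[ℂ] H) :
    0 ≤ G (star X * X) := by
  have hk : ∀ k : H, ⟪k, (star X * X) k⟫_ℂ = (‖X k‖ ^ 2 : ℝ) := by
    intro k
    simp only [mul_apply_eq_comp, ContinuousLinearMap.comp_apply, ContinuousLinearMap.star_eq_adjoint,
      ContinuousLinearMap.adjoint_inner_right]
    rw [inner_self_eq_norm_sq_to_K]; simp
  rw [Complex.nonneg_iff]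
  refine ⟨hG.re_nonneg _ fun k => ?_, ?_⟩
  · rw [hk, Complex.ofReal_re]; positivity
  · have h1 := hG.re_nonneg (Complex.I • (star X * X)) fun k => by
      rw [smul_apply, inner_smul_right, hk]; simp [-Complex.ofReal_pow]
    have h2 := hG.re_nonneg ((-Complex.I) • (star X * X)) fun k => by
      rw [smul_apply, inner_smul_right, hk]; simp [-Complex.ofReal_pow]
    simp at h1 h2
    linarith

theorem StateBH.norm_le {G : (H →L[ℂ] H) →L[ℂ] ℂ} (hG : StateBH H G) (X : H →L[ℂ] H) :
    ‖G X‖ ≤ ‖X‖ := by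
  calc _ ≤ ‖G‖ * ‖X‖ := G.le_opNorm _
    _ ≤ 1 * ‖X‖ := by gcongr; exact hG.1
    _ = _ := one_mul _

/-- finite families: a state on `B(H)` is approximated by sums of vector functionals with vectors
in a dense set. -/
theorem StateBH.approx {G : (H →L[ℂ] H) →L[ℂ] ℂ} (hG : StateBH H G) (Y : Set H) (hY : Dense Y)
    {ι : Type*} [Fintype ι] (x : ι → (H →L[ℂ] H)) (ε : ℝ) (hε : 0 < ε) :
    ∃ (q : ℕ) (k : Fin q → H), (∀ s, k s ∈ Y) ∧ ∀ i, ‖G (x i) - ∑ s, ⟪k s, x i (k s)⟫_ℂ‖ < ε := by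
  classical
  let C : Set (ι → ℂ) := (AddSubmonoid.closure
    {f : ι → ℂ | ∃ (t : ℝ) (k : H), 0 ≤ t ∧ f = fun i => (t : ℂ) * ⟪k, x i k⟫_ℂ} : AddSubmonoid (ι → ℂ))
  have hCsmul : ∀ f ∈ C, ∀ t : ℝ, 0 ≤ t → t • f ∈ C := by
    intro f hf t ht
    induction hf using AddSubmonoid.closure_induction with
    | mem f hf =>
      obtain ⟨t', k, ht', rfl⟩ := hf
      refine AddSubmonoid.subset_closure ⟨t * t', k, by positivity, ?_⟩
      ext i; simp [mul_assoc]
    | zero => rw [smul_zero]; exact AddSubmonoid.zero_mem _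
    | add f g _ _ h1 h2 => rw [smul_add]; exact AddSubmonoid.add_mem _ h1 h2
  have hCconv : Convex ℝ C := by
    intro f hf g hg a b ha hb _
    exact AddSubmonoid.add_mem _ (hCsmul f hf a ha) (hCsmul g hg b hb)
  -- G values in closure
  have hmem : (fun i => G (x i)) ∈ closure C := by
    by_contra hn
    obtain ⟨f, u, hf1, hf2⟩ := RCLike.geometric_hahn_banach_closed_point (𝕜 := ℂ)
      hCconv.closure isClosed_closure hn
    set l : ι → ℂ := fun i => f (Pi.single i 1)
    have hl : ∀ y : ι → ℂ, f y = ∑ i, y i * l i := by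
      intro y
      conv_lhs => rw [← Finset.univ_sum_single y]
      rw [map_sum]
      refine Finset.sum_congr rfl fun i _ => ?_
      have : (Pi.single i (y i) : ι → ℂ) = y i • Pi.single i 1 := by
        ext j; by_cases h : j = i
        · subst h; simp
        · simp [h]
      rw [this, map_smul, smul_eq_mul]
    have hu : 0 < u := by
      have := hf1 0 (subset_closure (AddSubmonoid.zero_mem _))
      simpa using this
    -- all elements of C have re f ≤ 0
    have hneg : ∀ c ∈ C, (f c).re ≤ 0 := by
      intro c hc
      by_contra hp
      push Not at hp
      have h1 := hf1 _ (subset_closure (hCsmul c hc (u / (f c).re) (by positivity)))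
      have h2 : f ((u / (f c).re) • c) = ((u / (f c).re : ℝ) : ℂ) * f c := by
        rw [← Complex.coe_smul, map_smul, smul_eq_mul]
      rw [h2] at h1
      simp only [RCLike.re_to_complex, Complex.re_ofReal_mul] at h1
      rw [div_mul_cancel₀ _ hp.ne'] at h1
      exact lt_irrefl _ h1
    have h3 := hG.re_nonneg (-(∑ i, l i • x i)) fun k => by
      have := hneg _ (AddSubmonoid.subset_closure ⟨1, k, zero_le_one, rfl⟩)
      rw [hl] at this
      simp only [neg_apply, inner_neg_right, sum_apply,
        inner_sum, smul_apply, inner_smul_right]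
      simp only [Complex.ofReal_one, one_mul] at this
      simp_rw [mul_comm (l _)]
      simpa using this
    have h4 : f (fun i => G (x i)) = G (∑ i, l i • x i) := by
      rw [hl]; simp [mul_comm]
    rw [h4] at hf2
    simp only [RCLike.re_to_complex] at hf2
    rw [map_neg, Complex.neg_re] at h3
    linarith
  -- elements of C have desired approximations
  have hC : ∀ f ∈ C, ∀ δ : ℝ, 0 < δ → ∃ (q : ℕ) (k : Fin q → H), (∀ s, k s ∈ Y) ∧
      ∀ i, ‖f i - ∑ s, ⟪k s, x i (k s)⟫_ℂ‖ < δ := by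
    intro f hf
    induction hf using AddSubmonoid.closure_induction with
    | mem f hf =>
      obtain ⟨t, k, ht, rfl⟩ := hf
      intro δ hδ
      have hcont : ∀ i, Continuous fun k : H => ⟪k, x i k⟫_ℂ := fun i => by fun_prop
      set k' : H := (Real.sqrt t : ℂ) • k
      have hk' : ∀ i, ⟪k', x i k'⟫_ℂ = (t : ℂ) * ⟪k, x i k⟫_ℂ := by
        intro i
        simp only [k', map_smul, inner_smul_left, inner_smul_right, Complex.conj_ofReal]
        rw [← mul_assoc, ← Complex.ofReal_mul, Real.mul_self_sqrt ht]
      have hopen : IsOpen {y : H | ∀ i, ‖(t : ℂ) * ⟪k, x i k⟫_ℂ - ⟪y, x i y⟫_ℂ‖ < δ} := by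
        simp only [Set.ofPred_forall]
        refine isOpen_iInter_of_finite fun i => ?_
        have := hcont i
        exact isOpen_lt (by fun_prop) continuous_const
      obtain ⟨y, hy1, hy2⟩ := hY.exists_mem_open hopen ⟨k', fun i => by rw [hk']; simpa using hδ⟩
      refine ⟨1, fun _ => y, fun _ => hy1, fun i => ?_⟩
      simpa using hy2 i
    | zero => intro δ hδ; exact ⟨0, Fin.elim0, fun s => s.elim0, fun i => by simpa using hδ⟩
    | add f g _ _ h1 h2 =>
      intro δ hδ
      obtain ⟨q1, k1, a1, b1⟩ := h1 (δ / 2) (by positivity)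
      obtain ⟨q2, k2, a2, b2⟩ := h2 (δ / 2) (by positivity)
      refine ⟨q1 + q2, Fin.append k1 k2, fun s => ?_, fun i => ?_⟩
      · refine Fin.addCases (fun s => ?_) (fun s => ?_) s
        · rw [Fin.append_left]; exact a1 s
        · rw [Fin.append_right]; exact a2 s
      · rw [Fin.sum_univ_add]
        simp only [Fin.append_left, Fin.append_right, Pi.add_apply]
        rw [add_sub_add_comm]
        refine (norm_add_le _ _).trans_lt ?_
        linarith [b1 i, b2 i]
  obtain ⟨f, hf, hfd⟩ := Metric.mem_closure_iff.1 hmem (ε / 2) (by positivity)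
  obtain ⟨q, k, h1, h2⟩ := hC f hf (ε / 2) (by positivity)
  refine ⟨q, k, h1, fun i => ?_⟩
  have h3 : ‖G (x i) - f i‖ < ε / 2 := by
    rw [← dist_eq_norm]; exact (dist_le_pi_dist _ _ i).trans_lt hfd
  calc _ = ‖(G (x i) - f i) + (f i - ∑ s, ⟪k s, x i (k s)⟫_ℂ)‖ := by congr 1; ring
    _ ≤ _ := norm_add_le _ _
    _ < ε := by linarith [h2 i]
end NumRange

/-- Gram decomposition. -/
theorem gram_decomp {ι : Type*} [Fintype ι] (M : ι → ι → ℂ)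
    (hM : ∀ x : ι → ℂ, 0 ≤ ∑ i, ∑ j, conj (x i) * x j * M i j) :
    ∃ B : ι → ι → ℂ, ∀ i j, M i j = ∑ k, conj (B k i) * B k j := by
  classical
  have h : (Matrix.of M).PosSemidef := by
    refine Matrix.PosSemidef.of_dotProduct_mulVec_nonneg ?_ ?_
    · have hS : ∀ (i j : ι) (c : ℂ), 0 ≤ M i i + c * M i j + conj c * M j i + conj c * c * M j j := by
        intro i j c
        have := hM (Pi.single i 1 + Pi.single j c)
        simp only [Pi.add_apply, map_add, Pi.single_apply, apply_ite (starRingEnd ℂ), map_one, map_zero,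
          add_mul, mul_add, ite_mul, mul_ite, one_mul, mul_one, zero_mul, mul_zero,
          Finset.sum_add_distrib, Finset.sum_ite_eq', Finset.mem_univ, if_true,
          Finset.sum_const_zero, Finset.sum_ite_irrel] at this
        convert this using 1; ring
      have hd : ∀ i, (M i i).im = 0 := fun i => by
        have := (Complex.nonneg_iff.1 (hS i i 0)).2
        simpa using this.symm
      ext i j
      have h1 := (Complex.nonneg_iff.1 (hS i j 1)).2
      have h2 := (Complex.nonneg_iff.1 (hS i j Complex.I)).2
      simp [hd] at h1 h2
      simp only [Matrix.conjTranspose_apply, Matrix.of_apply]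
      apply Complex.ext
      · simp; linarith
      · simp; linarith
    · intro x
      convert hM x using 1
      simp [dotProduct, Matrix.mulVec, Finset.mul_sum]
      refine Finset.sum_congr rfl fun i _ => Finset.sum_congr rfl fun j _ => ?_
      ring
  obtain ⟨B, hB⟩ : ∃ B : Matrix ι ι ℂ, Matrix.of M = B.conjTranspose * B := by
    open scoped MatrixOrder in
    exact CStarAlgebra.nonneg_iff_eq_star_mul_self.mp h.nonneg
  refine ⟨B, fun i j => ?_⟩
  have := congrFun (congrFun hB i) j
  simpa [Matrix.mul_apply] using this

open Set in
theorem isCompact_convexHull_iUnion {E : Type*} [AddCommGroup E] [Module ℝ E] [TopologicalSpace E]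
    [IsTopologicalAddGroup E] [ContinuousSMul ℝ E] {ι : Type*} (s : Finset ι) (C : ι → Set E)
    (h1 : ∀ i ∈ s, IsCompact (C i)) (h2 : ∀ i ∈ s, Convex ℝ (C i)) :
    IsCompact (convexHull ℝ (⋃ i ∈ s, C i)) := by
  classical
  induction s using Finset.induction_on with
  | empty => simp
  | insert a s ha ih =>
    have ih' := ih (fun i hi => h1 i (Finset.mem_insert_of_mem hi))
      (fun i hi => h2 i (Finset.mem_insert_of_mem hi))
    rw [Finset.set_biUnion_insert]
    rcases (C a).eq_empty_or_nonempty with he | hne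
    · rw [he, empty_union]; exact ih'
    rcases (⋃ i ∈ s, C i).eq_empty_or_nonempty with he | hne'
    · rw [he, union_empty, (h2 a (Finset.mem_insert_self a s)).convexHull_eq]
      exact h1 a (Finset.mem_insert_self a s)
    rw [convexHull_union hne hne', (h2 a (Finset.mem_insert_self a s)).convexHull_eq]
    have : convexJoin ℝ (C a) (convexHull ℝ (⋃ i ∈ s, C i)) =
        (fun p : ℝ × E × E => (1 - p.1) • p.2.1 + p.1 • p.2.2) ''
          (Icc (0:ℝ) 1 ×ˢ (C a ×ˢ (convexHull ℝ (⋃ i ∈ s, C i)))) := by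
      ext x
      simp only [mem_convexJoin, segment_eq_image, mem_image, mem_prod, Prod.exists]
      constructor
      · rintro ⟨y, hy, z, hz, t, ht, rfl⟩; exact ⟨t, y, z, ⟨ht, hy, hz⟩, rfl⟩
      · rintro ⟨t, y, z, ⟨ht, hy, hz⟩, rfl⟩; exact ⟨y, hy, z, hz, t, ht, rfl⟩
    rw [this]
    exact (isCompact_Icc.prod ((h1 a (Finset.mem_insert_self a s)).prod ih')).image (by fun_prop)

/-- Milman's partial converse in a product of copies of `ℂ`. -/
theorem milman_pi {X : Type*} (E B : Set (X → ℂ)) (hE : IsCompact E) (hEc : Convex ℝ E)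
    (hB : B ⊆ E) (g : X → ℂ) (hg : g ∈ E.extremePoints ℝ) (hgB : g ∈ closure (convexHull ℝ B)) :
    g ∈ closure B := by
  classical
  by_contra hn
  obtain ⟨U, hU, hUB⟩ : ∃ U ∈ nhds g, U ∩ B = ∅ := by
    rw [mem_closure_iff_nhds] at hn
    push Not at hn
    obtain ⟨U, hU, h⟩ := hn
    exact ⟨U, hU, by simpa [Set.not_nonempty_iff_eq_empty] using h⟩
  rw [nhds_pi, Filter.mem_pi] at hU
  obtain ⟨I, hI, t, ht, htU⟩ := hU
  obtain ⟨ε, hε, hεt⟩ : ∃ ε > 0, ∀ i ∈ I, Metric.ball (g i) ε ⊆ t i := by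
    choose e he1 he2 using fun i => Metric.mem_nhds_iff.1 (ht i)
    rcases I.eq_empty_or_nonempty with h0 | h0
    · exact ⟨1, one_pos, by simp [h0]⟩
    · obtain ⟨j, hj, hj'⟩ := hI.exists_minimalFor e I h0
      refine ⟨e j, he1 j, fun i hi => (Metric.ball_subset_ball ?_).trans (he2 i)⟩
      by_contra hlt; push Not at hlt
      exact absurd (hj' hi hlt.le) (not_le.2 hlt)
  -- functionals
  let L : (X × Fin 4) → (X → ℂ) → ℝ := fun p f =>
    ![(f p.1).re - (g p.1).re, (g p.1).re - (f p.1).re, (f p.1).im - (g p.1).im,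
      (g p.1).im - (f p.1).im] p.2
  let C : (X × Fin 4) → Set (X → ℂ) := fun p => E ∩ {f | ε / 2 ≤ L p f}
  have hLc : ∀ p, Continuous (L p) := by
    rintro ⟨x, i⟩
    fin_cases i <;> simp [L] <;> fun_prop
  have hLconv : ∀ p, Convex ℝ {f | ε / 2 ≤ L p f} := by
    rintro ⟨x, i⟩ f hf f' hf' a b ha hb hab
    fin_cases i <;> simp [L] at hf hf' ⊢ <;> obtain rfl : b = 1 - a := by linarith
    all_goals nlinarith
  let S : Finset (X × Fin 4) := hI.toFinset ×ˢ Finset.univ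
  have hcomp := isCompact_convexHull_iUnion S C
    (fun p _ => hE.inter_right (isClosed_le continuous_const (hLc p)))
    (fun p _ => hEc.inter (hLconv p))
  have hsubE : convexHull ℝ (⋃ p ∈ S, C p) ⊆ E :=
    convexHull_min (Set.iUnion₂_subset fun p _ => Set.inter_subset_left) hEc
  have hBsub : B ⊆ ⋃ p ∈ S, C p := by
    intro b hb
    by_contra hnb
    have : b ∈ U ∩ B := by
      refine ⟨htU fun i hi => hεt i hi ?_, hb⟩
      have hnb' : ∀ k : Fin 4, L (i, k) b < ε / 2 := by
        intro k
        by_contra hc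
        push Not at hc
        refine hnb (Set.mem_iUnion₂.2 ⟨(i, k), ?_, hB hb, hc⟩)
        simp [S, hi]
      have h0 := hnb' 0
      have h1 := hnb' 1
      have h2 := hnb' 2
      have h3 := hnb' 3
      simp [L] at h0 h1 h2 h3
      rw [Metric.mem_ball, dist_eq_norm]
      refine (Complex.norm_le_abs_re_add_abs_im _).trans_lt ?_
      simp only [Complex.sub_re, Complex.sub_im]
      have := abs_lt.2 (⟨by linarith, h0⟩ : -(ε/2) < (b i).re - (g i).re ∧ _)
      have := abs_lt.2 (⟨by linarith, h2⟩ : -(ε/2) < (b i).im - (g i).im ∧ _)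
      linarith
    rw [hUB] at this
    exact this
  have hgQ : g ∈ convexHull ℝ (⋃ p ∈ S, C p) :=
    closure_minimal (convexHull_mono hBsub) hcomp.isClosed hgB
  have hext : g ∈ (convexHull ℝ (⋃ p ∈ S, C p)).extremePoints ℝ :=
    inter_extremePoints_subset_extremePoints_of_subset hsubE ⟨hgQ, hg⟩
  have := extremePoints_convexHull_subset hext
  obtain ⟨p, _, hp⟩ := Set.mem_iUnion₂.1 this
  have := hp.2
  obtain ⟨x, i⟩ := p
  fin_cases i <;> simp [L] at this <;> linarith

/-- Recurrence in a torus. -/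
theorem torus_recurrence {r : ℕ} (z : Fin r → Circle) (U : Set (Fin r → Circle)) (hU : U ∈ nhds 1) :
    ∃ k : ℕ, z ^ (k + 1) ∈ U := by
  obtain ⟨y, -, φ, hφ, hlim⟩ := (isCompact_univ (X := Fin r → Circle)).tendsto_subseq
    (x := fun k : ℕ => z ^ k) (fun _ => Set.mem_univ _)
  have h1 : Filter.Tendsto (fun k => (z ^ φ (k + 1)) * (z ^ φ k)⁻¹) Filter.atTop (nhds (y * y⁻¹)) :=
    (hlim.comp (Filter.tendsto_add_atTop_nat 1)).mul hlim.inv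
  rw [mul_inv_cancel] at h1
  obtain ⟨k, hk⟩ := (h1.eventually hU).exists
  have h2 : φ k < φ (k + 1) := hφ (Nat.lt_succ_self k)
  refine ⟨φ (k + 1) - φ k - 1, ?_⟩
  have h3 : φ (k + 1) - φ k - 1 + 1 = φ (k + 1) - φ k := by omega
  rw [h3, pow_sub _ h2.le]
  exact hk
end Part1

section Part2
set_option linter.unusedSectionVars false
set_option linter.unusedVariables false

open scoped ComplexOrder InnerProductSpace ComplexConjugate

section CS
theorem cs_scalar (α β γ δ : ℂ) (hα : 0 ≤ α)
    (h : ∀ l : ℂ, 0 ≤ conj l * l * α + conj l * β + l * γ + δ) : ‖β‖ ^ 2 ≤ α.re * δ.re := by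
  have hδ : 0 ≤ δ := by simpa using h 0
  have hα' := Complex.nonneg_iff.1 hα
  have hδ' := Complex.nonneg_iff.1 hδ
  have h1 := (Complex.nonneg_iff.1 (h 1)).2
  have h2 := (Complex.nonneg_iff.1 (h Complex.I)).2
  simp [← hα'.2, ← hδ'.2] at h1 h2
  have hγ : γ = conj β := by
    apply Complex.ext
    · simp; linarith
    · simp; linarith
  have hq : ∀ s : ℝ, 0 ≤ (‖β‖ ^ 2 * α.re) * (s * s) + (-2 * ‖β‖ ^ 2) * s + δ.re := by
    intro s
    have h3 := (Complex.nonneg_iff.1 (h (-(s : ℂ) * β))).1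
    have h4 : conj β * β = ((‖β‖ ^ 2 : ℝ) : ℂ) := by
      rw [mul_comm, Complex.mul_conj, Complex.normSq_eq_norm_sq]
    have h5 : conj (-(s : ℂ) * β) * (-(s : ℂ) * β) * α + conj (-(s : ℂ) * β) * β
        + (-(s : ℂ) * β) * γ + δ = ((s * s * ‖β‖ ^ 2 : ℝ) : ℂ) * α - ((2 * s * ‖β‖ ^ 2 : ℝ) : ℂ) + δ := by
      rw [hγ]
      simp only [map_mul, map_neg, Complex.conj_ofReal]
      push_cast
      push_cast at h4
      linear_combination (s * s * α - 2 * s : ℂ) * h4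
    rw [h5] at h3
    simp only [Complex.add_re, Complex.sub_re, Complex.re_ofReal_mul, Complex.ofReal_re] at h3
    linarith
  rcases eq_or_ne β 0 with hb | hb
  · subst hb; simp; exact mul_nonneg hα'.1 hδ'.1
  · have := discrim_le_zero hq
    unfold discrim at this
    have hp : 0 < ‖β‖ ^ 2 := by positivity
    nlinarith
end CS

section State
variable {H : Type*} [NormedAddCommGroup H] [InnerProductSpace ℂ H] [CompleteSpace H]

theorem StateBH.gram_nonneg {G : (H →L[ℂ] H) →L[ℂ] ℂ} (hG : StateBH H G) {ι : Type*} [Fintype ι]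
    (X : ι → (H →L[ℂ] H)) (x : ι → ℂ) :
    0 ≤ ∑ i, ∑ j, conj (x i) * x j * G (star (X i) * X j) := by
  have := hG.nonneg (∑ i, x i • X i)
  convert this using 1
  simp only [star_sum, star_smul, Finset.sum_mul, Finset.mul_sum, smul_mul_smul_comm, map_sum, map_smul, smul_eq_mul]
  rw [Finset.sum_comm]
  rfl

theorem StateBH.gram {G : (H →L[ℂ] H) →L[ℂ] ℂ} (hG : StateBH H G) {ι : Type*} [Fintype ι]
    (X : ι → (H →L[ℂ] H)) : ∃ B : ι → ι → ℂ, ∀ i j,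
      G (star (X i) * X j) = ∑ k, conj (B k i) * B k j :=
  gram_decomp _ (hG.gram_nonneg X)

theorem StateBH.schur {G : (H →L[ℂ] H) →L[ℂ] ℂ} (hG : StateBH H G) {ι : Type*} [Fintype ι]
    (X Y : ι → (H →L[ℂ] H)) (x : ι → ℂ) :
    0 ≤ ∑ i, ∑ j, conj (x i) * x j * (G (star (X i) * X j) * G (star (Y i) * Y j)) := by
  obtain ⟨B, hB⟩ := hG.gram X
  have : ∑ i, ∑ j, conj (x i) * x j * (G (star (X i) * X j) * G (star (Y i) * Y j))
      = ∑ k, ∑ i, ∑ j, conj (x i * B k i) * (x j * B k j) * G (star (Y i) * Y j) := by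
    symm
    rw [Finset.sum_comm]
    refine Finset.sum_congr rfl fun i _ => ?_
    rw [Finset.sum_comm]
    refine Finset.sum_congr rfl fun j _ => ?_
    rw [hB, Finset.sum_mul, Finset.mul_sum]
    refine Finset.sum_congr rfl fun k _ => ?_
    rw [map_mul]; ring
  rw [this]
  exact Finset.sum_nonneg fun k _ => hG.gram_nonneg Y _
end State

section Core
variable {r : ℕ} {A : Type*} [Ring A] [StarRing A] [Algebra ℂ A] [StarModule ℂ A]
  {D : Type*} [Ring D] [StarRing D] [Algebra ℂ D] [StarModule ℂ D]
  {H : Type*} [NormedAddCommGroup H] [InnerProductSpace ℂ H] [CompleteSpace H]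

structure GradedCond (𝒢 : (Fin r → ℤ) → Submodule ℂ A) : Prop where
  one : (1 : A) ∈ 𝒢 0
  mul : ∀ {n m a b}, a ∈ 𝒢 n → b ∈ 𝒢 m → a * b ∈ 𝒢 (n + m)
  star' : ∀ {n a}, a ∈ 𝒢 n → star a ∈ 𝒢 (-n)
  bd : ∀ n, ∀ a ∈ 𝒢 n, a ∈ Submodule.span ℂ
    {m : A | m ∈ 𝒢 n ∧ ∃ q ∈ 𝒢 0, star m * m + star q * q = 1}

theorem GradedCond.smul_mul {𝒢 : (Fin r → ℤ) → Submodule ℂ A} (h : GradedCond 𝒢) {n m a b}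
    (ha : a ∈ 𝒢 n) (hb : b ∈ 𝒢 m) : star a * b ∈ 𝒢 (m - n) := by
  have := h.mul (h.star' ha) hb
  rwa [neg_add_eq_sub] at this

structure PD (𝒢 : (Fin r → ℤ) → Submodule ℂ A) (h : (Fin r → ℤ) × A × D → ℂ) : Prop where
  zero : ∀ n a T, a ∉ 𝒢 n → h (n, a, T) = 0
  add_left : ∀ n a b T, a ∈ 𝒢 n → b ∈ 𝒢 n → h (n, a + b, T) = h (n, a, T) + h (n, b, T)
  smul_left : ∀ n (c : ℂ) a T, a ∈ 𝒢 n → h (n, c • a, T) = c * h (n, a, T)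
  add_right : ∀ n a S T, h (n, a, S + T) = h (n, a, S) + h (n, a, T)
  smul_right : ∀ n a (c : ℂ) T, h (n, a, c • T) = c * h (n, a, T)
  pos : ∀ (ι : Type) [Fintype ι] (n : ι → (Fin r → ℤ)) (a : ι → A) (T : ι → D),
    (∀ i, a i ∈ 𝒢 (n i)) →
      0 ≤ ∑ i, ∑ j, h (n j - n i, star (a i) * a j, star (T i) * T j)

variable {𝒢 : (Fin r → ℤ) → Submodule ℂ A}

theorem PD.pos1 {h : (Fin r → ℤ) × A × D → ℂ} (hh : PD 𝒢 h) (n a T) (ha : a ∈ 𝒢 n) :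
    0 ≤ h (0, star a * a, star T * T) := by
  have := hh.pos Unit (fun _ => n) (fun _ => a) (fun _ => T) (fun _ => ha)
  simpa using this

theorem PD.add {h h' : (Fin r → ℤ) × A × D → ℂ} (hh : PD 𝒢 h) (hh' : PD 𝒢 h') : PD 𝒢 (h + h') where
  zero n a T ha := by simp [hh.zero n a T ha, hh'.zero n a T ha]
  add_left n a b T ha hb := by
    simp only [Pi.add_apply, hh.add_left n a b T ha hb, hh'.add_left n a b T ha hb]; ring
  smul_left n c a T ha := by
    simp only [Pi.add_apply, hh.smul_left n c a T ha, hh'.smul_left n c a T ha]; ring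
  add_right n a S T := by simp only [Pi.add_apply, hh.add_right, hh'.add_right]; ring
  smul_right n a c T := by simp only [Pi.add_apply, hh.smul_right, hh'.smul_right]; ring
  pos ι _ n a T ha := by
    simp only [Pi.add_apply, Finset.sum_add_distrib]
    exact add_nonneg (hh.pos ι n a T ha) (hh'.pos ι n a T ha)

theorem PD.zero' : PD 𝒢 (0 : (Fin r → ℤ) × A × D → ℂ) where
  zero n a T ha := rfl
  add_left n a b T ha hb := by simp
  smul_left n c a T ha := by simp
  add_right n a S T := by simp
  smul_right n a c T := by simp
  pos ι _ n a T ha := by simp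

theorem PD.smul {h : (Fin r → ℤ) × A × D → ℂ} (hh : PD 𝒢 h) {t : ℝ} (ht : 0 ≤ t) : PD 𝒢 (t • h) where
  zero n a T ha := by simp [hh.zero n a T ha]
  add_left n a b T ha hb := by
    simp only [Pi.smul_apply, hh.add_left n a b T ha hb, smul_add]
  smul_left n c a T ha := by
    simp only [Pi.smul_apply, hh.smul_left n c a T ha, Complex.real_smul]; ring
  add_right n a S T := by simp only [Pi.smul_apply, hh.add_right, smul_add]
  smul_right n a c T := by simp only [Pi.smul_apply, hh.smul_right, Complex.real_smul]; ring
  pos ι _ n a T ha := by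
    simp only [Pi.smul_apply, ← Finset.smul_sum]
    exact smul_nonneg ht (hh.pos ι n a T ha)

theorem PD.cs (h𝒢 : GradedCond 𝒢) {h : (Fin r → ℤ) × A × D → ℂ} (hh : PD 𝒢 h) (n a T) (ha : a ∈ 𝒢 n) :
    ‖h (n, a, T)‖ ^ 2 ≤ (h (0, 1, 1)).re * (h (0, star a * a, star T * T)).re := by
  have h1 : 0 ≤ h (0, 1, 1) := by simpa using hh.pos1 0 1 1 h𝒢.one
  refine cs_scalar _ _ (h (-n, star a, star T)) _ h1 fun l => ?_
  have := hh.pos Bool (fun b => cond b n 0) (fun b => cond b a (l • 1)) (fun b => cond b T 1) (by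
    rintro (_ | _)
    · exact Submodule.smul_mem _ _ h𝒢.one
    · exact ha)
  simp only [Fintype.sum_bool, cond_true, cond_false, sub_self, sub_zero, zero_sub, neg_zero, star_smul, star_one,
    smul_mul_assoc, mul_smul_comm, one_mul, mul_one] at this
  rw [hh.smul_left (-n) _ _ _ (h𝒢.star' ha), hh.smul_left n _ _ _ ha,
    hh.smul_left 0 _ _ _ (Submodule.smul_mem _ _ h𝒢.one), hh.smul_left 0 _ _ _ h𝒢.one] at this
  convert this using 1
  simp only [Complex.star_def]
  ring

/-- the state space -/
def EE (𝒢 : (Fin r → ℤ) → Submodule ℂ A) (D : Type*) [Ring D] [StarRing D] [Algebra ℂ D] :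
    Set ((Fin r → ℤ) × A × D → ℂ) := {h | PD 𝒢 h ∧ h (0, 1, 1) = 1}

theorem EE_bound (h𝒢 : GradedCond 𝒢)
    (hsq : ∀ T : D, ∃ (c : ℝ) (R : D), star T * T + star R * R = (c : ℂ) • 1)
    (x : (Fin r → ℤ) × A × D) : ∃ C : ℝ, ∀ h ∈ EE 𝒢 D, ‖h x‖ ≤ C := by
  obtain ⟨n, a, T⟩ := x
  by_cases ha : a ∈ 𝒢 n
  swap
  · exact ⟨0, fun h hh => by rw [hh.1.zero n a T ha]; simp⟩
  have hle : Submodule.span ℂ {m : A | m ∈ 𝒢 n ∧ ∃ q ∈ 𝒢 0, star m * m + star q * q = 1} ≤ 𝒢 n :=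
    Submodule.span_le.2 fun m hm => hm.1
  have := h𝒢.bd n a ha
  clear ha
  induction this using Submodule.span_induction with
  | mem m hm =>
    obtain ⟨hm, q, hq, hmq⟩ := hm
    obtain ⟨c, R, hR⟩ := hsq T
    refine ⟨Real.sqrt c, fun h hh => ?_⟩
    have h1 := hh.1.cs h𝒢 n m T hm
    have h00 : star m * m ∈ 𝒢 0 := by simpa using h𝒢.smul_mul hm hm
    have h01 : star q * q ∈ 𝒢 0 := by simpa using h𝒢.smul_mul hq hq
    have h2 := hh.1.add_left 0 _ _ (star T * T) h00 h01
    rw [hmq] at h2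
    have h3 := hh.1.add_right 0 1 (star T * T) (star R * R)
    rw [hR, hh.1.smul_right, hh.2] at h3
    have h4 := (Complex.nonneg_iff.1 (hh.1.pos1 0 q T hq)).1
    have h5 := (Complex.nonneg_iff.1 (hh.1.pos1 0 1 R h𝒢.one)).1
    rw [star_one, one_mul] at h5
    have h2' := congrArg Complex.re h2
    have h3' := congrArg Complex.re h3
    simp only [Complex.add_re, mul_one, Complex.ofReal_re] at h2' h3'
    rw [hh.2, Complex.one_re, one_mul] at h1
    apply Real.le_sqrt_of_sq_le
    linarith
  | zero => exact ⟨0, fun h hh => by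
      have := hh.1.smul_left n 0 0 T (Submodule.zero_mem _)
      simp at this; simp [this]⟩
  | add a b ha hb h1 h2 =>
    obtain ⟨C1, h1⟩ := h1
    obtain ⟨C2, h2⟩ := h2
    refine ⟨C1 + C2, fun h hh => ?_⟩
    rw [hh.1.add_left n a b T (hle ha) (hle hb)]
    exact (norm_add_le _ _).trans (add_le_add (h1 h hh) (h2 h hh))
  | smul c a ha h1 =>
    obtain ⟨C1, h1⟩ := h1
    refine ⟨‖c‖ * C1, fun h hh => ?_⟩
    rw [hh.1.smul_left n c a T (hle ha), norm_mul]
    exact mul_le_mul_of_nonneg_left (h1 h hh) (norm_nonneg _)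

theorem EE_convex : Convex ℝ (EE 𝒢 D) := by
  intro h hh h' hh' a b ha hb hab
  refine ⟨(hh.1.smul ha).add (hh'.1.smul hb), ?_⟩
  simp [hh.2, hh'.2]
  exact_mod_cast hab

theorem EE_closed : IsClosed (EE 𝒢 D) := by
  have : EE 𝒢 D = {h | (∀ n a T, a ∉ 𝒢 n → h (n, a, T) = 0) ∧
      (∀ n a b T, a ∈ 𝒢 n → b ∈ 𝒢 n → h (n, a + b, T) = h (n, a, T) + h (n, b, T)) ∧
      (∀ n (c : ℂ) a T, a ∈ 𝒢 n → h (n, c • a, T) = c * h (n, a, T)) ∧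
      (∀ n a S T, h (n, a, S + T) = h (n, a, S) + h (n, a, T)) ∧
      (∀ n a (c : ℂ) T, h (n, a, c • T) = c * h (n, a, T)) ∧
      (∀ (ι : Type) (_ : Fintype ι) (n : ι → (Fin r → ℤ)) (a : ι → A) (T : ι → D),
    (∀ i, a i ∈ 𝒢 (n i)) →
      0 ≤ ∑ i, ∑ j, h (n j - n i, star (a i) * a j, star (T i) * T j)) ∧ h (0, 1, 1) = 1} := by
    ext h
    constructor
    · rintro ⟨⟨h1, h2, h3, h4, h5, h6⟩, h7⟩; exact ⟨h1, h2, h3, h4, h5, fun ι _ => h6 ι, h7⟩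
    · rintro ⟨h1, h2, h3, h4, h5, h6, h7⟩; exact ⟨⟨h1, h2, h3, h4, h5, fun ι _ => h6 ι _⟩, h7⟩
  rw [this]
  simp only [Set.ofPred_and, Set.ofPred_forall]
  repeat' apply IsClosed.inter
  all_goals
    repeat' (apply isClosed_iInter; intro)
  any_goals exact isClosed_eq (by fun_prop) (by fun_prop)
  exact isClosed_le continuous_const (by fun_prop)

theorem EE_compact (h𝒢 : GradedCond 𝒢)
    (hsq : ∀ T : D, ∃ (c : ℝ) (R : D), star T * T + star R * R = (c : ℂ) • 1) :
    IsCompact (EE 𝒢 D) := by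
  choose C hC using EE_bound (D := D) h𝒢 hsq
  refine IsCompact.of_isClosed_subset
    (isCompact_univ_pi fun x => isCompact_closedBall (0 : ℂ) (C x)) EE_closed ?_
  intro h hh x _
  simpa using hC x h hh

end Core
end Part2

section Part3
set_option linter.unusedSectionVars false
set_option linter.unusedVariables false

open scoped ComplexOrder InnerProductSpace ComplexConjugate

section Chi
variable {r : ℕ}

noncomputable def chi (z : Fin r → Circle) (n : Fin r → ℤ) : ℂ := ((∏ i, z i ^ n i : Circle) : ℂ)

theorem chi_one (n : Fin r → ℤ) : chi 1 n = 1 := by simp [chi]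
theorem chi_zero (z : Fin r → Circle) : chi z 0 = 1 := by simp [chi]
theorem chi_add (z : Fin r → Circle) (n m) : chi z (n + m) = chi z n * chi z m := by
  simp only [chi, Pi.add_apply, zpow_add, Finset.prod_mul_distrib, Circle.coe_mul]
theorem chi_neg (z : Fin r → Circle) (n) : chi z (-n) = conj (chi z n) := by
  simp only [chi, Pi.neg_apply, zpow_neg, Finset.prod_inv_distrib, Circle.coe_inv_eq_conj]
theorem chi_sub (z : Fin r → Circle) (n m) : chi z (n - m) = conj (chi z m) * chi z n := by
  rw [sub_eq_add_neg, chi_add, chi_neg, mul_comm]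
theorem chi_mul (z w : Fin r → Circle) (n) : chi (z * w) n = chi z n * chi w n := by
  simp only [chi, Pi.mul_apply, mul_zpow, Finset.prod_mul_distrib, Circle.coe_mul]
theorem chi_inv (z : Fin r → Circle) (n) : chi z⁻¹ n = conj (chi z n) := by
  rw [← chi_neg]; simp [chi]
theorem chi_norm (z : Fin r → Circle) (n) : ‖chi z n‖ = 1 := Circle.norm_coe _
theorem chi_conj_mul (z : Fin r → Circle) (n) : conj (chi z n) * chi z n = 1 := by
  rw [← chi_sub, sub_self, chi_zero]
theorem chi_continuous (n : Fin r → ℤ) : Continuous fun z : Fin r → Circle => chi z n := by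
  unfold chi
  have : Continuous fun z : Fin r → Circle => ∏ i, z i ^ n i :=
    continuous_finsetProd _ fun i _ => (continuous_apply i).zpow (n i)
  exact continuous_subtype_val.comp this
end Chi

section Core3
variable {r : ℕ} {A : Type*} [Ring A] [StarRing A] [Algebra ℂ A] [StarModule ℂ A]
  {D : Type*} [Ring D] [StarRing D] [Algebra ℂ D] [StarModule ℂ D]
  {H : Type*} [NormedAddCommGroup H] [InnerProductSpace ℂ H] [CompleteSpace H]

open Classical in
noncomputable def tw (𝒢 : (Fin r → ℤ) → Submodule ℂ A) (z : Fin r → Circle) (v : A → D → ℂ) :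
    (Fin r → ℤ) × A × D → ℂ :=
  fun x => if x.2.1 ∈ 𝒢 x.1 then chi z x.1 * v x.2.1 x.2.2 else 0

variable {𝒢 : (Fin r → ℤ) → Submodule ℂ A}

theorem tw_of_mem (z : Fin r → Circle) (v : A → D → ℂ) {n a} (T) (h : a ∈ 𝒢 n) :
    tw 𝒢 z v (n, a, T) = chi z n * v a T := by simp [tw, h]
theorem tw_of_notMem (z : Fin r → Circle) (v : A → D → ℂ) {n a} (T) (h : a ∉ 𝒢 n) :
    tw 𝒢 z v (n, a, T) = 0 := by simp [tw, h]
theorem tw_add (z : Fin r → Circle) (v w : A → D → ℂ) : tw 𝒢 z (v + w) = tw 𝒢 z v + tw 𝒢 z w := by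
  ext ⟨n, a, T⟩
  by_cases h : a ∈ 𝒢 n
  · simp [tw_of_mem _ _ _ h, mul_add]
  · simp [tw_of_notMem _ _ _ h]
theorem tw_smul (z : Fin r → Circle) (t : ℝ) (v : A → D → ℂ) : tw 𝒢 z (t • v) = t • tw 𝒢 z v := by
  ext ⟨n, a, T⟩
  by_cases h : a ∈ 𝒢 n
  · simp [tw_of_mem _ _ _ h]; ring
  · simp [tw_of_notMem _ _ _ h]
theorem tw_zero (z : Fin r → Circle) : tw 𝒢 z (0 : A → D → ℂ) = 0 := by
  ext ⟨n, a, T⟩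
  by_cases h : a ∈ 𝒢 n
  · simp [tw_of_mem _ _ _ h]
  · simp [tw_of_notMem _ _ _ h]

variable (π : A →⋆ₐ[ℂ] (H →L[ℂ] H)) (τ : D →⋆ₐ[ℂ] (H →L[ℂ] H))

noncomputable def RR (𝒢 : (Fin r → ℤ) → Submodule ℂ A) (G : (H →L[ℂ] H) →L[ℂ] ℂ) :
    (Fin r → ℤ) × A × D → ℂ := tw 𝒢 1 (fun a T => G (π a * τ T))

noncomputable def bas (G : (H →L[ℂ] H) →L[ℂ] ℂ) {ι : Type} [Fintype ι] (c b : ι → A) : A → D → ℂ :=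
  fun a T => ∑ i, ∑ j, G (π (star (c i) * a * c j)) * G (π (star (b i) * b j) * τ T)

def VV (𝒢 : (Fin r → ℤ) → Submodule ℂ A) (G : (H →L[ℂ] H) →L[ℂ] ℂ) : AddSubmonoid (A → D → ℂ) :=
  AddSubmonoid.closure {v | ∃ (ι : Type) (_ : Fintype ι) (e : ι → Fin r → ℤ) (c b : ι → A),
    (∀ i, c i ∈ 𝒢 (e i)) ∧ v = bas π τ G c b}

theorem VV_smul (G : (H →L[ℂ] H) →L[ℂ] ℂ) (t : ℝ) (ht : 0 ≤ t) (v) (hv : v ∈ VV π τ 𝒢 G) :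
    t • v ∈ VV π τ 𝒢 G := by
  unfold VV at hv
  induction hv using AddSubmonoid.closure_induction with
  | mem x hx =>
    obtain ⟨ι, hι, e, c, b, hc, rfl⟩ := hx
    refine AddSubmonoid.subset_closure ⟨ι, hι, e, c, fun i => ((Real.sqrt t : ℝ) : ℂ) • b i, hc, ?_⟩
    funext a T
    simp only [bas, Pi.smul_apply, Finset.smul_sum]
    refine Finset.sum_congr rfl fun i _ => Finset.sum_congr rfl fun j _ => ?_
    rw [star_smul, smul_mul_smul_comm, map_smul, smul_mul_assoc, map_smul, Complex.star_def, Complex.conj_ofReal,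
      ← Complex.ofReal_mul, Real.mul_self_sqrt ht, Complex.real_smul, smul_eq_mul]
    ring
  | zero => rw [smul_zero]; exact zero_mem _
  | add x y _ _ hx hy => rw [smul_add]; exact add_mem hx hy

theorem PD_bas (hcomm : ∀ a T, Commute (π a) (τ T)) (h𝒢 : GradedCond 𝒢) {G : (H →L[ℂ] H) →L[ℂ] ℂ} (hG : StateBH H G)
    (z : Fin r → Circle) {ι : Type} [Fintype ι] (c b : ι → A) : PD 𝒢 (tw 𝒢 z (bas π τ G c b)) where
  zero n a T ha := tw_of_notMem _ _ _ ha
  add_left n a a' T ha ha' := by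
    rw [tw_of_mem _ _ _ ha, tw_of_mem _ _ _ ha', tw_of_mem _ _ _ (add_mem ha ha')]
    simp only [bas, mul_add, add_mul, map_add, Finset.sum_add_distrib]
  smul_left n k a T ha := by
    rw [tw_of_mem _ _ _ ha, tw_of_mem _ _ _ (Submodule.smul_mem _ _ ha)]
    simp only [bas, mul_smul_comm, smul_mul_assoc, map_smul, smul_eq_mul, ← Finset.mul_sum, mul_assoc]
    ring
  add_right n a S T := by
    by_cases ha : a ∈ 𝒢 n
    · simp only [tw_of_mem _ _ _ ha, bas, mul_add, map_add, Finset.sum_add_distrib]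
    · simp only [tw_of_notMem _ _ _ ha, add_zero]
  smul_right n a k T := by
    by_cases ha : a ∈ 𝒢 n
    · simp only [tw_of_mem _ _ _ ha, bas, mul_smul_comm, map_smul, smul_eq_mul, Finset.mul_sum]
      refine Finset.sum_congr rfl fun i _ => Finset.sum_congr rfl fun j _ => ?_
      ring
    · simp only [tw_of_notMem _ _ _ ha, mul_zero]
  pos κ _ n a T ha := by
    have := hG.schur (ι := κ × ι) (fun p => π (a p.1 * c p.2)) (fun p => π (b p.2) * τ (T p.1))
      (fun p => chi z (n p.1))
    convert this using 1
    simp only [Fintype.sum_prod_type]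
    refine Finset.sum_congr rfl fun k _ => ?_
    rw [Finset.sum_comm]
    refine Finset.sum_congr rfl fun l _ => ?_
    rw [tw_of_mem _ _ _ (h𝒢.smul_mul (ha k) (ha l)), bas, Finset.mul_sum]
    refine Finset.sum_congr rfl fun i _ => ?_
    rw [Finset.mul_sum]
    refine Finset.sum_congr rfl fun j _ => ?_
    rw [chi_sub, star_mul, ← map_star, ← map_star, ← map_star]
    congr 3
    · simp only [star_mul, map_mul, mul_assoc]
    · simp only [map_mul]
      have h1 := hcomm (star (b i)) (star (T k))
      have h2 := hcomm (b j) (star (T k))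
      rw [mul_assoc (τ (star (T k))), ← mul_assoc (π (star (b i))), ← mul_assoc _ (π (star (b i)) * π (b j)),
        ← mul_assoc (π (star (b i)) * π (b j))]
      rw [((h1.mul_left h2)).eq]

theorem PD_tw (hcomm : ∀ a T, Commute (π a) (τ T)) (h𝒢 : GradedCond 𝒢) {G : (H →L[ℂ] H) →L[ℂ] ℂ} (hG : StateBH H G)
    (z : Fin r → Circle) (v) (hv : v ∈ VV π τ 𝒢 G) : PD 𝒢 (tw 𝒢 z v) := by
  unfold VV at hv
  induction hv using AddSubmonoid.closure_induction with
  | mem x hx =>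
    obtain ⟨ι, _, e, c, b, hc, rfl⟩ := hx
    exact PD_bas π τ hcomm h𝒢 hG z c b
  | zero => rw [tw_zero]; exact PD.zero'
  | add x y _ _ hx hy => rw [tw_add]; exact hx.add hy

theorem RR_mem_EE (hcomm : ∀ a T, Commute (π a) (τ T)) (h𝒢 : GradedCond 𝒢) {G : (H →L[ℂ] H) →L[ℂ] ℂ} (hG : StateBH H G) :
    RR π τ 𝒢 G ∈ EE 𝒢 D := by
  refine ⟨⟨fun n a T ha => tw_of_notMem _ _ _ ha, ?_, ?_, ?_, ?_, ?_⟩, ?_⟩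
  · intro n a b T ha hb
    simp only [RR, tw_of_mem _ _ _ ha, tw_of_mem _ _ _ hb, tw_of_mem _ _ _ (add_mem ha hb), map_add, add_mul, mul_add]
  · intro n k a T ha
    simp only [RR, tw_of_mem _ _ _ ha, tw_of_mem _ _ _ (Submodule.smul_mem _ _ ha), map_smul, smul_mul_assoc, smul_eq_mul, chi_one, one_mul]
  · intro n a S T
    by_cases ha : a ∈ 𝒢 n
    · simp only [RR, tw_of_mem _ _ _ ha, mul_add, map_add]
    · simp only [RR, tw_of_notMem _ _ _ ha, add_zero]
  · intro n a k T
    by_cases ha : a ∈ 𝒢 n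
    · simp only [RR, tw_of_mem _ _ _ ha, mul_smul_comm, map_smul, smul_eq_mul, chi_one, one_mul]
    · simp only [RR, tw_of_notMem _ _ _ ha, mul_zero]
  · intro κ _ n a T ha
    have := hG.gram_nonneg (ι := κ) (fun p => π (a p) * τ (T p)) (fun _ => 1)
    convert this using 1
    refine Finset.sum_congr rfl fun k _ => Finset.sum_congr rfl fun l _ => ?_
    rw [RR, tw_of_mem _ _ _ (h𝒢.smul_mul (ha k) (ha l)), chi_one]
    simp only [map_one, one_mul, star_mul, ← map_star, map_mul]
    congr 1
    have h1 := hcomm (star (a k)) (star (T k))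
    have h2 := hcomm (a l) (star (T k))
    rw [mul_assoc (τ (star (T k))), ← mul_assoc (π (star (a k))), ← mul_assoc _ (π (star (a k)) * π (a l)),
        ← mul_assoc (π (star (a k)) * π (a l))]
    rw [((h1.mul_left h2)).eq]
  · rw [RR, tw_of_mem _ _ _ h𝒢.one]
    simp [chi_one, hG.2]

end Core3
end Part3

section Part4
set_option linter.unusedSectionVars false
set_option linter.unusedVariables false
set_option linter.unusedSimpArgs false

open scoped ComplexOrder InnerProductSpace ComplexConjugate

section Face
variable {r : ℕ} {A : Type*} [Ring A] [StarRing A] [Algebra ℂ A] [StarModule ℂ A]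
  {D : Type*} [Ring D] [StarRing D] [Algebra ℂ D] [StarModule ℂ D]
  {H : Type*} [NormedAddCommGroup H] [InnerProductSpace ℂ H] [CompleteSpace H]
  {𝒢 : (Fin r → ℤ) → Submodule ℂ A}

theorem PD.cs_multi (h𝒢 : GradedCond 𝒢) {h : (Fin r → ℤ) × A × D → ℂ} (hh : PD 𝒢 h)
    {ι : Type} [Fintype ι] (n : ι → (Fin r → ℤ)) (a : ι → A) (T : ι → D) (ha : ∀ i, a i ∈ 𝒢 (n i)) :
    ‖∑ i, h (n i, a i, T i)‖ ^ 2 ≤ (h (0, 1, 1)).re *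
      (∑ i, ∑ j, h (n j - n i, star (a i) * a j, star (T i) * T j)).re := by
  have h1 : 0 ≤ h (0, 1, 1) := by simpa using hh.pos1 0 1 1 h𝒢.one
  refine cs_scalar _ _ (∑ i, h (-n i, star (a i), star (T i))) _ h1 fun l => ?_
  have := hh.pos (Option ι) (fun b => b.elim 0 n) (fun b => b.elim (l • 1) a) (fun b => b.elim 1 T) (by
    rintro (_ | i)
    · exact Submodule.smul_mem _ _ h𝒢.one
    · exact ha i)
  simp only [Fintype.sum_option, Option.elim_none, Option.elim_some, sub_self, sub_zero, zero_sub, neg_zero, star_smul, star_one,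
    smul_mul_assoc, mul_smul_comm, one_mul, mul_one, Finset.sum_add_distrib] at this
  rw [hh.smul_left 0 _ _ _ (Submodule.smul_mem _ _ h𝒢.one), hh.smul_left 0 _ _ _ h𝒢.one,
    Finset.sum_congr rfl fun i _ => hh.smul_left (n i) _ _ _ (ha i),
    Finset.sum_congr rfl fun i _ => hh.smul_left (-n i) _ _ _ (h𝒢.star' (ha i)),
    ← Finset.mul_sum, ← Finset.mul_sum] at this
  convert this using 1
  simp only [Complex.star_def]
  ring

variable (π : A →⋆ₐ[ℂ] (H →L[ℂ] H)) (τ : D →⋆ₐ[ℂ] (H →L[ℂ] H))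

/-- the graph of a function on homogeneous triples -/
def GW (𝒢 : (Fin r → ℤ) → Submodule ℂ A) (h : (Fin r → ℤ) × A × D → ℂ) :
    Submodule ℂ ((H →L[ℂ] H) × ℂ) :=
  Submodule.span ℂ {x | ∃ n a T, a ∈ 𝒢 n ∧ x = (π a * τ T, h (n, a, T))}

theorem GW_family {h : (Fin r → ℤ) × A × D → ℂ} (hh : PD 𝒢 h) (x) (hx : x ∈ GW π τ 𝒢 h) :
    ∃ (ι : Type) (_ : Fintype ι) (n : ι → (Fin r → ℤ)) (a : ι → A) (T : ι → D),
      (∀ i, a i ∈ 𝒢 (n i)) ∧ x.1 = ∑ i, π (a i) * τ (T i) ∧ x.2 = ∑ i, h (n i, a i, T i) := by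
  unfold GW at hx
  induction hx using Submodule.span_induction with
  | mem x hx =>
    obtain ⟨n, a, T, ha, rfl⟩ := hx
    exact ⟨Unit, inferInstance, fun _ => n, fun _ => a, fun _ => T, fun _ => ha, by simp, by simp⟩
  | zero => exact ⟨Empty, inferInstance, fun _ => 0, fun _ => 0, fun _ => 0, by simp, by simp, by simp⟩
  | add x y _ _ hx hy =>
    obtain ⟨ι, _, n, a, T, ha, h1, h2⟩ := hx
    obtain ⟨ι', _, n', a', T', ha', h1', h2'⟩ := hy
    refine ⟨ι ⊕ ι', inferInstance, Sum.elim n n', Sum.elim a a', Sum.elim T T', ?_, ?_, ?_⟩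
    · rintro (i | i)
      · exact ha i
      · exact ha' i
    · simp [h1, h1']
    · simp [h2, h2']
  | smul c x _ hx =>
    obtain ⟨ι, _, n, a, T, ha, h1, h2⟩ := hx
    refine ⟨ι, inferInstance, n, fun i => c • a i, T, fun i => Submodule.smul_mem _ _ (ha i), ?_, ?_⟩
    · simp [h1, Finset.smul_sum]
    · simp [h2, Finset.mul_sum, fun i => hh.smul_left (n i) c _ (T i) (ha i)]

theorem GW_sq (hcomm : ∀ a T, Commute (π a) (τ T)) (h𝒢 : GradedCond 𝒢) {h : (Fin r → ℤ) × A × D → ℂ} (hh : h ∈ EE 𝒢 D)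
    (x) (hx : x ∈ GW π τ 𝒢 h) {G : (H →L[ℂ] H) →L[ℂ] ℂ} (hG : StateBH H G) {s t : ℝ}
    (hs : 0 < s) (ht : 0 < t) {h'} (hh' : h' ∈ EE 𝒢 D) (hg : s • h + t • h' = RR π τ 𝒢 G) :
    ∃ y : ℂ, (star x.1 * x.1, y) ∈ GW π τ 𝒢 h ∧ ‖x.2‖ ^ 2 ≤ ‖y‖ ∧ ‖y‖ ≤ s⁻¹ * ‖x.1‖ ^ 2 := by
  obtain ⟨ι, _, n, a, T, ha, h1, h2⟩ := GW_family π τ hh.1 x hx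
  have hpos := hh.1.pos ι n a T ha
  have hpos' := hh'.1.pos ι n a T ha
  set y := ∑ i, ∑ j, h (n j - n i, star (a i) * a j, star (T i) * T j) with hy
  have hyn : ‖y‖ = y.re := by
    obtain ⟨h3, h4⟩ := Complex.nonneg_iff.1 hpos
    rw [← abs_of_nonneg h3]; symm; exact Complex.abs_re_eq_norm.2 h4.symm
  have hX : star x.1 * x.1 = ∑ i, ∑ j, π (star (a i) * a j) * τ (star (T i) * T j) := by
    rw [h1, star_sum, Finset.sum_mul_sum]
    refine Finset.sum_congr rfl fun k _ => Finset.sum_congr rfl fun l _ => ?_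
    simp only [star_mul, ← map_star, map_mul]
    have h1 := hcomm (star (a k)) (star (T k))
    have h2 := hcomm (a l) (star (T k))
    rw [mul_assoc (τ (star (T k))), ← mul_assoc (π (star (a k))), ← mul_assoc _ (π (star (a k)) * π (a l)),
        ← mul_assoc (π (star (a k)) * π (a l))]
    rw [((h1.mul_left h2)).eq]
  refine ⟨y, ?_, ?_, ?_⟩
  · rw [hX]
    have : ((∑ i, ∑ j, π (star (a i) * a j) * τ (star (T i) * T j), y) : (H →L[ℂ] H) × ℂ)
        = ∑ i, ∑ j, (π (star (a i) * a j) * τ (star (T i) * T j),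
          h (n j - n i, star (a i) * a j, star (T i) * T j)) := by
      ext1
      · simp only [Prod.fst_sum]
      · simp only [Prod.snd_sum, hy]
    rw [this]
    exact sum_mem fun i _ => sum_mem fun j _ =>
      Submodule.subset_span ⟨_, _, _, h𝒢.smul_mul (ha i) (ha j), rfl⟩
  · have := hh.1.cs_multi h𝒢 n a T ha
    rw [hh.2, Complex.one_re, one_mul] at this
    rw [h2, hyn]; exact this
  · rw [hyn]
    have e1 : G (star x.1 * x.1) = s * y + t * ∑ i, ∑ j, h' (n j - n i, star (a i) * a j, star (T i) * T j) := by
      rw [hX, hy]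
      simp only [map_sum, Finset.mul_sum, ← Finset.sum_add_distrib]
      refine Finset.sum_congr rfl fun k _ => Finset.sum_congr rfl fun l _ => ?_
      have := congrFun hg (n l - n k, star (a k) * a l, star (T k) * T l)
      rw [RR, tw_of_mem _ _ _ (h𝒢.smul_mul (ha k) (ha l)), chi_one, one_mul] at this
      rw [← this]
      simp
    have e2 := congrArg Complex.re e1
    have e3 := (Complex.nonneg_iff.1 hpos').1
    simp only [Complex.add_re, Complex.re_ofReal_mul] at e2
    have e4 : (G (star x.1 * x.1)).re ≤ ‖x.1‖ ^ 2 := by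
      refine (Complex.re_le_norm _).trans ((hG.norm_le _).trans ?_)
      rw [CStarRing.norm_star_mul_self, sq]
    rw [inv_mul_eq_div, le_div_iff₀ hs]
    nlinarith [mul_nonneg ht.le e3]

theorem GW_bound (hcomm : ∀ a T, Commute (π a) (τ T)) (h𝒢 : GradedCond 𝒢) {h : (Fin r → ℤ) × A × D → ℂ} (hh : h ∈ EE 𝒢 D)
    {G : (H →L[ℂ] H) →L[ℂ] ℂ} (hG : StateBH H G) {s t : ℝ}
    (hs : 0 < s) (ht : 0 < t) {h'} (hh' : h' ∈ EE 𝒢 D) (hg : s • h + t • h' = RR π τ 𝒢 G)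
    (x) (hx : x ∈ GW π τ 𝒢 h) : ‖x.2‖ ≤ ‖x.1‖ := by
  have hsq := fun x hx => GW_sq π τ hcomm h𝒢 hh x hx hG hs ht hh' hg
  let S : Set ℝ := {C | 0 ≤ C ∧ ∀ x ∈ GW π τ 𝒢 h, ‖x.2‖ ≤ C * ‖x.1‖}
  have hS : Real.sqrt s⁻¹ ∈ S := by
    refine ⟨Real.sqrt_nonneg _, fun x hx => ?_⟩
    obtain ⟨y, -, h1, h2⟩ := hsq x hx
    refine le_of_pow_le_pow_left₀ (two_ne_zero) (by positivity) ?_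
    rw [mul_pow, Real.sq_sqrt (by positivity)]
    linarith
  have hSb : BddBelow S := ⟨0, fun c hc => hc.1⟩
  have hm0 : 0 ≤ sInf S := le_csInf ⟨_, hS⟩ fun c hc => hc.1
  have hmS : sInf S ∈ S := by
    refine ⟨hm0, fun x hx => ?_⟩
    rcases eq_or_lt_of_le (norm_nonneg x.1) with h0 | h0
    · rw [← h0]
      have := hS.2 x hx
      rw [← h0] at this
      simpa using this
    · rw [← div_le_iff₀ h0]
      refine le_csInf ⟨_, hS⟩ fun c hc => ?_
      rw [div_le_iff₀ h0]
      exact hc.2 x hx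
  have hmq : Real.sqrt (sInf S) ∈ S := by
    refine ⟨Real.sqrt_nonneg _, fun x hx => ?_⟩
    obtain ⟨y, h0, h1, h2⟩ := hsq x hx
    have h3 := hmS.2 _ h0
    simp only [CStarRing.norm_star_mul_self] at h3
    refine le_of_pow_le_pow_left₀ (two_ne_zero) (by positivity) ?_
    rw [mul_pow, Real.sq_sqrt hm0]
    nlinarith
  have h1 : sInf S ≤ Real.sqrt (sInf S) := csInf_le hSb hmq
  have h2 : sInf S ≤ 1 := by
    rw [Real.le_sqrt hm0 hm0] at h1
    nlinarith
  have := hmS.2 x hx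
  nlinarith [norm_nonneg x.1]

def KK (𝒢 : (Fin r → ℤ) → Submodule ℂ A) : Set ((Fin r → ℤ) × A × D → ℂ) :=
  RR π τ 𝒢 '' {G | StateBH H G}

theorem KK_face (hcomm : ∀ a T, Commute (π a) (τ T)) (h𝒢 : GradedCond 𝒢) :
    IsExtreme ℝ (EE 𝒢 D) (KK π τ 𝒢) := by
  refine ⟨?_, ?_⟩
  · rintro _ ⟨G, hG, rfl⟩
    exact RR_mem_EE π τ hcomm h𝒢 hG
  rintro h hh h' hh' _ ⟨G, hG, rfl⟩ ⟨s, t, hs, ht, hst, hg⟩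
  have hb := GW_bound π τ hcomm h𝒢 hh hG hs ht hh' hg
  let W := GW π τ 𝒢 h
  let F1 : W →ₗ[ℂ] (H →L[ℂ] H) := (LinearMap.fst ℂ (H →L[ℂ] H) ℂ).comp W.subtype
  have hinj : Function.Injective F1 := by
    rw [injective_iff_map_eq_zero]
    rintro ⟨⟨X, y⟩, hx⟩ h0
    have h1 : X = 0 := h0
    have := hb _ hx
    simp only [h1, norm_zero, norm_le_zero_iff] at this
    ext1; ext1
    · exact h1
    · exact this
  let e := LinearEquiv.ofInjective F1 hinj
  let f : LinearMap.range F1 →ₗ[ℂ] ℂ := ((LinearMap.snd ℂ (H →L[ℂ] H) ℂ).comp W.subtype).comp e.symm.toLinearMap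
  have hfe : ∀ w : W, f (e w) = w.1.2 := by
    intro w
    simp only [f, LinearMap.comp_apply, LinearEquiv.coe_coe, LinearEquiv.symm_apply_apply]
    rfl
  have hf : ∀ x, ‖f x‖ ≤ 1 * ‖x‖ := by
    intro x
    obtain ⟨w, rfl⟩ := e.surjective x
    rw [hfe, one_mul]
    exact hb _ w.2
  obtain ⟨G', hG', hn⟩ := exists_extension_norm_eq (LinearMap.range F1) (f.mkContinuous 1 hf)
  have hval : ∀ n a T, a ∈ 𝒢 n → G' (π a * τ T) = h (n, a, T) := by
    intro n a T ha
    let w : W := ⟨(π a * τ T, h (n, a, T)), Submodule.subset_span ⟨n, a, T, ha, rfl⟩⟩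
    have h1 := hG' (e w)
    have h2 : ((e w : LinearMap.range F1) : H →L[ℂ] H) = π a * τ T := rfl
    rw [h2] at h1
    rw [h1]
    exact hfe w
  refine ⟨G', ⟨?_, ?_⟩, ?_⟩
  · rw [hn]; exact LinearMap.mkContinuous_norm_le _ zero_le_one _
  · have := hval 0 1 1 h𝒢.one
    simpa [hh.2] using this
  · ext ⟨n, a, T⟩
    by_cases ha : a ∈ 𝒢 n
    · rw [RR, tw_of_mem _ _ _ ha, chi_one, one_mul, hval n a T ha]
    · rw [RR, tw_of_notMem _ _ _ ha, hh.1.zero _ _ _ ha]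

theorem RR_add_smul (G G' : (H →L[ℂ] H) →L[ℂ] ℂ) (s t : ℝ) :
    RR π τ 𝒢 (((s : ℂ) • G) + ((t : ℂ) • G')) = s • RR π τ 𝒢 G + t • RR π τ 𝒢 G' := by
  ext ⟨n, a, T⟩
  by_cases ha : a ∈ 𝒢 n
  · simp [RR, tw_of_mem _ _ _ ha, chi_one]
  · simp [RR, tw_of_notMem _ _ _ ha]

theorem KK_convex : Convex ℝ (KK π τ 𝒢) := by
  rintro _ ⟨G, hG, rfl⟩ _ ⟨G', hG', rfl⟩ s t hs ht hst
  refine ⟨_, ⟨?_, ?_⟩, RR_add_smul π τ G G' s t⟩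
  · refine (norm_add_le _ _).trans ?_
    rw [norm_smul, norm_smul, Complex.norm_of_nonneg hs, Complex.norm_of_nonneg ht]
    nlinarith [hG.1, hG'.1]
  · simp [hG.2, hG'.2]
    exact_mod_cast hst

theorem KK_compact : IsCompact (KK π τ 𝒢) := by
  let S : Set (WeakDual ℂ (H →L[ℂ] H)) := (WeakDual.toStrongDual ⁻¹' Metric.closedBall 0 1) ∩ {G | G 1 = 1}
  have hS : IsCompact S := (WeakDual.isCompact_closedBall 0 1).inter_right
    (isClosed_eq (WeakDual.eval_continuous 1) continuous_const)
  have : KK π τ 𝒢 = (fun G : WeakDual ℂ (H →L[ℂ] H) => RR π τ 𝒢 (WeakDual.toStrongDual G)) '' S := by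
    ext h
    constructor
    · rintro ⟨G, hG, rfl⟩
      refine ⟨StrongDual.toWeakDual G, ⟨?_, hG.2⟩, rfl⟩
      simpa using hG.1
    · rintro ⟨G, hG, rfl⟩
      refine ⟨WeakDual.toStrongDual G, ⟨?_, hG.2⟩, rfl⟩
      simpa using hG.1
  rw [this]
  refine hS.image ?_
  refine continuous_pi fun x => ?_
  obtain ⟨n, a, T⟩ := x
  by_cases ha : a ∈ 𝒢 n
  · simp only [RR, tw_of_mem _ _ _ ha, chi_one, one_mul]
    exact WeakDual.eval_continuous (π a * τ T)
  · simp only [RR, tw_of_notMem _ _ _ ha]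
    exact continuous_const

end Face
end Part4

section Part5
set_option linter.unusedSectionVars false
set_option linter.unusedVariables false
set_option linter.unusedSimpArgs false

open scoped ComplexOrder InnerProductSpace ComplexConjugate

section Semi
variable {r : ℕ} {A : Type*} [Ring A] [StarRing A] [Algebra ℂ A] [StarModule ℂ A]
  {D : Type*} [Ring D] [StarRing D] [Algebra ℂ D] [StarModule ℂ D]
  {H : Type*} [NormedAddCommGroup H] [InnerProductSpace ℂ H] [CompleteSpace H]
  {𝒢 : (Fin r → ℤ) → Submodule ℂ A}
variable (π : A →⋆ₐ[ℂ] (H →L[ℂ] H)) (τ : D →⋆ₐ[ℂ] (H →L[ℂ] H))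

def B0 (𝒢 : (Fin r → ℤ) → Submodule ℂ A) (G : (H →L[ℂ] H) →L[ℂ] ℂ) : Set ((Fin r → ℤ) × A × D → ℂ) :=
  {f | ∃ z, ∃ v ∈ VV π τ 𝒢 G, f = tw 𝒢 z v ∧ f (0, 1, 1) = 1}

def CC (𝒢 : (Fin r → ℤ) → Submodule ℂ A) (G : (H →L[ℂ] H) →L[ℂ] ℂ) :
    AddSubmonoid ((Fin r → ℤ) × A × D → ℂ) :=
  AddSubmonoid.closure {f | ∃ z, ∃ v ∈ VV π τ 𝒢 G, f = tw 𝒢 z v}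

theorem PD.eq_zero (h𝒢 : GradedCond 𝒢) {h : (Fin r → ℤ) × A × D → ℂ} (hh : PD 𝒢 h)
    (h0 : (h (0, 1, 1)).re = 0) : h = 0 := by
  ext ⟨n, a, T⟩
  by_cases ha : a ∈ 𝒢 n
  · have := hh.cs h𝒢 n a T ha
    rw [h0, zero_mul] at this
    simpa using this
  · exact hh.zero n a T ha

theorem CC_normal (hcomm : ∀ a T, Commute (π a) (τ T)) (h𝒢 : GradedCond 𝒢)
    {G : (H →L[ℂ] H) →L[ℂ] ℂ} (hG : StateBH H G) (f) (hf : f ∈ CC π τ 𝒢 G) :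
    f = 0 ∨ ∃ t : ℝ, 0 < t ∧ ∃ b ∈ convexHull ℝ (B0 π τ 𝒢 G), b (0, 1, 1) = 1 ∧ f = t • b := by
  unfold CC at hf
  induction hf using AddSubmonoid.closure_induction with
  | mem x hx =>
    obtain ⟨z, v, hv, rfl⟩ := hx
    have hp := PD_tw π τ hcomm h𝒢 hG z v hv
    have h0 : 0 ≤ tw 𝒢 z v (0, 1, 1) := by simpa using hp.pos1 0 1 1 h𝒢.one
    obtain ⟨h1, h2⟩ := Complex.nonneg_iff.1 h0
    rcases eq_or_lt_of_le h1 with h3 | h3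
    · left; exact hp.eq_zero h𝒢 h3.symm
    · right
      set t := (tw 𝒢 z v (0, 1, 1)).re with ht
      have h4 : tw 𝒢 z v (0, 1, 1) = t := Complex.ext rfl h2.symm
      have h5 : tw 𝒢 z (t⁻¹ • v) (0, 1, 1) = 1 := by
        rw [tw_smul, Pi.smul_apply, h4, Complex.real_smul, ← Complex.ofReal_mul, inv_mul_cancel₀ h3.ne', Complex.ofReal_one]
      refine ⟨t, h3, tw 𝒢 z (t⁻¹ • v), subset_convexHull _ _ ⟨z, _, VV_smul π τ G _ (by positivity) _ hv, rfl, h5⟩, h5, ?_⟩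
      rw [tw_smul, smul_smul, mul_inv_cancel₀ h3.ne', one_smul]
  | zero => left; rfl
  | add x y _ _ hx hy =>
    rcases hx with rfl | ⟨t, ht, b, hb, hb1, rfl⟩
    · simpa using hy
    rcases hy with rfl | ⟨t', ht', b', hb', hb1', rfl⟩
    · right; exact ⟨t, ht, b, hb, hb1, by simp⟩
    right
    have hs : 0 < t + t' := by positivity
    refine ⟨t + t', hs, (t / (t + t')) • b + (t' / (t + t')) • b', ?_, ?_, ?_⟩
    · exact convex_convexHull ℝ _ hb hb' (by positivity) (by positivity) (by field_simp)
    · simp only [Pi.add_apply, Pi.smul_apply, hb1, hb1', Complex.real_smul, mul_one, ← Complex.ofReal_add]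
      rw [← add_div, div_self hs.ne', Complex.ofReal_one]
    · rw [smul_add, smul_smul, smul_smul, mul_div_cancel₀ _ hs.ne', mul_div_cancel₀ _ hs.ne']

theorem mem_closure_conv (hcomm : ∀ a T, Commute (π a) (τ T)) (h𝒢 : GradedCond 𝒢)
    {G : (H →L[ℂ] H) →L[ℂ] ℂ} (hG : StateBH H G) (g : (Fin r → ℤ) × A × D → ℂ) (hg1 : g (0, 1, 1) = 1)
    (hg : g ∈ closure (CC π τ 𝒢 G : Set ((Fin r → ℤ) × A × D → ℂ))) :
    g ∈ closure (convexHull ℝ (B0 π τ 𝒢 G)) := by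
  rw [mem_closure_iff_nhdsWithin_neBot] at hg
  have hc : Continuous fun f : (Fin r → ℤ) × A × D → ℂ => (f (0, 1, 1)).re := by fun_prop
  have ht : Filter.Tendsto (fun f : (Fin r → ℤ) × A × D → ℂ => ((f (0, 1, 1)).re)⁻¹ • f)
      (nhdsWithin g (CC π τ 𝒢 G : Set ((Fin r → ℤ) × A × D → ℂ))) (nhds g) := by
    have : Filter.Tendsto (fun f : (Fin r → ℤ) × A × D → ℂ => ((f (0, 1, 1)).re)⁻¹ • f) (nhds g)
        (nhds (((g (0, 1, 1)).re)⁻¹ • g)) := by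
      refine ((hc.tendsto g).inv₀ ?_).smul Filter.tendsto_id
      simp [hg1]
    simp only [hg1, Complex.one_re, inv_one, one_smul] at this
    exact this.mono_left nhdsWithin_le_nhds
  refine mem_closure_of_tendsto ht ?_
  have h1 : ∀ᶠ f in nhdsWithin g (CC π τ 𝒢 G : Set ((Fin r → ℤ) × A × D → ℂ)), (1/2 : ℝ) < (f (0, 1, 1)).re := by
    refine Filter.Eventually.filter_mono nhdsWithin_le_nhds ?_
    refine (hc.tendsto g).eventually (lt_mem_nhds ?_)
    simp only [hg1, Complex.one_re]; norm_num
  filter_upwards [h1, self_mem_nhdsWithin] with f hf1 hf2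
  rcases CC_normal π τ hcomm h𝒢 hG f hf2 with rfl | ⟨t, ht, b, hb, hb1, rfl⟩
  · simp at hf1; linarith
  · simp only [Pi.smul_apply, hb1, Complex.real_smul, mul_one, Complex.ofReal_re, smul_smul]
    rwa [inv_mul_cancel₀ ht.ne', one_smul]

noncomputable def rot (w : Fin r → Circle) (f : (Fin r → ℤ) × A × D → ℂ) : (Fin r → ℤ) × A × D → ℂ :=
  fun x => chi w x.1 * f x

theorem rot_continuous {X : Type*} [TopologicalSpace X] {w : X → (Fin r → Circle)}
    {f : X → ((Fin r → ℤ) × A × D → ℂ)} (hw : Continuous w) (hf : Continuous f) :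
    Continuous fun p => rot (w p) (f p) := by
  refine continuous_pi fun x => ?_
  exact ((chi_continuous x.1).comp hw).mul ((continuous_apply x).comp hf)

theorem rot_tw (w z : Fin r → Circle) (v : A → D → ℂ) : rot w (tw 𝒢 z v) = tw 𝒢 (w * z) v := by
  ext ⟨n, a, T⟩
  by_cases ha : a ∈ 𝒢 n
  · rw [rot, tw_of_mem _ _ _ ha, tw_of_mem _ _ _ ha, chi_mul, mul_assoc]
  · rw [rot, tw_of_notMem _ _ _ ha, tw_of_notMem _ _ _ ha, mul_zero]

theorem rot_one (f : (Fin r → ℤ) × A × D → ℂ) : rot 1 f = f := by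
  ext x; simp [rot, chi_one]

theorem exists_z {G : (H →L[ℂ] H) →L[ℂ] ℂ} (g : (Fin r → ℤ) × A × D → ℂ)
    (hg : g ∈ closure (B0 π τ 𝒢 G)) : ∃ z, g ∈ closure (tw 𝒢 z '' (VV π τ 𝒢 G : Set (A → D → ℂ))) := by
  let P : Set ((Fin r → Circle) × ((Fin r → ℤ) × A × D → ℂ)) := {p | p.2 ∈ tw 𝒢 p.1 '' (VV π τ 𝒢 G : Set (A → D → ℂ))}
  have h1 : g ∈ Prod.snd '' closure P := by
    have hcl : IsClosed (Prod.snd '' closure P) := isClosedMap_snd_of_compactSpace _ isClosed_closure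
    refine closure_minimal ?_ hcl hg
    rintro f ⟨z, v, hv, rfl, -⟩
    exact ⟨(z, tw 𝒢 z v), subset_closure ⟨v, hv, rfl⟩, rfl⟩
  obtain ⟨⟨z, g'⟩, hz, rfl⟩ := h1
  refine ⟨z, ?_⟩
  have hcont : Continuous fun p : (Fin r → Circle) × ((Fin r → ℤ) × A × D → ℂ) => rot (z * p.1⁻¹) p.2 :=
    rot_continuous (continuous_const.mul continuous_fst.inv) continuous_snd
  have := map_mem_closure (t := tw 𝒢 z '' (VV π τ 𝒢 G : Set (A → D → ℂ))) hcont hz (by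
    rintro ⟨w, f⟩ ⟨v, hv, hvf⟩
    refine ⟨v, hv, ?_⟩
    simp only at hvf ⊢
    rw [← hvf, rot_tw]; simp)
  simp only [mul_inv_cancel, rot_one] at this
  exact this

theorem VV_subst (h𝒢 : GradedCond 𝒢) {G : (H →L[ℂ] H) →L[ℂ] ℂ} (hG : StateBH H G)
    {ι : Type} [Fintype ι] (e : ι → Fin r → ℤ) (c b : ι → A) (hc : ∀ i, c i ∈ 𝒢 (e i))
    (z' : Fin r → Circle) (v') (hv' : v' ∈ VV π τ 𝒢 G) :
    (fun (a : A) (T : D) => ∑ i, ∑ j, chi z' (e j - e i) * v' (star (c i) * a * c j) 1 *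
      G (π (star (b i) * b j) * τ T)) ∈ VV π τ 𝒢 G := by
  unfold VV at hv'
  induction hv' using AddSubmonoid.closure_induction with
  | mem x hx =>
    obtain ⟨κ, _, e', c', b', hc', rfl⟩ := hx
    obtain ⟨B, hB⟩ := hG.gram (fun k => π (b' k))
    have : (fun (a : A) (T : D) => ∑ i, ∑ j, chi z' (e j - e i) * (bas π τ G c' b') (star (c i) * a * c j) 1 *
      G (π (star (b i) * b j) * τ T)) = ∑ m, bas π τ G (ι := ι × κ) (fun p => c p.1 * c' p.2)
        (fun p => (chi z' (e p.1) * B m p.2) • b p.1) := by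
      funext a T
      simp only [Finset.sum_apply, bas, Fintype.sum_prod_type]
      rw [Finset.sum_comm (s := (Finset.univ : Finset κ)) (t := (Finset.univ : Finset ι))]
      refine Finset.sum_congr rfl fun i _ => ?_
      have e1 : ∀ j : ι, chi z' (e j - e i) * (∑ k, ∑ l, G (π (star (c' k) * (star (c i) * a * c j) * c' l)) *
            G (π (star (b' k) * b' l) * τ 1)) * G (π (star (b i) * b j) * τ T)
          = ∑ k, ∑ l, ∑ m, G (π (star (c i * c' k) * a * (c j * c' l))) *
            G (π (star ((chi z' (e i) * B m k) • b i) * ((chi z' (e j) * B m l) • b j)) * τ T) := by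
        intro j
        rw [Finset.mul_sum, Finset.sum_mul]
        refine Finset.sum_congr rfl fun k _ => ?_
        rw [Finset.mul_sum, Finset.sum_mul]
        refine Finset.sum_congr rfl fun l _ => ?_
        rw [map_one, mul_one, map_mul π (star (b' k)), map_star, hB, Finset.mul_sum, Finset.mul_sum, Finset.sum_mul]
        refine Finset.sum_congr rfl fun m _ => ?_
        have e2 : star (c i * c' k) * a * (c j * c' l) = star (c' k) * (star (c i) * a * c j) * c' l := by
          simp only [star_mul, mul_assoc]
        rw [e2, star_smul, smul_mul_smul_comm, map_smul, smul_mul_assoc, map_smul, smul_eq_mul, Complex.star_def,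
          map_mul (starRingEnd ℂ), chi_sub]
        ring
      rw [Finset.sum_congr rfl fun j _ => e1 j]
      rw [Finset.sum_comm]
      have e3 : ∀ f : κ → ι → κ → κ → ℂ, ∑ k, ∑ j, ∑ l, ∑ m, f k j l m = ∑ m, ∑ k, ∑ j, ∑ l, f k j l m := by
        intro f
        symm
        rw [Finset.sum_comm]
        refine Finset.sum_congr rfl fun k _ => ?_
        rw [Finset.sum_comm]
        refine Finset.sum_congr rfl fun j _ => ?_
        rw [Finset.sum_comm]
      rw [e3]
    rw [this]
    refine sum_mem fun m _ => AddSubmonoid.subset_closure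
      ⟨ι × κ, inferInstance, fun p => e p.1 + e' p.2, _, _, fun p => h𝒢.mul (hc p.1) (hc' p.2), rfl⟩
  | zero =>
    have : (fun (a : A) (T : D) => ∑ i, ∑ j, chi z' (e j - e i) * (0 : A → D → ℂ) (star (c i) * a * c j) 1 *
      G (π (star (b i) * b j) * τ T)) = 0 := by funext a T; simp
    rw [this]; exact zero_mem _
  | add x y _ _ hx hy =>
    have := add_mem hx hy
    convert this using 1
    funext a T
    simp only [Pi.add_apply, mul_add, add_mul, Finset.sum_add_distrib]

theorem semigroup_mul (h𝒢 : GradedCond 𝒢) {G : (H →L[ℂ] H) →L[ℂ] ℂ} (hG : StateBH H G)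
    (z z' : Fin r → Circle)
    (hz : RR π τ 𝒢 G ∈ closure (tw 𝒢 z '' (VV π τ 𝒢 G : Set (A → D → ℂ))))
    (hz' : RR π τ 𝒢 G ∈ closure (tw 𝒢 z' '' (VV π τ 𝒢 G : Set (A → D → ℂ)))) :
    RR π τ 𝒢 G ∈ closure (tw 𝒢 (z * z') '' (VV π τ 𝒢 G : Set (A → D → ℂ))) := by
  let M : AddSubmonoid ((Fin r → ℤ) × A × D → ℂ) :=
    { carrier := tw 𝒢 (z * z') '' (VV π τ 𝒢 G : Set (A → D → ℂ))
      zero_mem' := ⟨0, zero_mem _, tw_zero _⟩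
      add_mem' := by
        rintro _ _ ⟨v, hv, rfl⟩ ⟨w, hw, rfl⟩
        exact ⟨v + w, add_mem hv hw, tw_add _ _ _⟩ }
  have key : ∀ v ∈ VV π τ 𝒢 G, tw 𝒢 z v ∈ M.topologicalClosure := by
    intro v hv
    unfold VV at hv
    induction hv using AddSubmonoid.closure_induction with
    | mem x hx =>
      obtain ⟨ι, _, e, c, b, hc, rfl⟩ := hx
      classical
      let Ξ : ((Fin r → ℤ) × A × D → ℂ) → ((Fin r → ℤ) × A × D → ℂ) := fun f x =>
        if x.2.1 ∈ 𝒢 x.1 then chi z x.1 * ∑ i, ∑ j, f (x.1 + (e j - e i), star (c i) * x.2.1 * c j, 1) *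
          G (π (star (b i) * b j) * τ x.2.2) else 0
      have hΞ : Continuous Ξ := by
        refine continuous_pi fun x => ?_
        by_cases hx : x.2.1 ∈ 𝒢 x.1
        · simp only [Ξ, if_pos hx]; fun_prop
        · simp only [Ξ, if_neg hx]; exact continuous_const
      have hmem : ∀ n a, a ∈ 𝒢 n → ∀ i j, star (c i) * a * c j ∈ 𝒢 (n + (e j - e i)) := by
        intro n a ha i j
        have := h𝒢.mul (h𝒢.smul_mul (hc i) ha) (hc j)
        convert this using 2
        abel
      have h1 := map_mem_closure (t := (M : Set ((Fin r → ℤ) × A × D → ℂ))) hΞ hz' (by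
        rintro _ ⟨v', hv', rfl⟩
        refine ⟨_, VV_subst π τ h𝒢 hG e c b hc z' v' hv', ?_⟩
        ext ⟨n, a, T⟩
        by_cases ha : a ∈ 𝒢 n
        · rw [tw_of_mem _ _ _ ha]
          simp only [Ξ, if_pos ha, tw_of_mem _ _ _ (hmem n a ha _ _), chi_add, chi_mul, Finset.mul_sum]
          refine Finset.sum_congr rfl fun i _ => Finset.sum_congr rfl fun j _ => ?_
          ring
        · rw [tw_of_notMem _ _ _ ha]
          simp only [Ξ, if_neg ha])
      have h2 : Ξ (RR π τ 𝒢 G) = tw 𝒢 z (bas π τ G c b) := by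
        ext ⟨n, a, T⟩
        by_cases ha : a ∈ 𝒢 n
        · rw [tw_of_mem _ _ _ ha]
          simp only [Ξ, if_pos ha, RR, tw_of_mem _ _ _ (hmem n a ha _ _), chi_one, one_mul, bas, map_one, mul_one]
        · rw [tw_of_notMem _ _ _ ha]
          simp only [Ξ, if_neg ha]
      rw [← h2]
      exact h1
    | zero => rw [tw_zero]; exact zero_mem _
    | add x y _ _ hx hy => rw [tw_add]; exact add_mem hx hy
  have h3 : closure (tw 𝒢 z '' (VV π τ 𝒢 G : Set (A → D → ℂ))) ⊆ M.topologicalClosure := by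
    refine closure_minimal ?_ (AddSubmonoid.isClosed_topologicalClosure _)
    rintro _ ⟨v, hv, rfl⟩
    exact key v hv
  exact h3 hz

theorem z_one (h𝒢 : GradedCond 𝒢) {G : (H →L[ℂ] H) →L[ℂ] ℂ} (hG : StateBH H G)
    (z : Fin r → Circle)
    (hz : RR π τ 𝒢 G ∈ closure (tw 𝒢 z '' (VV π τ 𝒢 G : Set (A → D → ℂ)))) :
    RR π τ 𝒢 G ∈ closure (tw 𝒢 1 '' (VV π τ 𝒢 G : Set (A → D → ℂ))) := by
  have hp : ∀ k : ℕ, RR π τ 𝒢 G ∈ closure (tw 𝒢 (z ^ (k + 1)) '' (VV π τ 𝒢 G : Set (A → D → ℂ))) := by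
    intro k
    induction k with
    | zero => simpa using hz
    | succ k ih => rw [pow_succ]; exact semigroup_mul π τ h𝒢 hG _ _ ih hz
  have hshift : ∀ w, RR π τ 𝒢 G ∈ closure (tw 𝒢 w '' (VV π τ 𝒢 G : Set (A → D → ℂ))) →
      rot w⁻¹ (RR π τ 𝒢 G) ∈ closure (tw 𝒢 1 '' (VV π τ 𝒢 G : Set (A → D → ℂ))) := by
    intro w hw
    refine map_mem_closure (f := fun f => rot w⁻¹ f) (rot_continuous continuous_const continuous_id) hw ?_
    rintro _ ⟨v, hv, rfl⟩
    exact ⟨v, hv, by simp only [rot_tw, inv_mul_cancel]⟩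
  have hcont : Continuous fun w : Fin r → Circle => rot w⁻¹ (RR π τ 𝒢 G) :=
    rot_continuous continuous_inv continuous_const
  by_contra hn
  have hU : {w : Fin r → Circle | rot w⁻¹ (RR π τ 𝒢 G) ∈
      (closure (tw 𝒢 1 '' (VV π τ 𝒢 G : Set (A → D → ℂ))))ᶜ} ∈ nhds 1 := by
    refine (isClosed_closure.isOpen_compl.preimage hcont).mem_nhds ?_
    simp only [Set.mem_preimage, inv_one, rot_one]
    exact hn
  obtain ⟨k, hk⟩ := torus_recurrence z _ hU
  exact hk (hshift _ (hp k))

theorem ext_main (hcomm : ∀ a T, Commute (π a) (τ T)) (h𝒢 : GradedCond 𝒢)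
    (hsq : ∀ T : D, ∃ (c : ℝ) (R : D), star T * T + star R * R = (c : ℂ) • 1)
    {G : (H →L[ℂ] H) →L[ℂ] ℂ} (hG : StateBH H G)
    (hext : RR π τ 𝒢 G ∈ (EE 𝒢 D).extremePoints ℝ)
    (hfol : RR π τ 𝒢 G ∈ closure (CC π τ 𝒢 G : Set ((Fin r → ℤ) × A × D → ℂ))) :
    RR π τ 𝒢 G ∈ closure (tw 𝒢 1 '' (VV π τ 𝒢 G : Set (A → D → ℂ))) := by
  have h1 := mem_closure_conv π τ hcomm h𝒢 hG _ (RR_mem_EE π τ hcomm h𝒢 hG).2 hfol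
  have h2 := milman_pi (EE 𝒢 D) (B0 π τ 𝒢 G) (EE_compact h𝒢 hsq) EE_convex (by
    rintro f ⟨z, v, hv, rfl, h1⟩
    exact ⟨PD_tw π τ hcomm h𝒢 hG z v hv, h1⟩) _ hext h1
  obtain ⟨z, hz⟩ := exists_z π τ _ h2
  exact z_one π τ h𝒢 hG z hz

/-- All states are limits of untwisted combinations. -/
theorem krein_main (hcomm : ∀ a T, Commute (π a) (τ T)) (h𝒢 : GradedCond 𝒢)
    (hsq : ∀ T : D, ∃ (c : ℝ) (R : D), star T * T + star R * R = (c : ℂ) • 1)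
    (hfol : ∀ G : (H →L[ℂ] H) →L[ℂ] ℂ, StateBH H G →
      RR π τ 𝒢 G ∈ closure (CC π τ 𝒢 G : Set ((Fin r → ℤ) × A × D → ℂ)))
    {G : (H →L[ℂ] H) →L[ℂ] ℂ} (hG : StateBH H G) :
    RR π τ 𝒢 G ∈ closure (tw 𝒢 1 '' (AddSubmonoid.closure (⋃ G' ∈ {G' | StateBH H G'},
      (VV π τ 𝒢 G' : Set (A → D → ℂ))) : Set (A → D → ℂ))) := by
  set VA := AddSubmonoid.closure (⋃ G' ∈ {G' | StateBH H G'}, (VV π τ 𝒢 G' : Set (A → D → ℂ))) with hVA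
  have hsm : ∀ t : ℝ, 0 ≤ t → ∀ v ∈ VA, t • v ∈ VA := by
    intro t ht v hv
    rw [hVA] at hv
    induction hv using AddSubmonoid.closure_induction with
    | mem x hx =>
      simp only [Set.mem_iUnion] at hx
      obtain ⟨G', hG', hx⟩ := hx
      refine AddSubmonoid.subset_closure ?_
      simp only [Set.mem_iUnion]
      exact ⟨G', hG', VV_smul π τ G' t ht x hx⟩
    | zero => rw [smul_zero]; exact zero_mem _
    | add x y _ _ hx hy => rw [smul_add]; exact add_mem hx hy
  have hconv : Convex ℝ (tw 𝒢 1 '' (VA : Set (A → D → ℂ))) := by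
    rintro _ ⟨v, hv, rfl⟩ _ ⟨w, hw, rfl⟩ s t hs ht hst
    exact ⟨s • v + t • w, add_mem (hsm s hs v hv) (hsm t ht w hw), by rw [tw_add, tw_smul, tw_smul]⟩
  have hK := closure_convexHull_extremePoints (KK_compact π τ (𝒢 := 𝒢)) (KK_convex π τ)
  have hmem : RR π τ 𝒢 G ∈ KK π τ 𝒢 := ⟨G, hG, rfl⟩
  rw [← hK] at hmem
  refine closure_minimal (convexHull_min ?_ hconv.closure) isClosed_closure hmem
  intro g hg
  have hg' := (KK_face π τ hcomm h𝒢).extremePoints_subset_extremePoints hg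
  obtain ⟨G', hG', rfl⟩ := hg.1
  refine closure_mono ?_ (ext_main π τ hcomm h𝒢 hsq hG' hg' (hfol G' hG'))
  refine Set.image_mono ?_
  intro v hv
  refine AddSubmonoid.subset_closure ?_
  simp only [Set.mem_iUnion]
  exact ⟨G', hG', hv⟩

end Semi
end Part5

section Part6
set_option linter.unusedSectionVars false
set_option linter.unusedVariables false
set_option linter.unusedSimpArgs false

open scoped ComplexOrder InnerProductSpace ComplexConjugate



section Graph
variable {r : ℕ} {Λ : HigherRankGraph r} [Fintype Λ.Obj] [DecidableEq Λ.Obj] [∀ l, Fintype (Λ.Mor l)]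
  [∀ l, DecidableEq (Λ.Mor l)]
  {A : Type*} [Ring A] [StarRing A] [Algebra ℂ A] [StarModule ℂ A]

structure CKF (Λ : HigherRankGraph r) [Fintype Λ.Obj] [DecidableEq Λ.Obj] [∀ l, Fintype (Λ.Mor l)]
    [∀ l, DecidableEq (Λ.Mor l)] (s : ∀ l : Fin r → ℕ, Λ.Mor l → A) : Prop where
  orthp : ∀ a b : Λ.Obj, a ≠ b → s 0 (Λ.id' a) * s 0 (Λ.id' b) = 0
  idem : ∀ a : Λ.Obj, s 0 (Λ.id' a) * s 0 (Λ.id' a) = s 0 (Λ.id' a)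
  sa : ∀ a : Λ.Obj, star (s 0 (Λ.id' a)) = s 0 (Λ.id' a)
  sum1 : ∑ a : Λ.Obj, s 0 (Λ.id' a) = 1
  comp : ∀ {l m : Fin r → ℕ} (u : Λ.Mor l) (v : Λ.Mor m) (h : Λ.tgt u = Λ.src v),
      s _ (Λ.comp u v h) = s l u * s m v
  isom : ∀ {l : Fin r → ℕ} (u : Λ.Mor l), star (s l u) * s l u = s 0 (Λ.id' (Λ.tgt u))
  unitl : ∀ {l : Fin r → ℕ} (u : Λ.Mor l), s 0 (Λ.id' (Λ.src u)) * s l u = s l u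
  unitr : ∀ {l : Fin r → ℕ} (u : Λ.Mor l), s l u * s 0 (Λ.id' (Λ.tgt u)) = s l u
  ck : ∀ (a : Λ.Obj) (n : Fin r → ℕ),
      s 0 (Λ.id' a) = ∑ u : Λ.Mor n, if Λ.src u = a then s n u * star (s n u) else 0
  orth : ∀ {l : Fin r → ℕ} (u v : Λ.Mor l), u ≠ v → star (s l u) * s l v = 0

namespace CKF
variable {s : ∀ l : Fin r → ℕ, Λ.Mor l → A} (hs : CKF Λ s)

theorem sum_range (hs : CKF Λ s) (n : Fin r → ℕ) : ∑ u : Λ.Mor n, s n u * star (s n u) = 1 := by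
  rw [← hs.sum1]
  simp_rw [hs.ck _ n]
  rw [Finset.sum_comm]
  simp

theorem factor (hs : CKF Λ s) {k l m : Fin r → ℕ} (hk : k = l + m) (w : Λ.Mor k) :
    ∃ (u : Λ.Mor l) (v : Λ.Mor m), Λ.tgt u = Λ.src v ∧ Λ.tgt w = Λ.tgt v ∧ s k w = s l u * s m v := by
  subst hk
  obtain ⟨⟨u, v, h⟩, huv, -⟩ := Λ.factor l m w
  refine ⟨u, v, h, ?_, ?_⟩
  · rw [← huv, Λ.tgt_comp]
  · rw [← huv, hs.comp]

theorem star_mul_same (hs : CKF Λ s) {l : Fin r → ℕ} (u v : Λ.Mor l) :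
    star (s l u) * s l v = if u = v then s 0 (Λ.id' (Λ.tgt u)) else 0 := by
  split_ifs with h
  · subst h; exact hs.isom u
  · exact hs.orth u v h

theorem mul_ne (hs : CKF Λ s) {l m : Fin r → ℕ} (u : Λ.Mor l) (v : Λ.Mor m) (h : Λ.tgt u ≠ Λ.src v) :
    s l u * s m v = 0 := by
  rw [← hs.unitr u, ← hs.unitl v, mul_assoc, ← mul_assoc (s 0 (Λ.id' (Λ.tgt u))), hs.orthp _ _ h, zero_mul, mul_zero]

theorem mul_star_ne (hs : CKF Λ s) {l m : Fin r → ℕ} (u : Λ.Mor l) (v : Λ.Mor m) (h : Λ.tgt u ≠ Λ.tgt v) :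
    s l u * star (s m v) = 0 := by
  rw [← hs.unitr u, ← hs.unitr v, star_mul, hs.sa, mul_assoc, ← mul_assoc (s 0 (Λ.id' (Λ.tgt u))), hs.orthp _ _ h,
    zero_mul, mul_zero]

/-- integer degree -/
def dz (l : Fin r → ℕ) : Fin r → ℤ := fun i => l i

theorem dz_add (l m : Fin r → ℕ) : dz (l + m) = dz l + dz m := by ext; simp [dz]

def gr (s : ∀ l : Fin r → ℕ, Λ.Mor l → A) (n : Fin r → ℤ) : Submodule ℂ A :=
  Submodule.span ℂ {a | ∃ (l m : Fin r → ℕ) (x : Λ.Mor l) (y : Λ.Mor m), dz l - dz m = n ∧ a = s l x * star (s m y)}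

theorem gen_mem {l m : Fin r → ℕ} (x : Λ.Mor l) (y : Λ.Mor m) : s l x * star (s m y) ∈ gr s (dz l - dz m) :=
  Submodule.subset_span ⟨l, m, x, y, rfl, rfl⟩

theorem one_mem (hs : CKF Λ s) : (1 : A) ∈ gr s 0 := by
  rw [← hs.sum_range 0]
  refine sum_mem fun u _ => ?_
  simpa using gen_mem (s := s) u u

theorem star_gr {n : Fin r → ℤ} {a : A} (ha : a ∈ gr s n) : star a ∈ gr s (-n) := by
  unfold gr at ha
  induction ha using Submodule.span_induction with
  | mem a ha =>
    obtain ⟨l, m, x, y, rfl, rfl⟩ := ha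
    rw [star_mul, star_star, neg_sub]; exact gen_mem y x
  | zero => rw [star_zero]; exact zero_mem _
  | add a b _ _ ha hb => rw [star_add]; exact add_mem ha hb
  | smul c a _ ha => rw [star_smul]; exact Submodule.smul_mem _ _ ha

theorem s_mul_gr (hs : CKF Λ s) {l : Fin r → ℕ} (x : Λ.Mor l) {n : Fin r → ℤ} {a : A} (ha : a ∈ gr s n) :
    s l x * a ∈ gr s (dz l + n) := by
  unfold gr at ha
  induction ha using Submodule.span_induction with
  | mem a ha =>
    obtain ⟨l', m, x', y, rfl, rfl⟩ := ha
    rw [← mul_assoc]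
    by_cases h : Λ.tgt x = Λ.src x'
    · rw [← hs.comp x x' h, ← add_sub_assoc, ← dz_add]; exact gen_mem _ _
    · rw [hs.mul_ne x x' h, zero_mul]; exact zero_mem _
  | zero => rw [mul_zero]; exact zero_mem _
  | add a b _ _ ha hb => rw [mul_add]; exact add_mem ha hb
  | smul c a _ ha => rw [mul_smul_comm]; exact Submodule.smul_mem _ _ ha

theorem star_s_mul (hs : CKF Λ s) {m l : Fin r → ℕ} (y : Λ.Mor m) (u : Λ.Mor l) :
    star (s m y) * s l u ∈ gr s (dz l - dz m) := by
  have : star (s m y) * s l u = ∑ w : Λ.Mor (m + l), (star (s m y) * s _ w) * (star (s _ w) * s l u) := by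
    conv_lhs => rw [← mul_one (star (s m y)), ← hs.sum_range (m + l), Finset.mul_sum, Finset.sum_mul]
    simp only [mul_assoc]
  rw [this]
  refine sum_mem fun w _ => ?_
  obtain ⟨y', α, h1, -, h2⟩ := hs.factor (rfl : m + l = m + l) w
  obtain ⟨u', β, h3, -, h4⟩ := hs.factor (add_comm m l) w
  have e1 : star (s m y) * s _ w = if y = y' then s l α else 0 := by
    rw [h2, ← mul_assoc, hs.star_mul_same]
    split_ifs with h
    · subst h; rw [h1, hs.unitl]
    · rw [zero_mul]
  have e2 : star (s _ w) * s l u = if u' = u then star (s m β) else 0 := by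
    rw [h4, star_mul, mul_assoc, hs.star_mul_same]
    split_ifs with h
    · subst h; rw [h3, ← hs.sa, ← star_mul, hs.unitl]
    · rw [mul_zero]
  rw [e1, e2]
  split_ifs
  · exact gen_mem _ _
  all_goals simp

theorem star_s_mul_gr (hs : CKF Λ s) {m : Fin r → ℕ} (y : Λ.Mor m) {n : Fin r → ℤ} {a : A} (ha : a ∈ gr s n) :
    star (s m y) * a ∈ gr s (n - dz m) := by
  unfold gr at ha
  induction ha using Submodule.span_induction with
  | mem a ha =>
    obtain ⟨l', m', x', y', rfl, rfl⟩ := ha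
    have h := hs.star_s_mul y x'
    have h2 := hs.s_mul_gr y' (star_gr h)
    have h3 := star_gr h2
    rw [star_mul, star_star] at h3
    rw [← mul_assoc]
    convert h3 using 2
    abel
  | zero => rw [mul_zero]; exact zero_mem _
  | add a b _ _ ha hb => rw [mul_add]; exact add_mem ha hb
  | smul c a _ ha => rw [mul_smul_comm]; exact Submodule.smul_mem _ _ ha

theorem mul_gr (hs : CKF Λ s) {n m : Fin r → ℤ} {a b : A} (ha : a ∈ gr s n) (hb : b ∈ gr s m) :
    a * b ∈ gr s (n + m) := by
  unfold gr at ha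
  induction ha using Submodule.span_induction with
  | mem a ha =>
    obtain ⟨l', m', x', y', rfl, rfl⟩ := ha
    rw [mul_assoc]
    have := hs.s_mul_gr x' (hs.star_s_mul_gr y' hb)
    convert this using 2
    abel
  | zero => rw [zero_mul]; exact zero_mem _
  | add a b _ _ ha hb => rw [add_mul]; exact add_mem ha hb
  | smul c a _ ha => rw [smul_mul_assoc]; exact Submodule.smul_mem _ _ ha

theorem graded (hs : CKF Λ s) : GradedCond (gr s) where
  one := hs.one_mem
  mul := hs.mul_gr
  star' := star_gr
  bd n a ha := by
    unfold gr at ha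
    refine Submodule.span_mono ?_ ha
    rintro _ ⟨l, m, x, y, rfl, rfl⟩
    refine ⟨gen_mem x y, ?_⟩
    by_cases h : Λ.tgt x = Λ.tgt y
    · have he : star (s l x * star (s m y)) * (s l x * star (s m y)) = s m y * star (s m y) := by
        rw [star_mul, star_star, mul_assoc, ← mul_assoc (star (s l x)), hs.isom, h, ← mul_assoc, hs.unitr]
      have hee : (s m y * star (s m y)) * (s m y * star (s m y)) = s m y * star (s m y) := by
        rw [mul_assoc, ← mul_assoc (star (s m y)), hs.isom, ← mul_assoc, hs.unitr]
      refine ⟨1 - s m y * star (s m y), sub_mem hs.one_mem (by simpa using gen_mem (s := s) y y), ?_⟩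
      rw [he]
      simp only [star_sub, star_one, star_mul, star_star, mul_sub, sub_mul, mul_one, one_mul, hee]
      abel
    · rw [hs.mul_star_ne x y h]
      exact ⟨1, hs.one_mem, by simp⟩

theorem good (hs : CKF Λ s) {l m n n' : Fin r → ℕ} (x : Λ.Mor l) (y : Λ.Mor m) (hn : l ≤ n)
    (hnn : dz l - dz m = dz n - dz n') (u : Λ.Mor n) (v : Λ.Mor n') :
    ∃ c : ℂ, star (s n u) * (s l x * star (s m y)) * s n' v = c • s 0 (Λ.id' (Λ.tgt u)) ∧
      (c = 0 ∨ Λ.tgt u = Λ.tgt v) := by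
  have e1 : n = l + (n - l) := by ext i; have h0 : l i ≤ n i := hn i; simp only [Pi.add_apply, Pi.sub_apply]; omega
  have e2 : n' = m + (n - l) := by
    ext i; have h0 : l i ≤ n i := hn i; have h00 := congrFun hnn i; simp only [dz, Pi.add_apply, Pi.sub_apply] at h00 ⊢; omega
  obtain ⟨x0, u', h1, h2, h3⟩ := hs.factor e1 u
  obtain ⟨y0, v', h4, h5, h6⟩ := hs.factor e2 v
  have e3 : star (s n u) * (s l x * star (s m y)) * s n' v
    = (star (s _ u') * (star (s l x0) * s l x)) * ((star (s m y) * s m y0) * s _ v') := by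
    rw [h3, h6, star_mul]; simp only [mul_assoc]
  have e4 : star (s _ u') * (star (s l x0) * s l x) = if x0 = x then star (s _ u') else 0 := by
    rw [hs.star_mul_same]
    split_ifs with h
    · rw [h1, ← hs.sa, ← star_mul, hs.unitl]
    · rw [mul_zero]
  have e5 : (star (s m y) * s m y0) * s _ v' = if y = y0 then s _ v' else 0 := by
    rw [hs.star_mul_same]
    split_ifs with h
    · rw [h, h4, hs.unitl]
    · rw [zero_mul]
  rw [e3, e4, e5]
  split_ifs
  · rw [hs.star_mul_same]
    by_cases h : u' = v'
    · subst h
      exact ⟨1, by simp [h2], Or.inr (by rw [h2, h5])⟩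
    · exact ⟨0, by simp [h], Or.inl rfl⟩
  · exact ⟨0, by simp, Or.inl rfl⟩
  · exact ⟨0, by simp, Or.inl rfl⟩
  · exact ⟨0, by simp, Or.inl rfl⟩

end CKF
end Graph
end Part6

section Part7
set_option linter.unusedSectionVars false
set_option linter.unusedVariables false
set_option linter.unusedSimpArgs false

open scoped ComplexOrder InnerProductSpace ComplexConjugate

section Fourier

noncomputable def zeta {r : ℕ} (N : ℕ) (j : Fin r → Fin N) : Fin r → Circle :=
  fun i => Circle.exp (2 * Real.pi / N) ^ (j i : ℕ)

theorem four_one (N : ℕ) (hN : 0 < N) (m : ℤ) (hm : |m| < N) :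
    ∑ j : Fin N, (((Circle.exp (2 * Real.pi / N) ^ (j : ℕ)) ^ m : Circle) : ℂ) = if m = 0 then (N : ℂ) else 0 := by
  split_ifs with h
  · subst h; simp
  · set w : Circle := Circle.exp (2 * Real.pi / N) with hw
    have hprim : IsPrimitiveRoot (w : ℂ) N := by
      have := Complex.isPrimitiveRoot_exp N hN.ne'
      convert this using 1
      rw [hw, Circle.coe_exp]
      congr 1
      push_cast; ring
    have h1 : ((w : ℂ) ^ m) ≠ 1 := by
      rw [Ne, hprim.zpow_eq_one_iff_dvd]
      intro hd
      exact h (Int.eq_zero_of_abs_lt_dvd hd hm)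
    have h2 : ∀ j : Fin N, (((w ^ (j : ℕ)) ^ m : Circle) : ℂ) = ((w : ℂ) ^ m) ^ (j : ℕ) := by
      intro j
      rw [← zpow_natCast, ← zpow_mul, mul_comm, zpow_mul, zpow_natCast]
      simp
    rw [Finset.sum_congr rfl fun j _ => h2 j, Fin.sum_univ_eq_sum_range (fun j => ((w : ℂ) ^ m) ^ j) N,
      geom_sum_eq h1]
    have h3 : ((w : ℂ) ^ m) ^ N = 1 := by
      rw [← zpow_natCast, ← zpow_mul, mul_comm, zpow_mul, zpow_natCast, hprim.pow_eq_one, one_zpow]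
    rw [h3, sub_self, zero_div]

theorem four_sum {r : ℕ} (N : ℕ) (hN : 0 < N) (m : Fin r → ℤ) (hm : ∀ i, |m i| < N) :
    ∑ j : Fin r → Fin N, chi (zeta N j) m = if m = 0 then (N : ℂ) ^ r else 0 := by
  have h1 : ∀ j : Fin r → Fin N, chi (zeta N j) m =
      ∏ i, (((Circle.exp (2 * Real.pi / N) ^ (j i : ℕ)) ^ (m i) : Circle) : ℂ) := by
    intro j
    simp only [chi, zeta]
    exact map_prod Circle.coeHom _ _
  rw [Finset.sum_congr rfl fun j _ => h1 j]
  have h2 := Finset.prod_univ_sum (fun _ : Fin r => (Finset.univ : Finset (Fin N)))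
    (fun i j => (((Circle.exp (2 * Real.pi / N) ^ (j : ℕ)) ^ (m i) : Circle) : ℂ))
  rw [Fintype.piFinset_univ] at h2
  rw [← h2, Finset.prod_congr rfl fun i _ => four_one N hN (m i) (hm i), Finset.prod_ite_zero]
  simp [funext_iff]

theorem count_one (L : ℕ) (k : ℤ) :
    (∑ a : Fin L, ∑ b : Fin L, if k + (b : ℤ) - (a : ℤ) = 0 then (1 : ℝ) else 0) ≤ L ∧
    (L : ℝ) - |(k : ℝ)| ≤ ∑ a : Fin L, ∑ b : Fin L, if k + (b : ℤ) - (a : ℤ) = 0 then (1 : ℝ) else 0 := by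
  set S := (Finset.univ : Finset (Fin L × Fin L)).filter (fun p => k + (p.2 : ℤ) - (p.1 : ℤ) = 0) with hS
  have h0 : (∑ a : Fin L, ∑ b : Fin L, if k + (b : ℤ) - (a : ℤ) = 0 then (1 : ℝ) else 0) = S.card := by
    rw [← Fintype.sum_prod_type' (f := fun a b : Fin L => if k + (b : ℤ) - (a : ℤ) = 0 then (1 : ℝ) else 0), hS, Finset.sum_boole]
  rw [h0]
  constructor
  · have : S.card ≤ (Finset.univ : Finset (Fin L)).card := by
      refine Finset.card_le_card_of_injOn Prod.snd (fun _ _ => Finset.mem_univ _) ?_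
      rintro ⟨a, b⟩ h ⟨a', b'⟩ h' hb
      simp [hS] at h h' hb
      subst hb
      ext
      · simp; omega
      · rfl
    rw [Finset.card_univ, Fintype.card_fin] at this
    exact_mod_cast this
  · have : (Finset.Ico (max 0 (-k)) (min (L : ℤ) (L - k))).card ≤ S.card := by
      refine Finset.card_le_card_of_surjOn (fun p => ((p.2 : ℕ) : ℤ)) ?_
      intro b hb
      simp only [Finset.coe_Ico, Set.mem_Ico] at hb
      refine ⟨(⟨(k + b).toNat, by omega⟩, ⟨b.toNat, by omega⟩), ?_, ?_⟩
      · simp [hS]; omega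
      · simp; omega
    rw [Int.card_Ico] at this
    have h2 : (L : ℤ) - |k| ≤ S.card := by
      rcases le_total 0 k with h | h
      · rw [abs_of_nonneg h]; omega
      · rw [abs_of_nonpos h]; omega
    exact_mod_cast h2

open Classical in
noncomputable def cnt {r : ℕ} (L : ℕ) (k : Fin r → ℤ) : ℝ :=
  ∑ n : Fin r → Fin L, ∑ n' : Fin r → Fin L, if ∀ i, k i + (n' i : ℤ) - (n i : ℤ) = 0 then 1 else 0

theorem cnt_tendsto {r : ℕ} (k : Fin r → ℤ) :
    Filter.Tendsto (fun L : ℕ => cnt L k / (L : ℝ) ^ r) Filter.atTop (nhds 1) := by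
  have h1 : ∀ L : ℕ, cnt L k / (L : ℝ) ^ r = ∏ i, ((∑ a : Fin L, ∑ b : Fin L,
      if k i + (b : ℤ) - (a : ℤ) = 0 then (1 : ℝ) else 0) / L) := by
    intro L
    rw [Finset.prod_div_distrib, Finset.prod_const, Finset.card_univ, Fintype.card_fin]
    congr 1
    rw [Finset.prod_univ_sum, Fintype.piFinset_univ]
    unfold cnt
    refine Finset.sum_congr rfl fun n _ => ?_
    rw [Finset.prod_univ_sum, Fintype.piFinset_univ]
    refine Finset.sum_congr rfl fun n' _ => ?_
    rw [Finset.prod_ite_zero]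
    simp
  simp_rw [h1]
  suffices h : ∀ i, Filter.Tendsto (fun L : ℕ => (∑ a : Fin L, ∑ b : Fin L,
      if k i + (b : ℤ) - (a : ℤ) = 0 then (1 : ℝ) else 0) / L) Filter.atTop (nhds 1) by
    have := tendsto_finsetProd (Finset.univ : Finset (Fin r)) fun i _ => h i
    rwa [Finset.prod_const_one] at this
  intro i
  have hlow : Filter.Tendsto (fun L : ℕ => 1 - |(k i : ℝ)| / L) Filter.atTop (nhds 1) := by
    simpa using (tendsto_const_div_atTop_nhds_zero_nat |(k i : ℝ)|).const_sub 1
  refine tendsto_of_tendsto_of_tendsto_of_le_of_le' hlow tendsto_const_nhds ?_ ?_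
  · filter_upwards [Filter.eventually_gt_atTop 0] with L hL
    have hL' : (0 : ℝ) < L := by exact_mod_cast hL
    rw [le_div_iff₀ hL', sub_mul, div_mul_cancel₀ _ hL'.ne', one_mul]
    exact (count_one L (k i)).2
  · filter_upwards [Filter.eventually_gt_atTop 0] with L hL
    have hL' : (0 : ℝ) < L := by exact_mod_cast hL
    rw [div_le_one hL']
    exact (count_one L (k i)).1
end Fourier

section StateCS
variable {H : Type*} [NormedAddCommGroup H] [InnerProductSpace ℂ H] [CompleteSpace H]
theorem StateBH.cs {G : (H →L[ℂ] H) →L[ℂ] ℂ} (hG : StateBH H G) (X Y : H →L[ℂ] H) :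
    ‖G (star X * Y)‖ ^ 2 ≤ (G (star X * X)).re * (G (star Y * Y)).re := by
  refine cs_scalar _ _ (G (star Y * X)) _ (hG.nonneg X) fun l => ?_
  have := hG.gram_nonneg (ι := Bool) (fun b => cond b X Y) (fun b => cond b l 1)
  simp only [Fintype.sum_bool, cond_true, cond_false, map_one, one_mul, mul_one] at this
  convert this using 1
  ring
theorem StateBH.cs_zero {G : (H →L[ℂ] H) →L[ℂ] ℂ} (hG : StateBH H G) (X Y : H →L[ℂ] H)
    (h : G (star X * X) = 0) : G (star X * Y) = 0 := by
  have := hG.cs X Y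
  rw [h, Complex.zero_re, zero_mul] at this
  simpa using this
end StateCS

section Folner
variable {r : ℕ} {Λ : HigherRankGraph r} [Fintype Λ.Obj] [DecidableEq Λ.Obj] [∀ l, Fintype (Λ.Mor l)]
  [∀ l, DecidableEq (Λ.Mor l)]
  {A : Type*} [Ring A] [StarRing A] [Algebra ℂ A] [StarModule ℂ A]
  {D : Type*} [Ring D] [StarRing D] [Algebra ℂ D] [StarModule ℂ D]
  {H : Type*} [NormedAddCommGroup H] [InnerProductSpace ℂ H] [CompleteSpace H]
namespace CKF
variable {s : ∀ l : Fin r → ℕ, Λ.Mor l → A}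
variable (π : A →⋆ₐ[ℂ] (H →L[ℂ] H)) (τ : D →⋆ₐ[ℂ] (H →L[ℂ] H))

theorem s_mem (hs : CKF Λ s) {l : Fin r → ℕ} (u : Λ.Mor l) : s l u ∈ gr s (dz l) := by
  have h := gen_mem (s := s) u (Λ.id' (Λ.tgt u))
  rw [hs.sa, hs.unitr] at h
  convert h using 1
  have : dz (0 : Fin r → ℕ) = 0 := rfl
  rw [this, sub_zero]

theorem weights (hs : CKF Λ s) {G : (H →L[ℂ] H) →L[ℂ] ℂ} (hG : StateBH H G) (t : Λ.Obj) :
    ∃ (e : Fin r → ℤ) (c : A), c ∈ gr s e ∧ s 0 (Λ.id' t) * c = c ∧ (G (π (star c * c)) = 1 ∨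
      (c = 0 ∧ ∀ (l : Fin r → ℕ) (u : Λ.Mor l), Λ.tgt u = t → G (π (s l u * star (s l u))) = 0)) := by
  by_cases h : ∀ (l : Fin r → ℕ) (u : Λ.Mor l), Λ.tgt u = t → G (π (s l u * star (s l u))) = 0
  · exact ⟨0, 0, zero_mem _, by simp, Or.inr ⟨rfl, h⟩⟩
  · push Not at h
    obtain ⟨l, u, rfl, hu⟩ := h
    have hpos := hG.nonneg (π (star (s l u)))
    rw [← map_star, ← map_mul, star_star] at hpos
    set κ := G (π (s l u * star (s l u))) with hκ
    have hκr : κ = (κ.re : ℂ) := by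
      apply Complex.ext <;> simp [← (Complex.nonneg_iff.mp hpos).2]
    have hre : 0 < κ.re := by
      rcases (Complex.nonneg_iff.mp hpos).1.lt_or_eq with h | h
      · exact h
      · exact absurd (by rw [hκr, ← h]; simp) hu
    refine ⟨-dz l, ((Real.sqrt κ.re : ℝ) : ℂ)⁻¹ • star (s l u), Submodule.smul_mem _ _ (star_gr (hs.s_mem u)), ?_, Or.inl ?_⟩
    · rw [mul_smul_comm]
      congr 1
      have := congrArg star (hs.unitr u)
      rwa [star_mul, hs.sa] at this
    · rw [star_smul, smul_mul_smul_comm, star_star, map_smul, map_smul, ← hκ, smul_eq_mul, Complex.star_def, map_inv₀, Complex.conj_ofReal,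
        ← mul_inv, ← Complex.ofReal_mul, Real.mul_self_sqrt hre.le]
      rw [← hκr]
      exact inv_mul_cancel₀ hu

theorem S_eq (hs : CKF Λ s) {G : (H →L[ℂ] H) →L[ℂ] ℂ} (hG : StateBH H G) (w : Λ.Obj → A)
    (hw1 : ∀ t, s 0 (Λ.id' t) * w t = w t)
    (hw2 : ∀ t, G (π (star (w t) * w t)) = 1 ∨
      (w t = 0 ∧ ∀ (l : Fin r → ℕ) (u : Λ.Mor l), Λ.tgt u = t → G (π (s l u * star (s l u))) = 0))
    {l m n n' : Fin r → ℕ} (x : Λ.Mor l) (y : Λ.Mor m) (hn : l ≤ n)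
    (hnn : dz l - dz m = dz n - dz n') (T : D) :
    ∑ u : Λ.Mor n, ∑ v : Λ.Mor n', G (π (star (s n u * w (Λ.tgt u)) * (s l x * star (s m y)) * (s n' v * w (Λ.tgt v)))) *
      G (π (s n u * star (s n' v)) * τ T) = G (π (s l x * star (s m y)) * τ T) := by
  have key : ∀ (u : Λ.Mor n) (v : Λ.Mor n'), G (π (star (s n u * w (Λ.tgt u)) * (s l x * star (s m y)) * (s n' v * w (Λ.tgt v)))) *
      G (π (s n u * star (s n' v)) * τ T) = G (π ((s n u * star (s n u)) * (s l x * star (s m y)) * (s n' v * star (s n' v))) * τ T) := by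
    intro u v
    obtain ⟨c, hc, hc'⟩ := hs.good x y hn hnn u v
    have e1 : star (s n u * w (Λ.tgt u)) * (s l x * star (s m y)) * (s n' v * w (Λ.tgt v)) =
        c • (star (w (Λ.tgt u)) * (s 0 (Λ.id' (Λ.tgt u)) * w (Λ.tgt v))) := by
      rw [← mul_smul_comm, ← smul_mul_assoc, ← hc, star_mul]; simp only [mul_assoc]
    have e2 : (s n u * star (s n u)) * (s l x * star (s m y)) * (s n' v * star (s n' v)) =
        c • (s n u * star (s n' v)) := by
      have : (s n u * star (s n u)) * (s l x * star (s m y)) * (s n' v * star (s n' v)) =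
        s n u * (star (s n u) * (s l x * star (s m y)) * s n' v) * star (s n' v) := by simp only [mul_assoc]
      rw [this, hc, mul_smul_comm, hs.unitr, smul_mul_assoc]
    rw [e1, e2]
    rcases hc' with h0 | ht
    · simp [h0]
    · rw [← ht, hw1]
      simp only [map_smul, smul_mul_assoc, smul_eq_mul]
      rcases hw2 (Λ.tgt u) with h | ⟨h, h'⟩
      · rw [h, mul_one]
      · have := hG.cs_zero (π (star (s n u))) (π (star (s n' v)) * τ T) (by
          rw [← map_star, ← map_mul, star_star]; exact h' n u rfl)
        rw [← map_star, star_star, ← mul_assoc, ← map_mul] at this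
        rw [this, h]; simp
  simp_rw [key]
  simp only [← map_sum, ← Finset.sum_mul, ← Finset.mul_sum, hs.sum_range, one_mul, mul_one]


def dg {r : ℕ} (L : ℕ) (n : Fin r → Fin L) : Fin r → ℕ := fun i => L + n i

noncomputable def fF (s : ∀ l : Fin r → ℕ, Λ.Mor l → A) (G : (H →L[ℂ] H) →L[ℂ] ℂ) (w : Λ.Obj → A) (L : ℕ) :
    (Fin r → ℤ) × A × D → ℂ :=
  ∑ j : Fin r → Fin (2 * L), (1 / (((2 * L : ℕ) : ℝ) ^ r * (L : ℝ) ^ r)) • tw (gr s) (zeta (2 * L) j)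
    (bas π τ G (ι := Σ n : Fin r → Fin L, Λ.Mor (dg L n)) (fun i => s _ i.2 * w (Λ.tgt i.2))
      (fun i => chi (zeta (2 * L) j) (dz (dg L i.1)) • star (s _ i.2)))

theorem fF_mem (hs : CKF Λ s) (G : (H →L[ℂ] H) →L[ℂ] ℂ) (w : Λ.Obj → A) (e : Λ.Obj → Fin r → ℤ)
    (hw : ∀ t, w t ∈ gr s (e t)) (L : ℕ) : fF π τ s G w L ∈ CC π τ (gr s) G := by
  refine sum_mem fun j _ => ?_
  rw [← tw_smul]
  refine AddSubmonoid.subset_closure ⟨_, _, VV_smul π τ G _ (by positivity) _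
    (AddSubmonoid.subset_closure ⟨_, inferInstance, fun i => dz (dg L i.1) + e (Λ.tgt i.2), _, _, ?_, rfl⟩), rfl⟩
  intro i
  exact hs.s_mul_gr _ (hw _)

theorem fF_PD (hs : CKF Λ s) (hcomm : ∀ a T, Commute (π a) (τ T)) {G : (H →L[ℂ] H) →L[ℂ] ℂ} (hG : StateBH H G) (w : Λ.Obj → A)
    (L : ℕ) : PD (gr s) (fF π τ s G w L : (Fin r → ℤ) × A × D → ℂ) := by
  unfold fF
  refine Finset.sum_induction _ (PD (gr s)) (fun a b ha hb => ha.add hb) PD.zero' fun j _ => ?_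
  exact (PD_bas π τ hcomm hs.graded hG _ _ _).smul (by positivity)

theorem fF_gen (hs : CKF Λ s) {G : (H →L[ℂ] H) →L[ℂ] ℂ} (hG : StateBH H G) (w : Λ.Obj → A)
    (hw1 : ∀ t, s 0 (Λ.id' t) * w t = w t)
    (hw2 : ∀ t, G (π (star (w t) * w t)) = 1 ∨
      (w t = 0 ∧ ∀ (l : Fin r → ℕ) (u : Λ.Mor l), Λ.tgt u = t → G (π (s l u * star (s l u))) = 0))
    (L : ℕ) (hL : 0 < L) {l m : Fin r → ℕ} (x : Λ.Mor l) (y : Λ.Mor m) (hl : ∀ i, l i ≤ L) (hm : ∀ i, m i ≤ L) (T : D) :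
    fF π τ s G w L (dz l - dz m, s l x * star (s m y), T) =
      ((cnt L (dz l - dz m) / (L : ℝ) ^ r : ℝ) : ℂ) * G (π (s l x * star (s m y)) * τ T) := by
  set a := s l x * star (s m y) with ha
  set k := dz l - dz m with hk
  let Sm : (Fin r → Fin L) → (Fin r → Fin L) → ℂ := fun n n' =>
    ∑ u : Λ.Mor (dg L n), ∑ v : Λ.Mor (dg L n'), G (π (star (s _ u * w (Λ.tgt u)) * a * (s _ v * w (Λ.tgt v)))) *
      G (π (s _ u * star (s _ v)) * τ T)
  have hb : ∀ z : Fin r → Circle, chi z k * bas π τ G (ι := Σ n : Fin r → Fin L, Λ.Mor (dg L n)) (fun i => s _ i.2 * w (Λ.tgt i.2))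
      (fun i => chi z (dz (dg L i.1)) • star (s _ i.2)) a T =
      ∑ n : Fin r → Fin L, ∑ n' : Fin r → Fin L, chi z (k + dz (dg L n') - dz (dg L n)) * Sm n n' := by
    intro z
    simp only [bas, Fintype.sum_sigma, Finset.mul_sum, Sm]
    refine Finset.sum_congr rfl fun n _ => ?_
    rw [Finset.sum_comm]
    refine Finset.sum_congr rfl fun n' _ => Finset.sum_congr rfl fun u _ => Finset.sum_congr rfl fun v _ => ?_
    rw [star_smul, star_star, smul_mul_smul_comm, map_smul, smul_mul_assoc, map_smul, chi_sub z (k + dz (dg L n')), chi_add, smul_eq_mul, Complex.star_def]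
    ring
  have hd : ∀ (n n' : Fin r → Fin L) i, (k + dz (dg L n') - dz (dg L n)) i = k i + (n' i : ℤ) - (n i : ℤ) := by
    intro n n' i
    simp [dz, dg]
    ring
  have hbd : ∀ (n n' : Fin r → Fin L) i, |(k + dz (dg L n') - dz (dg L n)) i| < ((2 * L : ℕ) : ℤ) := by
    intro n n' i
    rw [hd, abs_lt]
    have h1 := hl i
    have h2 := hm i
    have h3 := (n i).2
    have h4 := (n' i).2
    simp only [hk, Pi.sub_apply, dz]
    push_cast
    constructor <;> omega
  have hL' : (L : ℂ) ≠ 0 := by exact_mod_cast hL.ne'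
  unfold fF
  rw [Finset.sum_apply]
  simp only [Pi.smul_apply]
  have hmem : a ∈ gr s k := gen_mem x y
  simp_rw [tw_of_mem _ _ _ hmem, hb]
  rw [← Finset.smul_sum, Finset.sum_comm]
  have h5 : ∀ n : Fin r → Fin L, (∑ j : Fin r → Fin (2 * L), ∑ n' : Fin r → Fin L,
      chi (zeta (2 * L) j) (k + dz (dg L n') - dz (dg L n)) * Sm n n') =
      ∑ n' : Fin r → Fin L, (if ∀ i, k i + (n' i : ℤ) - (n i : ℤ) = 0 then 1 else 0 : ℂ) * (((2 * L : ℕ) : ℂ) ^ r * G (π a * τ T)) := by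
    intro n
    rw [Finset.sum_comm]
    refine Finset.sum_congr rfl fun n' _ => ?_
    rw [← Finset.sum_mul, four_sum (2 * L) (by omega) _ (hbd n n')]
    have hiff : (k + dz (dg L n') - dz (dg L n) = 0) ↔ ∀ i, k i + (n' i : ℤ) - (n i : ℤ) = 0 := by
      rw [funext_iff]; simp only [hd, Pi.zero_apply]
    by_cases h : ∀ i, k i + (n' i : ℤ) - (n i : ℤ) = 0
    · rw [if_pos (hiff.2 h), if_pos h, one_mul]
      congr 1
      refine hs.S_eq π τ hG w hw1 hw2 x y (fun i => (hl i).trans (Nat.le_add_right _ _)) ?_ T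
      have := hiff.2 h
      exact eq_sub_of_add_eq (sub_eq_zero.mp this)
    · rw [if_neg (fun h' => h (hiff.1 h')), if_neg h]; simp
  simp_rw [h5]
  have h6 : (cnt L k : ℂ) = ∑ n : Fin r → Fin L, ∑ n' : Fin r → Fin L, (if ∀ i, k i + (n' i : ℤ) - (n i : ℤ) = 0 then 1 else 0 : ℂ) := by
    unfold cnt
    push_cast
    refine Finset.sum_congr rfl fun n _ => Finset.sum_congr rfl fun n' _ => ?_
    split_ifs <;> simp
  simp_rw [← Finset.sum_mul]
  rw [← h6, Complex.real_smul]
  push_cast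
  field_simp

theorem folner (hs : CKF Λ s) (hcomm : ∀ a T, Commute (π a) (τ T)) {G : (H →L[ℂ] H) →L[ℂ] ℂ} (hG : StateBH H G) :
    RR π τ (gr s) G ∈ closure (CC π τ (gr s) G : Set ((Fin r → ℤ) × A × D → ℂ)) := by
  choose e w hwm hw1 hw2 using hs.weights π hG
  refine mem_closure_of_tendsto (f := fun L : ℕ => fF π τ s G w L) (b := Filter.atTop) ?_
    (Filter.Eventually.of_forall fun L => hs.fF_mem π τ G w e hwm L)
  rw [tendsto_pi_nhds]
  rintro ⟨k, a, T⟩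
  have hPD := fun L => hs.fF_PD π τ hcomm hG w L
  have hR := (RR_mem_EE π τ hcomm hs.graded hG).1
  by_cases ha : a ∈ gr s k
  swap
  · rw [hR.zero k a T ha]
    simp_rw [(hPD _).zero k a T ha]
    exact tendsto_const_nhds
  have ha' := ha
  unfold gr at ha'
  induction ha' using Submodule.span_induction with
  | mem a hx =>
    obtain ⟨l, m, x, y, hd, rfl⟩ := hx
    subst hd
    rw [RR, tw_of_mem _ _ _ (gen_mem x y), chi_one]
    have h1 := ((Complex.continuous_ofReal.tendsto 1).comp (cnt_tendsto (dz l - dz m))).mul_const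
      (G (π (s l x * star (s m y)) * τ T))
    rw [Complex.ofReal_one] at h1
    refine h1.congr' ?_
    filter_upwards [Filter.eventually_gt_atTop 0, Filter.eventually_ge_atTop (∑ i, l i), Filter.eventually_ge_atTop (∑ i, m i)] with L hL hl hm
    rw [hs.fF_gen π τ hG w hw1 hw2 L hL x y (fun i => (Finset.single_le_sum (f := l) (fun _ _ => Nat.zero_le _) (Finset.mem_univ i)).trans hl)
      (fun i => (Finset.single_le_sum (f := m) (fun _ _ => Nat.zero_le _) (Finset.mem_univ i)).trans hm)]
    rfl
  | zero =>
    have h0 : ∀ {h : (Fin r → ℤ) × A × D → ℂ}, PD (gr s) h → h (k, 0, T) = 0 := by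
      intro h hh
      have := hh.smul_left k 0 0 T (zero_mem _)
      simpa using this
    rw [h0 hR]
    simp_rw [h0 (hPD _)]
    exact tendsto_const_nhds
  | add a b h1 h2 iha ihb =>
    rw [hR.add_left k a b T h1 h2]
    simp_rw [(hPD _).add_left k a b T h1 h2]
    exact (iha h1).add (ihb h2)
  | smul c a h1 iha =>
    rw [hR.smul_left k c a T h1]
    simp_rw [(hPD _).smul_left k c a T h1]
    exact (iha h1).const_mul c

end CKF
end Folner
end Part7

section Part8
set_option linter.unusedSectionVars false
set_option linter.unusedVariables false
set_option linter.unusedSimpArgs false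

open scoped ComplexOrder InnerProductSpace ComplexConjugate

section HsqSec
variable {H : Type*} [NormedAddCommGroup H] [InnerProductSpace ℂ H] [CompleteSpace H]

theorem centralizer_hsq (S : Set (H →L[ℂ] H)) (T : StarSubalgebra.centralizer ℂ S) :
    ∃ (c : ℝ) (R : StarSubalgebra.centralizer ℂ S), star T * T + star R * R = (c : ℂ) • 1 := by
  set x : H →L[ℂ] H := (T : H →L[ℂ] H) with hx
  have h0 : star x * x ≤ algebraMap ℝ (H →L[ℂ] H) (‖x‖ ^ 2) := CStarAlgebra.star_mul_le_algebraMap_norm_sq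
  set b := algebraMap ℝ (H →L[ℂ] H) (‖x‖ ^ 2) - star x * x with hb
  have hb0 : 0 ≤ b := sub_nonneg.2 h0
  have hmem : CFC.sqrt b ∈ StarSubalgebra.centralizer ℂ S := by
    have hT := T.2
    rw [← SetLike.mem_coe, StarSubalgebra.coe_centralizer] at hT ⊢
    rw [Set.mem_centralizer_iff] at hT ⊢
    have hT' := (star T).2
    rw [← SetLike.mem_coe, StarSubalgebra.coe_centralizer, Set.mem_centralizer_iff] at hT'
    intro m hm
    have h1 : Commute b m := by
      have e1 : Commute x m := (hT m hm).symm
      have e2 : Commute (star x) m := (hT' m hm).symm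
      have e3 : Commute (algebraMap ℝ (H →L[ℂ] H) (‖x‖ ^ 2)) m := Algebra.commutes (‖x‖ ^ 2) m
      exact e3.sub_left (e2.mul_left e1)
    exact (h1.cfcₙ_nnreal _).symm.eq
  refine ⟨‖x‖ ^ 2, ⟨CFC.sqrt b, hmem⟩, ?_⟩
  ext1
  have h2 : star (CFC.sqrt b) * CFC.sqrt b = b := by
    rw [(CFC.sqrt_nonneg b).isSelfAdjoint.star_eq, CFC.sqrt_mul_sqrt_self b hb0]
  change star x * x + star (CFC.sqrt b) * CFC.sqrt b = ((‖x‖ ^ 2 : ℝ) : ℂ) • 1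
  rw [h2, hb, Algebra.algebraMap_eq_smul_one, Complex.coe_smul]
  abel
end HsqSec

section ThetaSec
variable {A : Type*} [Ring A] [StarRing A] [Algebra ℂ A] [StarModule ℂ A]

def ThetaGen (A : Type*) [Ring A] [StarRing A] [Algebra ℂ A] : Set (A → A) :=
  {θ | ∃ (ι : Type) (_ : Fintype ι) (k : A →ₗ[ℂ] ℂ) (c y : ι → A), (∀ a, 0 ≤ k (star a * a)) ∧
    θ = fun a => ∑ i, ∑ j, k (star (c i) * a * c j) • (star (y i) * y j)}

def Theta (A : Type*) [Ring A] [StarRing A] [Algebra ℂ A] : AddSubmonoid (A → A) :=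
  AddSubmonoid.closure (ThetaGen A)

variable {r : ℕ} {Λ : HigherRankGraph r} [Fintype Λ.Obj] [DecidableEq Λ.Obj] [∀ l, Fintype (Λ.Mor l)]
  [∀ l, DecidableEq (Λ.Mor l)]
  {H : Type*} [NormedAddCommGroup H] [InnerProductSpace ℂ H] [CompleteSpace H]
  {s : ∀ l : Fin r → ℕ, Λ.Mor l → A}
  (π : A →⋆ₐ[ℂ] (H →L[ℂ] H))

noncomputable def vecState (ξ : H) : (H →L[ℂ] H) →L[ℂ] ℂ :=
  (innerSL ℂ ξ).comp (ContinuousLinearMap.apply ℂ H ξ)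

theorem vecState_apply (ξ : H) (X : H →L[ℂ] H) : vecState ξ X = ⟪ξ, X ξ⟫_ℂ := rfl

theorem vecState_state (ξ : H) (hξ : ‖ξ‖ = 1) : StateBH H (vecState ξ) := by
  constructor
  · refine ContinuousLinearMap.opNorm_le_bound _ zero_le_one fun X => ?_
    rw [vecState_apply]
    refine (norm_inner_le_norm _ _).trans ?_
    have := X.le_opNorm ξ
    rw [hξ] at *
    linarith
  · rw [vecState_apply]
    simp [hξ]

theorem theta_approx (ξ : H) (hcyc : Dense (Set.range fun a => π a ξ))
    {N : Type} [Fintype N] (a : N → A) (T : N → (H →L[ℂ] H)) (hT : ∀ i a, Commute (π a) (T i))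
    {G : (H →L[ℂ] H) →L[ℂ] ℂ} (hG : StateBH H G) {ι : Type} [Fintype ι] (c b : ι → A) (δ : ℝ) (hδ : 0 < δ) :
    ∃ θ ∈ Theta A, ∀ n, ‖∑ i, ∑ j, G (π (star (c i) * a n * c j)) * G (π (star (b i) * b j) * T n) -
      ⟪ξ, (π (θ (a n)) * T n) ξ⟫_ℂ‖ < δ := by
  set M : ℝ := 1 + ∑ n, ∑ i, ∑ j, ‖G (π (star (c i) * a n * c j))‖ with hM
  have hMpos : 0 < M := by positivity
  obtain ⟨q, k, hk, happ⟩ := hG.approx _ hcyc (ι := ι × ι × N) (fun x => π (star (b x.1) * b x.2.1) * T x.2.2)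
    (δ / M) (by positivity)
  choose x hx using hk
  refine ⟨∑ t : Fin q, fun a => ∑ i, ∑ j, G (π (star (c i) * a * c j)) • (star (b i * x t) * (b j * x t)),
    sum_mem fun t _ => AddSubmonoid.subset_closure ⟨ι, inferInstance, G.toLinearMap.comp π.toAlgHom.toLinearMap, c, fun i => b i * x t, ?_, rfl⟩, ?_⟩
  · intro a
    have := hG.nonneg (π a)
    rw [← map_star, ← map_mul] at this
    exact this
  · intro n
    have e1 : ⟪ξ, (π ((∑ t : Fin q, fun a => ∑ i, ∑ j, G (π (star (c i) * a * c j)) • (star (b i * x t) * (b j * x t))) (a n)) * T n) ξ⟫_ℂ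
        = ∑ i, ∑ j, G (π (star (c i) * a n * c j)) * ∑ t, ⟪k t, (π (star (b i) * b j) * T n) (k t)⟫_ℂ := by
      rw [Finset.sum_apply]
      simp only [map_sum, map_smul, Finset.sum_mul, smul_mul_assoc, ContinuousLinearMap.sum_apply, ContinuousLinearMap.smul_apply,
        inner_sum, inner_smul_right, Finset.mul_sum]
      rw [Finset.sum_comm]
      refine Finset.sum_congr rfl fun i _ => ?_
      rw [Finset.sum_comm]
      refine Finset.sum_congr rfl fun j _ => Finset.sum_congr rfl fun t _ => ?_
      congr 1
      rw [← hx t]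
      have e2 : π (star (b i * x t) * (b j * x t)) * T n = star (π (x t)) * ((π (star (b i) * b j) * T n) * π (x t)) := by
        rw [mul_assoc (π (star (b i) * b j)), ← (hT n (x t)).eq, star_mul, ← map_star]
        simp only [map_mul, mul_assoc]
      rw [e2, ContinuousLinearMap.mul_apply, ContinuousLinearMap.star_eq_adjoint, ContinuousLinearMap.adjoint_inner_right]
      rfl
    rw [e1, ← Finset.sum_sub_distrib]
    simp_rw [← Finset.sum_sub_distrib, ← mul_sub]
    calc _ ≤ ∑ i, ∑ j, ‖G (π (star (c i) * a n * c j))‖ * (δ / M) := by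
          refine (norm_sum_le _ _).trans (Finset.sum_le_sum fun i _ => (norm_sum_le _ _).trans (Finset.sum_le_sum fun j _ => ?_))
          rw [norm_mul]
          gcongr
          exact (happ (i, j, n)).le
      _ = (∑ i, ∑ j, ‖G (π (star (c i) * a n * c j))‖) * (δ / M) := by simp_rw [Finset.sum_mul]
      _ < M * (δ / M) := by
          gcongr
          have := Finset.single_le_sum (f := fun n => ∑ i, ∑ j, ‖G (π (star (c i) * a n * c j))‖)
            (fun n _ => by positivity) (Finset.mem_univ n)
          rw [hM]; linarith
      _ = δ := by field_simp

theorem theta_main (hs : CKF Λ s) (ξ : H) (hξ : ‖ξ‖ = 1) (hcyc : Dense (Set.range fun a => π a ξ))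
    {N : Type} [Fintype N] (d : N → Fin r → ℤ) (a : N → A) (ha : ∀ n, a n ∈ CKF.gr s (d n))
    (T : N → (H →L[ℂ] H)) (hT : ∀ i a, Commute (π a) (T i)) (δ : ℝ) (hδ : 0 < δ) :
    ∃ θ ∈ Theta A, ∀ n, ‖⟪ξ, (π (a n) * T n) ξ⟫_ℂ - ⟪ξ, (π (θ (a n)) * T n) ξ⟫_ℂ‖ < δ := by
  let Dsub := StarSubalgebra.centralizer ℂ (Set.range π)
  let τ : Dsub →⋆ₐ[ℂ] (H →L[ℂ] H) := Dsub.subtype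
  have hcomm : ∀ a (T : Dsub), Commute (π a) (τ T) := by
    intro a T
    have hT := T.2
    rw [← SetLike.mem_coe, StarSubalgebra.coe_centralizer, Set.mem_centralizer_iff] at hT
    exact hT _ (Or.inl ⟨a, rfl⟩)
  have hTm : ∀ n, T n ∈ Dsub := by
    intro n
    rw [← SetLike.mem_coe, StarSubalgebra.coe_centralizer, Set.mem_centralizer_iff]
    rintro m (⟨a, rfl⟩ | ⟨a, ha⟩)
    · exact hT n a
    · have : m = π (star a) := by rw [map_star, ha, star_star]
      rw [this]; exact hT n _
  have hkm := krein_main π τ hcomm hs.graded (centralizer_hsq _)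
    (fun G hG => hs.folner π τ hcomm hG) (vecState_state ξ hξ)
  have hopen : IsOpen {f : (Fin r → ℤ) × A × Dsub → ℂ | ∀ n, ‖RR π τ (CKF.gr s) (vecState ξ) (d n, a n, ⟨T n, hTm n⟩) - f (d n, a n, ⟨T n, hTm n⟩)‖ < δ / 2} := by
    simp only [Set.setOf_forall]
    exact isOpen_iInter_of_finite fun n => isOpen_lt (by fun_prop) continuous_const
  obtain ⟨f, hf, hfm⟩ := mem_closure_iff.1 hkm _ hopen (by intro n; simpa using hδ)
  obtain ⟨v, hv, rfl⟩ := hfm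
  have claim : ∀ η : ℝ, 0 < η → ∃ θ ∈ Theta A, ∀ n, ‖v (a n) ⟨T n, hTm n⟩ - ⟪ξ, (π (θ (a n)) * T n) ξ⟫_ℂ‖ < η := by
    clear hf
    have hadd : ∀ v w : A → Dsub → ℂ, (∀ η : ℝ, 0 < η → ∃ θ ∈ Theta A, ∀ n, ‖v (a n) ⟨T n, hTm n⟩ - ⟪ξ, (π (θ (a n)) * T n) ξ⟫_ℂ‖ < η) →
       (∀ η : ℝ, 0 < η → ∃ θ ∈ Theta A, ∀ n, ‖w (a n) ⟨T n, hTm n⟩ - ⟪ξ, (π (θ (a n)) * T n) ξ⟫_ℂ‖ < η) →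
       ∀ η : ℝ, 0 < η → ∃ θ ∈ Theta A, ∀ n, ‖(v + w) (a n) ⟨T n, hTm n⟩ - ⟪ξ, (π (θ (a n)) * T n) ξ⟫_ℂ‖ < η := by
      intro v w h1 h2 η hη
      obtain ⟨θ, hθ, h1⟩ := h1 (η / 2) (by positivity)
      obtain ⟨θ', hθ', h2⟩ := h2 (η / 2) (by positivity)
      refine ⟨θ + θ', add_mem hθ hθ', fun n => ?_⟩
      have : (v + w) (a n) ⟨T n, hTm n⟩ - ⟪ξ, (π ((θ + θ') (a n)) * T n) ξ⟫_ℂ = (v (a n) ⟨T n, hTm n⟩ - ⟪ξ, (π (θ (a n)) * T n) ξ⟫_ℂ) +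
        (w (a n) ⟨T n, hTm n⟩ - ⟪ξ, (π (θ' (a n)) * T n) ξ⟫_ℂ) := by
        simp only [Pi.add_apply, map_add, add_mul, ContinuousLinearMap.add_apply, inner_add_right]; ring
      rw [this]
      exact (norm_add_le _ _).trans_lt (by linarith [h1 n, h2 n])
    have hzero : ∀ η : ℝ, 0 < η → ∃ θ ∈ Theta A, ∀ n, ‖(0 : A → Dsub → ℂ) (a n) ⟨T n, hTm n⟩ - ⟪ξ, (π (θ (a n)) * T n) ξ⟫_ℂ‖ < η := by
      intro η hη
      exact ⟨0, zero_mem _, fun n => by simpa using hη⟩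
    induction hv using AddSubmonoid.closure_induction with
    | zero => exact hzero
    | add v w _ _ h1 h2 => exact hadd v w h1 h2
    | mem v hv =>
      simp only [Set.mem_iUnion] at hv
      obtain ⟨G, hG, hv⟩ := hv
      unfold VV at hv
      rw [SetLike.mem_coe] at hv
      induction hv using AddSubmonoid.closure_induction with
      | zero => exact hzero
      | add v w _ _ h1 h2 => exact hadd v w h1 h2
      | mem v hv =>
        obtain ⟨ι, _, e, c, b, hc, rfl⟩ := hv
        intro η hη
        exact theta_approx π ξ hcyc a T hT hG c b η hη
  obtain ⟨θ, hθ, h⟩ := claim (δ / 2) (by positivity)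
  refine ⟨θ, hθ, fun n => ?_⟩
  have h1 := hf n
  rw [RR, tw_of_mem _ _ _ (ha n), tw_of_mem _ _ _ (ha n), chi_one, one_mul, one_mul, vecState_apply] at h1
  have h2 := h n
  calc _ ≤ _ := norm_sub_le_norm_sub_add_norm_sub _ (v (a n) ⟨T n, hTm n⟩) _
    _ < δ / 2 + δ / 2 := add_lt_add h1 h2
    _ = δ := by ring
end ThetaSec
end Part8

section Part9
set_option linter.unusedSectionVars false
set_option linter.unusedVariables false
set_option linter.unusedSimpArgs false

open scoped ComplexOrder InnerProductSpace ComplexConjugate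

section JordanSec
variable {A : Type*} [CStarAlgebra A] [PartialOrder A] [StarOrderedRing A] [Nontrivial A]

theorem jordan_real (h : selfAdjoint A →ₗ[ℝ] ℝ) (C : ℝ) (hC : ∀ x, |h x| ≤ C * ‖(x : A)‖) :
    ∃ g₁ g₂ : selfAdjoint A →ₗ[ℝ] ℝ, (∀ x : selfAdjoint A, 0 ≤ (x : A) → 0 ≤ g₁ x) ∧
      (∀ x : selfAdjoint A, 0 ≤ (x : A) → 0 ≤ g₂ x) ∧ ∀ x, h x = g₁ x - g₂ x := by
  have hC0 : 0 ≤ C := by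
    have := hC 1
    have h2 : (0 : ℝ) < ‖((1 : selfAdjoint A) : A)‖ := by simp
    by_contra h3
    push Not at h3
    have := (abs_nonneg (h 1)).trans this
    nlinarith
  let W : (selfAdjoint A × ℝ) →ₗ[ℝ] (selfAdjoint A × selfAdjoint A) :=
    { toFun := fun p => (p.1 + p.2 • 1, -p.1 + p.2 • 1)
      map_add' := by
        rintro ⟨x, t⟩ ⟨y, u⟩
        ext1 <;> simp only [Prod.mk_add_mk, add_smul] <;> abel
      map_smul' := by
        rintro c ⟨x, t⟩
        ext1 <;> simp [mul_smul] }
  have hW : Function.Injective W := by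
    rw [← LinearMap.ker_eq_bot, LinearMap.ker_eq_bot']
    rintro ⟨x, t⟩ hxt
    have e1 : x + t • (1 : selfAdjoint A) = 0 := congrArg Prod.fst hxt
    have e2 : -x + t • (1 : selfAdjoint A) = 0 := congrArg Prod.snd hxt
    have e3 : (t + t) • (1 : selfAdjoint A) = 0 := by
      rw [add_smul]
      calc _ = (x + t • (1 : selfAdjoint A)) + (-x + t • (1 : selfAdjoint A)) := by abel
        _ = 0 := by rw [e1, e2, add_zero]
    have ht : t = 0 := by
      rcases smul_eq_zero.1 e3 with h | h
      · linarith
      · exact absurd (congrArg Subtype.val h) (one_ne_zero (α := A))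
    subst ht
    simp at e1
    simp [e1]
  let K : PointedCone ℝ (selfAdjoint A × selfAdjoint A) :=
    { carrier := {p | 0 ≤ (p.1 : A) ∧ 0 ≤ (p.2 : A)}
      add_mem' := by
        rintro a b ⟨h1, h2⟩ ⟨h3, h4⟩
        exact ⟨by simpa using add_nonneg h1 h3, by simpa using add_nonneg h2 h4⟩
      zero_mem' := by simp
      smul_mem' := by
        rintro ⟨c, hc⟩ a ⟨h1, h2⟩
        exact ⟨by simpa using smul_nonneg hc h1, by simpa using smul_nonneg hc h2⟩ }
  let L : (selfAdjoint A × ℝ) →ₗ[ℝ] ℝ := h.comp (LinearMap.fst ℝ _ _) + (3 * C) • LinearMap.snd ℝ _ _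
  let f : (selfAdjoint A × selfAdjoint A) →ₗ.[ℝ] ℝ := ⟨LinearMap.range W, L.comp (LinearEquiv.ofInjective W hW).symm.toLinearMap⟩
  have hf : ∀ p (hp : W p ∈ f.domain), f ⟨W p, hp⟩ = L p := by
    intro p hp
    change L ((LinearEquiv.ofInjective W hW).symm ⟨W p, hp⟩) = L p
    congr 1
    exact (LinearEquiv.symm_apply_eq _).2 (by ext1; rfl)
  have hnn : ∀ x : f.domain, (x : selfAdjoint A × selfAdjoint A) ∈ K → 0 ≤ f x := by
    rintro ⟨_, ⟨⟨x, t⟩, rfl⟩⟩ ⟨h1, h2⟩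
    refine le_of_le_of_eq ?_ (hf (x, t) ⟨_, rfl⟩).symm
    have h1' : 0 ≤ (x : A) + t • (1 : A) := by simpa [W] using h1
    have h2' : 0 ≤ -(x : A) + t • (1 : A) := by simpa [W] using h2
    have h3 : (x : A) + t • (1 : A) ≤ (2 * t) • (1 : A) := by
      rw [← sub_nonneg]
      convert h2' using 1
      rw [two_mul, add_smul]; abel
    have h4 := CStarAlgebra.norm_le_norm_of_nonneg_of_le h1' h3
    have ht : 0 ≤ t := by
      have : 0 ≤ (2 * t) • (1 : A) := h1'.trans h3
      by_contra hneg
      push Not at hneg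
      have h5 : 0 ≤ (-(2 * t)) • (1 : A) := smul_nonneg (by linarith) zero_le_one
      rw [neg_smul] at h5
      have h6 : (2 * t) • (1 : A) = 0 := le_antisymm (neg_nonneg.1 h5) this
      rcases smul_eq_zero.1 h6 with h | h
      · linarith
      · exact one_ne_zero h
    have h5 : ‖(x : A)‖ ≤ 3 * t := by
      have : (x : A) = ((x : A) + t • (1 : A)) - t • (1 : A) := by abel
      rw [this]
      refine (norm_sub_le _ _).trans ?_
      rw [norm_smul, norm_one, Real.norm_of_nonneg (by positivity)] at h4
      rw [norm_smul, norm_one, Real.norm_of_nonneg ht]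
      linarith
    have h6 := hC x
    have h7 : C * ‖(x : A)‖ ≤ C * (3 * t) := by gcongr
    have h8 := neg_abs_le (h x)
    simp only [L, LinearMap.add_apply, LinearMap.comp_apply, LinearMap.fst_apply, LinearMap.smul_apply, LinearMap.snd_apply, smul_eq_mul]
    linarith
  have hdn : ∀ y, ∃ x : f.domain, (x : selfAdjoint A × selfAdjoint A) + y ∈ K := by
    rintro ⟨a, b⟩
    refine ⟨⟨W (0, ‖(a : A)‖ + ‖(b : A)‖), ⟨_, rfl⟩⟩, ?_, ?_⟩
    · have := a.2.neg_algebraMap_norm_le_self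
      rw [Algebra.algebraMap_eq_smul_one] at this
      simp only [W, LinearMap.coe_mk, AddHom.coe_mk, Prod.mk_add_mk, zero_add]
      have h2 : (0 : A) ≤ ‖(b : A)‖ • (1 : A) := smul_nonneg (norm_nonneg _) zero_le_one
      simp only [AddSubgroup.coe_add, selfAdjoint.val_smul, selfAdjoint.val_one, add_smul]
      have h3 := neg_le_iff_add_nonneg.1 this
      have : ‖(a : A)‖ • (1 : A) + ‖(b : A)‖ • (1 : A) + a = ((a : A) + ‖(a : A)‖ • (1 : A)) + ‖(b : A)‖ • (1 : A) := by abel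
      rw [this]
      exact add_nonneg h3 h2
    · have := b.2.neg_algebraMap_norm_le_self
      rw [Algebra.algebraMap_eq_smul_one] at this
      simp only [W, LinearMap.coe_mk, AddHom.coe_mk, Prod.mk_add_mk, zero_add, neg_zero]
      have h2 : (0 : A) ≤ ‖(a : A)‖ • (1 : A) := smul_nonneg (norm_nonneg _) zero_le_one
      simp only [AddSubgroup.coe_add, selfAdjoint.val_smul, selfAdjoint.val_one, add_smul]
      have h3 := neg_le_iff_add_nonneg.1 this
      have : ‖(a : A)‖ • (1 : A) + ‖(b : A)‖ • (1 : A) + b = ((b : A) + ‖(b : A)‖ • (1 : A)) + ‖(a : A)‖ • (1 : A) := by abel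
      rw [this]
      exact add_nonneg h3 h2
  obtain ⟨g, hg1, hg2⟩ := riesz_extension K f hnn hdn
  refine ⟨g.comp (LinearMap.inl ℝ _ _), g.comp (LinearMap.inr ℝ _ _), ?_, ?_, ?_⟩
  · intro x hx
    exact hg2 _ ⟨hx, by simp⟩
  · intro x hx
    exact hg2 _ ⟨by simp, hx⟩
  · intro x
    have e1 : g (W (x, 0)) = L (x, 0) := (hg1 ⟨W (x, 0), ⟨_, rfl⟩⟩).trans (hf _ _)
    have e2 : L (x, 0) = h x := by simp [L]
    rw [e2] at e1
    rw [← e1]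
    have e3 : W (x, 0) = LinearMap.inl ℝ _ _ x - LinearMap.inr ℝ _ _ x := by
      ext1 <;> simp [W]
    rw [e3, map_sub]
    rfl

noncomputable def cplx (g : selfAdjoint A →ₗ[ℝ] ℝ) : A →ₗ[ℂ] ℂ where
  toFun a := (g (realPart a) : ℂ) + Complex.I * g (imaginaryPart a)
  map_add' a b := by simp only [map_add, Complex.ofReal_add]; ring
  map_smul' c a := by
    rw [realPart_smul, imaginaryPart_smul]
    simp only [map_add, map_sub, map_smul, Complex.ofReal_add, Complex.ofReal_sub, smul_eq_mul, Complex.ofReal_mul, RingHom.id_apply]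
    conv_rhs => rw [← Complex.re_add_im c]
    have := Complex.I_mul_I
    linear_combination (-(c.im : ℂ) * g (imaginaryPart a)) * this

theorem cplx_sa (g : selfAdjoint A →ₗ[ℝ] ℝ) (x : selfAdjoint A) : cplx g (x : A) = g x := by
  simp [cplx]

noncomputable def cplxPos (g : selfAdjoint A →ₗ[ℝ] ℝ) (hg : ∀ x : selfAdjoint A, 0 ≤ (x : A) → 0 ≤ g x) : A →ₚ[ℂ] ℂ :=
  PositiveLinearMap.mk₀ (cplx g) fun x hx => by
    have := cplx_sa g ⟨x, hx.isSelfAdjoint⟩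
    simp only at this
    rw [this]
    exact_mod_cast hg ⟨x, hx.isSelfAdjoint⟩ hx

theorem jordan (f : A →L[ℂ] ℂ) : ∃ (g : Fin 4 → (A →ₚ[ℂ] ℂ)) (c : Fin 4 → ℂ), ∀ a, f a = ∑ i, c i * g i a := by
  let hre : selfAdjoint A →ₗ[ℝ] ℝ := Complex.reLm.comp ((f.toLinearMap.restrictScalars ℝ).comp (selfAdjoint.submodule ℝ A).subtype)
  let him : selfAdjoint A →ₗ[ℝ] ℝ := Complex.imLm.comp ((f.toLinearMap.restrictScalars ℝ).comp (selfAdjoint.submodule ℝ A).subtype)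
  obtain ⟨g0, g1, h0, h1, h01⟩ := jordan_real hre ‖f‖ fun x => (Complex.abs_re_le_norm _).trans (f.le_opNorm _)
  obtain ⟨g2, g3, h2, h3, h23⟩ := jordan_real him ‖f‖ fun x => (Complex.abs_im_le_norm _).trans (f.le_opNorm _)
  refine ⟨![cplxPos g0 h0, cplxPos g1 h1, cplxPos g2 h2, cplxPos g3 h3], ![1, -1, Complex.I, -Complex.I], fun a => ?_⟩
  have key : ∀ x : selfAdjoint A, f x = (g0 x - g1 x : ℝ) + Complex.I * (g2 x - g3 x : ℝ) := by
    intro x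
    rw [← h01, ← h23]
    have := Complex.re_add_im (f x)
    rw [mul_comm] at this
    exact this.symm
  have hcp : ∀ (g : selfAdjoint A →ₗ[ℝ] ℝ) hg (a : A), cplxPos g hg a = (g (realPart a) : ℂ) + Complex.I * g (imaginaryPart a) := fun _ _ _ => rfl
  rw [Fin.sum_univ_four]
  simp only [Matrix.cons_val, hcp]
  conv_lhs => rw [← realPart_add_I_smul_imaginaryPart a, map_add, map_smul, key, key]
  push_cast
  rw [smul_eq_mul]
  ring
end JordanSec
end Part9

section Part10
set_option linter.unusedSectionVars false
set_option linter.unusedVariables false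
set_option linter.unusedSimpArgs false

open scoped ComplexOrder InnerProductSpace ComplexConjugate

section RNSec
variable {A : Type*} [CStarAlgebra A] [PartialOrder A] [StarOrderedRing A]

noncomputable def rnV (f g : A →ₚ[ℂ] ℂ) (hfg : ∀ a : A, g (star a * a) ≤ f (star a * a)) : f.PreGNS →L[ℂ] g.PreGNS :=
  LinearMap.mkContinuous (g.toPreGNS.toLinearMap ∘ₗ f.ofPreGNS.toLinearMap) 1 fun x => by
    rw [one_mul, ← sq_le_sq₀ (by positivity) (by positivity), ← RCLike.ofReal_le_ofReal (K := ℂ),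
      RCLike.ofReal_eq_complex_ofReal, Complex.ofReal_pow, Complex.ofReal_pow,
      PositiveLinearMap.preGNS_norm_sq, PositiveLinearMap.preGNS_norm_sq]
    exact hfg _

theorem rnV_apply (f g : A →ₚ[ℂ] ℂ) (hfg) (a : A) : rnV f g hfg (f.toPreGNS a) = g.toPreGNS a := rfl

theorem rn_exists (f g : A →ₚ[ℂ] ℂ) (hfg : ∀ a : A, g (star a * a) ≤ f (star a * a)) :
    ∃ T : f.GNS →L[ℂ] f.GNS, (∀ a, Commute (f.gnsStarAlgHom a) T) ∧
      ∀ a b : A, ⟪((f.toPreGNS a : f.PreGNS) : f.GNS), T ((f.toPreGNS b : f.PreGNS) : f.GNS)⟫_ℂ = g (star a * b) := by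
  let V := (rnV f g hfg).completion
  have hV : ∀ a : A, V ((f.toPreGNS a : f.PreGNS) : f.GNS) = ((g.toPreGNS a : g.PreGNS) : g.GNS) := by
    intro a
    exact ContinuousLinearMap.completion_apply_coe _ _
  have hin : ∀ a b : A, ⟪((f.toPreGNS a : f.PreGNS) : f.GNS), (V.adjoint ∘L V) ((f.toPreGNS b : f.PreGNS) : f.GNS)⟫_ℂ = g (star a * b) := by
    intro a b
    rw [ContinuousLinearMap.comp_apply, ContinuousLinearMap.adjoint_inner_right, hV, hV, UniformSpace.Completion.inner_coe]
    rfl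
  refine ⟨V.adjoint ∘L V, ?_, hin⟩
  have hl : ∀ a b : A, f.gnsStarAlgHom a ((f.toPreGNS b : f.PreGNS) : f.GNS) = ((f.toPreGNS (a * b) : f.PreGNS) : f.GNS) := by
    intro a b
    exact PositiveLinearMap.gnsNonUnitalStarAlgHom_apply_coe f
  intro a
  change _ * _ = _ * _
  ext x
  refine ext_inner_left ℂ fun y => ?_
  induction x, y using UniformSpace.Completion.induction_on₂ with
  | hp => apply isClosed_eq <;> fun_prop
  | ih x y =>
    obtain ⟨x, rfl⟩ := f.toPreGNS.surjective x
    obtain ⟨y, rfl⟩ := f.toPreGNS.surjective y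
    rw [ContinuousLinearMap.mul_apply, ContinuousLinearMap.mul_apply, hl, hin]
    rw [← ContinuousLinearMap.adjoint_inner_left, ← ContinuousLinearMap.star_eq_adjoint, ← map_star, hl, hin]
    rw [star_mul, star_star, mul_assoc]

theorem gns_dense (f : A →ₚ[ℂ] ℂ) :
    Dense (Set.range fun a => f.gnsStarAlgHom a ((f.toPreGNS 1 : f.PreGNS) : f.GNS)) := by
  have : (fun a => f.gnsStarAlgHom a ((f.toPreGNS 1 : f.PreGNS) : f.GNS)) =
      (fun x : f.PreGNS => (x : f.GNS)) ∘ f.toPreGNS := by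
    funext a
    refine (PositiveLinearMap.gnsNonUnitalStarAlgHom_apply_coe f).trans ?_
    simp
  rw [this, Set.range_comp, f.toPreGNS.surjective.range_eq, Set.image_univ]
  exact UniformSpace.Completion.denseRange_coe

theorem posfun_exists_norm [Nontrivial A] : ∃ g : A →ₚ[ℂ] ℂ, 0 < g 1 := by
  obtain ⟨f, hf, hf1⟩ := exists_dual_vector ℂ (1 : A) (by simp)
  obtain ⟨g, c, hg⟩ := jordan f
  by_contra hcon
  push Not at hcon
  have : f 1 = 0 := by
    rw [hg]
    refine Finset.sum_eq_zero fun i _ => ?_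
    have h1 : 0 ≤ g i 1 := (g i).map_nonneg zero_le_one
    have : g i 1 = 0 := by
      by_contra h2
      exact hcon (g i) (lt_of_le_of_ne h1 (Ne.symm h2))
    rw [this, mul_zero]
  rw [this] at hf1
  simp at hf1

theorem Theta.smul {θ : A → A} (hθ : θ ∈ Theta A) {t : ℝ} (ht : 0 ≤ t) : (fun a => t • θ a) ∈ Theta A := by
  induction hθ using AddSubmonoid.closure_induction with
  | mem θ h =>
    obtain ⟨ι, _, k, c, y, hk, rfl⟩ := h
    refine AddSubmonoid.subset_closure ⟨ι, inferInstance, (t : ℂ) • k, c, y, ?_, ?_⟩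
    · intro a
      rw [LinearMap.smul_apply, smul_eq_mul]
      exact mul_nonneg (by exact_mod_cast ht) (hk a)
    · funext a
      simp only [LinearMap.smul_apply, Finset.smul_sum, Complex.coe_smul, smul_assoc]
  | zero =>
    convert (Theta A).zero_mem using 1
    funext a; simp
  | add x y hx hy h1 h2 =>
    convert (Theta A).add_mem h1 h2 using 1
    funext a; simp

variable {r : ℕ} {Λ : HigherRankGraph r} [Fintype Λ.Obj] [DecidableEq Λ.Obj] [∀ l, Fintype (Λ.Mor l)]
  [∀ l, DecidableEq (Λ.Mor l)] {s : ∀ l : Fin r → ℕ, Λ.Mor l → A}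

theorem theta_functional [Nontrivial A] (hs : CKF Λ s) {N : Type} [Fintype N] (d : N → Fin r → ℤ) (a : N → A)
    (ha : ∀ n, a n ∈ CKF.gr s (d n)) (F : N → (A →L[ℂ] ℂ)) (δ : ℝ) (hδ : 0 < δ) :
    ∃ θ ∈ Theta A, ∀ n, ‖F n (a n) - F n (θ (a n))‖ < δ := by
  classical
  choose g c hg using fun n => jordan (F n)
  obtain ⟨g0, hg0⟩ := posfun_exists_norm (A := A)
  -- the dominating functional
  let L : A →ₗ[ℂ] ℂ := g0.toLinearMap + ∑ n, ∑ i, (g n i).toLinearMap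
  have hLa : ∀ a, L a = g0 a + ∑ n, ∑ i, g n i a := by intro a; simp [L, LinearMap.sum_apply]
  have hLdom : ∀ n i a, 0 ≤ a → g n i a ≤ L a := by
    intro n i a ha
    rw [hLa]
    have h1 : g n i a ≤ ∑ i, g n i a := Finset.single_le_sum (f := fun i => g n i a) (fun j _ => (g n j).map_nonneg ha) (Finset.mem_univ i)
    have h2 : ∑ i, g n i a ≤ ∑ n, ∑ i, g n i a := Finset.single_le_sum (f := fun n => ∑ i, g n i a) (fun j _ => Finset.sum_nonneg fun k _ => (g j k).map_nonneg ha) (Finset.mem_univ n)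
    exact (h1.trans h2).trans (le_add_of_nonneg_left (g0.map_nonneg ha))
  have hLpos : ∀ a, 0 ≤ a → 0 ≤ L a := by
    intro a ha
    rw [hLa]
    exact add_nonneg (g0.map_nonneg ha) (Finset.sum_nonneg fun j _ => Finset.sum_nonneg fun k _ => (g j k).map_nonneg ha)
  have hL1 : 0 < L 1 := by
    rw [hLa]
    exact add_pos_of_pos_of_nonneg hg0 (Finset.sum_nonneg fun j _ => Finset.sum_nonneg fun k _ => (g j k).map_nonneg zero_le_one)
  have hinv : 0 ≤ (L 1)⁻¹ := inv_nonneg.2 hL1.le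
  let f : A →ₚ[ℂ] ℂ := PositiveLinearMap.mk₀ ((L 1)⁻¹ • L) fun x hx => by
    rw [LinearMap.smul_apply, smul_eq_mul]
    exact mul_nonneg hinv (hLpos x hx)
  have hf : ∀ a, f a = (L 1)⁻¹ * L a := fun _ => rfl
  have hf1 : f 1 = 1 := by rw [hf, inv_mul_cancel₀ hL1.ne']
  let g' : N → Fin 4 → (A →ₚ[ℂ] ℂ) := fun n i => PositiveLinearMap.mk₀ ((L 1)⁻¹ • (g n i).toLinearMap) fun x hx => by
    rw [LinearMap.smul_apply, smul_eq_mul]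
    exact mul_nonneg hinv ((g n i).map_nonneg hx)
  have hg' : ∀ n i a, g' n i a = (L 1)⁻¹ * g n i a := fun _ _ _ => rfl
  have hdom : ∀ n i a, g' n i (star a * a) ≤ f (star a * a) := by
    intro n i a
    rw [hg', hf]
    exact mul_le_mul_of_nonneg_left (hLdom n i _ (star_mul_self_nonneg a)) hinv
  choose T hT1 hT2 using fun n i => rn_exists f (g' n i) (hdom n i)
  let ξ : f.GNS := ((f.toPreGNS 1 : f.PreGNS) : f.GNS)
  have hξ : ‖ξ‖ = 1 := by
    have : ‖ξ‖ = ‖f.toPreGNS 1‖ := UniformSpace.Completion.norm_coe _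
    rw [this, PositiveLinearMap.preGNS_norm_def]
    simp [hf1]
  let TT : N → (f.GNS →L[ℂ] f.GNS) := fun n => ∑ i, (L 1 * c n i) • T n i
  have hTT : ∀ i a, Commute (f.gnsStarAlgHom a) (TT i) := by
    intro n a
    refine Commute.sum_right _ _ _ fun i _ => (hT1 n i a).smul_right _
  have hl : ∀ a b : A, f.gnsStarAlgHom a ((f.toPreGNS b : f.PreGNS) : f.GNS) = ((f.toPreGNS (a * b) : f.PreGNS) : f.GNS) := by
    intro a b
    exact PositiveLinearMap.gnsNonUnitalStarAlgHom_apply_coe f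
  have hFn : ∀ n x, ⟪ξ, (f.gnsStarAlgHom x * TT n) ξ⟫_ℂ = F n x := by
    intro n x
    rw [ContinuousLinearMap.mul_apply, ← ContinuousLinearMap.adjoint_inner_left, ← ContinuousLinearMap.star_eq_adjoint, ← map_star, hl]
    rw [ContinuousLinearMap.sum_apply, inner_sum, hg]
    refine Finset.sum_congr rfl fun i _ => ?_
    rw [ContinuousLinearMap.smul_apply, inner_smul_right, hT2, hg']
    simp only [star_mul, star_star, mul_one, star_one, one_mul]
    field_simp [hL1.ne']
  obtain ⟨θ, hθ, h⟩ := theta_main f.gnsStarAlgHom hs ξ hξ (gns_dense f) d a ha TT hTT δ hδ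
  refine ⟨θ, hθ, fun n => ?_⟩
  have := h n
  rw [hFn, hFn] at this
  exact this

theorem theta_norm [Nontrivial A] (hs : CKF Λ s) {N : Type} [Fintype N] (d : N → Fin r → ℤ) (a : N → A)
    (ha : ∀ n, a n ∈ CKF.gr s (d n)) (ε : ℝ) (hε : 0 < ε) :
    ∃ θ ∈ Theta A, ∀ n, ‖θ (a n) - a n‖ < ε := by
  classical
  let K : Set (N → A) := {x | ∃ θ ∈ Theta A, x = fun n => θ (a n)}
  have hK : Convex ℝ K := by
    rintro _ ⟨θ₁, h1, rfl⟩ _ ⟨θ₂, h2, rfl⟩ t u ht hu htu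
    refine ⟨_, (Theta A).add_mem (Theta.smul h1 ht) (Theta.smul h2 hu), ?_⟩
    funext n; simp
  by_cases hmem : a ∈ closure K
  · rw [Metric.mem_closure_iff] at hmem
    obtain ⟨_, ⟨θ, hθ, rfl⟩, hb⟩ := hmem ε hε
    refine ⟨θ, hθ, fun n => ?_⟩
    rw [dist_comm, dist_pi_lt_iff hε] at hb
    rw [← dist_eq_norm]; exact hb n
  exfalso
  obtain ⟨F, u, hF1, hF2⟩ := RCLike.geometric_hahn_banach_closed_point (𝕜 := ℂ) hK.closure isClosed_closure hmem
  let Fn : N → (A →L[ℂ] ℂ) := fun n => F.comp (ContinuousLinearMap.single ℂ (fun _ => A) n)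
  have hsum : ∀ x, F x = ∑ n, Fn n (x n) := by
    intro x
    conv_lhs => rw [← Finset.univ_sum_single x]
    rw [map_sum]
    rfl
  obtain ⟨θ, hθ, h⟩ := theta_functional hs d a ha Fn (((F a).re - u) / (Fintype.card N + 1)) (by
    have : u < (F a).re := hF2
    have : 0 < (F a).re - u := by linarith
    positivity)
  have h1 : (F fun n => θ (a n)).re < u := hF1 _ (subset_closure ⟨θ, hθ, rfl⟩)
  have h2 : u < (F a).re := hF2
  have h3 : ‖F a - F fun n => θ (a n)‖ ≤ Fintype.card N * (((F a).re - u) / (Fintype.card N + 1)) := by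
    rw [hsum, hsum, ← Finset.sum_sub_distrib]
    refine (norm_sum_le _ _).trans ?_
    refine (Finset.sum_le_sum fun n _ => (h n).le).trans ?_
    rw [hsum]
    simp
  have h4 : Fintype.card N * (((F a).re - u) / (Fintype.card N + 1)) ≤ (F a).re - u := by
    rw [mul_div_assoc', div_le_iff₀ (by positivity)]
    nlinarith
  have h5 := (Complex.abs_re_le_norm _).trans (h3.trans h4)
  rw [Complex.sub_re] at h5
  have := le_abs_self ((F a).re - (F fun n => θ (a n)).re)
  linarith
end RNSec
end Part10

section Part11
set_option linter.unusedSectionVars false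
set_option linter.unusedVariables false
set_option linter.unusedSimpArgs false

open scoped ComplexOrder InnerProductSpace ComplexConjugate

/-- complete positivity (second half of `IsUCP`) -/
def CPM {A B : Type*} [Ring A] [StarRing A] [Module ℂ A]
    [Ring B] [Star B] [Module ℂ B] (φ : A →ₗ[ℂ] B) : Prop :=
  ∀ (n : ℕ) (a : Fin n → A) (b : Fin n → B),
    ∃ (m : ℕ) (c : Fin m → B),
      ∑ i, ∑ j, star (b i) * φ (star (a i) * a j) * b j = ∑ t, star (c t) * c t

abbrev Blk {t : ℕ} (d : Fin t → ℕ) : Type := ∀ i, Matrix (Fin (d i)) (Fin (d i)) ℂ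

section MatSec
open Matrix

theorem psd_of_form {n : ℕ} (X : Matrix (Fin n) (Fin n) ℂ) (h : ∀ v, 0 ≤ star v ⬝ᵥ (X *ᵥ v)) : X.PosSemidef := by
  rw [← Matrix.isPositive_toEuclideanLin_iff, LinearMap.isPositive_iff_complex]
  intro x
  have h1 := h x.ofLp
  have : ⟪X.toEuclideanLin x, x⟫_ℂ = conj (star x.ofLp ⬝ᵥ (X *ᵥ x.ofLp)) := by
    rw [← inner_conj_symm]
    congr 1
    rw [EuclideanSpace.inner_eq_star_dotProduct, dotProduct_comm]
    rfl
  rw [this]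
  rw [Complex.nonneg_iff] at h1
  refine ⟨?_, ?_⟩
  · apply Complex.ext <;> simp [← h1.2]
  · simpa using h1.1

open scoped MatrixOrder in
theorem psd_sqrt {n : ℕ} (X : Matrix (Fin n) (Fin n) ℂ) (h : X.PosSemidef) : ∃ B, X = star B * B :=
  CStarAlgebra.nonneg_iff_eq_star_mul_self.mp h.nonneg

theorem blk_sqrt {t : ℕ} {d : Fin t → ℕ} (X : Blk d) (h : ∀ i, (X i).PosSemidef) : ∃ B : Blk d, X = star B * B := by
  choose B hB using fun i => psd_sqrt (X i) (h i)
  exact ⟨B, funext hB⟩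

theorem cpm_of_form {A : Type*} [Ring A] [StarRing A] [Module ℂ A] {t : ℕ} {d : Fin t → ℕ} (ψ : A →ₗ[ℂ] Blk d)
    (h : ∀ (s : Fin t) (n : ℕ) (a : Fin n → A) (w : Fin n → Fin (d s) → ℂ),
      0 ≤ ∑ i, ∑ j, star (w i) ⬝ᵥ (ψ (star (a i) * a j) s *ᵥ w j)) : CPM ψ := by
  intro n a b
  obtain ⟨c, hc⟩ := blk_sqrt (∑ i, ∑ j, star (b i) * ψ (star (a i) * a j) * b j) (by
    intro s
    refine psd_of_form _ fun v => ?_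
    convert h s n a (fun i => b i s *ᵥ v) using 1
    simp only [Finset.sum_apply, Pi.mul_apply, Pi.star_apply, Matrix.sum_mulVec, dotProduct_sum]
    refine Finset.sum_congr rfl fun i _ => Finset.sum_congr rfl fun j _ => ?_
    rw [← Matrix.mulVec_mulVec, ← Matrix.mulVec_mulVec, Matrix.dotProduct_mulVec _ (star (b i s)), Matrix.star_eq_conjTranspose,
      Matrix.vecMul_conjTranspose, star_star])
  refine ⟨1, fun _ => c, ?_⟩
  rw [hc]; simp

theorem form_of_cpm_psd {A : Type*} [Ring A] [StarRing A] [Module ℂ A] {t : ℕ} {d : Fin t → ℕ} {ψ : A →ₗ[ℂ] Blk d} (h : CPM ψ)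
    (s : Fin t) : (ψ 1 s).PosSemidef := by
  obtain ⟨m, c, hc⟩ := h 1 (fun _ => 1) (fun _ => 1)
  simp only [Finset.univ_unique, Finset.sum_singleton, star_one, one_mul, mul_one] at hc
  rw [hc, Finset.sum_apply]
  exact Matrix.posSemidef_sum _ fun i _ => Matrix.posSemidef_conjTranspose_mul_self _

end MatSec

section CPMSec
variable {A B C : Type*} [Ring A] [StarRing A] [Algebra ℂ A] [StarModule ℂ A] [Ring B] [StarRing B] [Algebra ℂ B] [StarModule ℂ B]

theorem CPM.of_fintype {φ : A →ₗ[ℂ] B} (h : ∀ (n : ℕ) (a : Fin n → A) (b : Fin n → B),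
    ∃ (I : Type) (_ : Fintype I) (c : I → B),
      ∑ i, ∑ j, star (b i) * φ (star (a i) * a j) * b j = ∑ t, star (c t) * c t) : CPM φ := by
  intro n a b
  obtain ⟨I, _, c, hc⟩ := h n a b
  refine ⟨Fintype.card I, fun i => c ((Fintype.equivFin I).symm i), ?_⟩
  rw [hc]
  exact (Equiv.sum_comp (Fintype.equivFin I).symm fun i => star (c i) * c i).symm

theorem CPM.add {φ φ' : A →ₗ[ℂ] B} (h : CPM φ) (h' : CPM φ') : CPM (φ + φ') := by
  apply CPM.of_fintype
  intro n a b
  obtain ⟨m, c, hc⟩ := h n a b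
  obtain ⟨m', c', hc'⟩ := h' n a b
  refine ⟨Fin m ⊕ Fin m', inferInstance, Sum.elim c c', ?_⟩
  simp only [LinearMap.add_apply, mul_add, add_mul, Finset.sum_add_distrib, Fintype.sum_sum_type, Sum.elim_inl, Sum.elim_inr, hc, hc']

theorem CPM.smul {φ : A →ₗ[ℂ] B} (h : CPM φ) {t : ℝ} (ht : 0 ≤ t) : CPM ((t : ℂ) • φ) := by
  intro n a b
  obtain ⟨m, c, hc⟩ := h n a b
  refine ⟨m, fun i => ((Real.sqrt t : ℝ) : ℂ) • c i, ?_⟩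
  simp only [LinearMap.smul_apply, mul_smul_comm, smul_mul_assoc, ← Finset.smul_sum, hc, star_smul, smul_smul]
  congr 1
  rw [Complex.star_def, Complex.conj_ofReal, ← Complex.ofReal_mul, Real.mul_self_sqrt ht]

/-- conjugating the output -/
def conjL (x : B) : B →ₗ[ℂ] B where
  toFun y := star x * y * x
  map_add' a b := by simp [mul_add, add_mul]
  map_smul' c a := by simp

theorem conjL_apply (x y : B) : conjL x y = star x * y * x := rfl

theorem CPM.conj_out {φ : A →ₗ[ℂ] B} (h : CPM φ) (x : B) : CPM ((conjL x).comp φ) := by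
  intro n a b
  obtain ⟨m, c, hc⟩ := h n a (fun i => x * b i)
  refine ⟨m, c, ?_⟩
  rw [← hc]
  simp only [LinearMap.comp_apply, conjL_apply, star_mul, mul_assoc]

theorem CPM.conj_in {φ : A →ₗ[ℂ] B} (h : CPM φ) (x : A) : CPM (φ.comp (conjL x)) := by
  intro n a b
  obtain ⟨m, c, hc⟩ := h n (fun i => a i * x) b
  refine ⟨m, c, ?_⟩
  rw [← hc]
  simp only [LinearMap.comp_apply, conjL_apply, star_mul, mul_assoc]

/-- maps from blocks -/
noncomputable def blkOut {t : ℕ} {d : Fin t → ℕ} (y : ∀ s, Fin (d s) → B) : Blk d →ₗ[ℂ] B where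
  toFun Y := ∑ s, ∑ p, ∑ q, Y s p q • (star (y s p) * y s q)
  map_add' a b := by simp only [Pi.add_apply, Matrix.add_apply, add_smul, Finset.sum_add_distrib]
  map_smul' c a := by simp only [Pi.smul_apply, Matrix.smul_apply, smul_assoc, Finset.smul_sum, RingHom.id_apply]

theorem cpm_blkOut {t : ℕ} {d : Fin t → ℕ} (y : ∀ s, Fin (d s) → B) : CPM (blkOut y) := by
  apply CPM.of_fintype
  intro n Y b
  refine ⟨Σ s, Fin (d s), inferInstance, fun x => ∑ j, ∑ q, Y j x.1 x.2 q • (y x.1 q * b j), ?_⟩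
  rw [Fintype.sum_sigma]
  have h1 : ∀ i j, star (b i) * blkOut y (star (Y i) * Y j) * b j =
      ∑ s, ∑ m, star (∑ p, Y i s m p • (y s p * b i)) * (∑ q, Y j s m q • (y s q * b j)) := by
    intro i j
    simp only [blkOut, LinearMap.coe_mk, AddHom.coe_mk, Finset.mul_sum, Finset.sum_mul, star_sum, star_smul, star_mul,
      Pi.mul_apply, Pi.star_apply, Matrix.mul_apply, Matrix.star_apply, Finset.sum_smul, smul_mul_assoc, mul_smul_comm, smul_smul]
    refine Finset.sum_congr rfl fun s _ => ?_
    simp only [Finset.smul_sum]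
    rw [Finset.sum_comm]
    refine (Finset.sum_congr rfl fun q _ => Finset.sum_comm).trans ?_
    rw [Finset.sum_comm]
    refine Finset.sum_congr rfl fun m _ => Finset.sum_congr rfl fun q _ => Finset.sum_congr rfl fun p _ => ?_
    rw [smul_smul, mul_comm (star (Y i s m p))]
    simp only [mul_assoc]
  simp only [h1]
  simp only [star_sum, Finset.sum_mul_sum]
  refine (Finset.sum_congr rfl fun i _ => Finset.sum_comm).trans ?_
  rw [Finset.sum_comm]
  refine Finset.sum_congr rfl fun s _ => ?_
  refine (Finset.sum_congr rfl fun i _ => Finset.sum_comm).trans ?_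
  rw [Finset.sum_comm]

end CPMSec
end Part11

section Part12
set_option linter.unusedSectionVars false
set_option linter.unusedVariables false
set_option linter.unusedSimpArgs false

open scoped ComplexOrder InnerProductSpace ComplexConjugate

section CPM2
variable {A B : Type*} [Ring A] [StarRing A] [Algebra ℂ A] [StarModule ℂ A] [Ring B] [StarRing B] [Algebra ℂ B] [StarModule ℂ B]

theorem CPM.sos {φ : A →ₗ[ℂ] B} (h : CPM φ) (a : A) : ∃ (m : ℕ) (c : Fin m → B), φ (star a * a) = ∑ t, star (c t) * c t := by
  obtain ⟨m, c, hc⟩ := h 1 (fun _ => a) (fun _ => 1)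
  simp only [Finset.univ_unique, Finset.sum_singleton, star_one, one_mul, mul_one] at hc
  exact ⟨m, c, hc⟩

theorem CPM.sa {φ : A →ₗ[ℂ] B} (h : CPM φ) (a : A) : star (φ (star a * a)) = φ (star a * a) := by
  obtain ⟨m, c, hc⟩ := h.sos a
  rw [hc]
  simp [star_sum]

theorem CPM.map_star {φ : A →ₗ[ℂ] B} (h : CPM φ) (a : A) : φ (star a) = star (φ a) := by
  have h0 := h.sa a
  have h1 := h.sa 1
  have h2 := h.sa (a + 1)
  have h3 := h.sa (a + Complex.I • 1)
  simp only [star_add, star_one, add_mul, mul_add, mul_one, one_mul, map_add, star_smul, smul_mul_assoc, mul_smul_comm, map_smul, Complex.star_def, Complex.conj_I, neg_smul, star_neg, map_neg, smul_neg, neg_neg, neg_mul, mul_neg, smul_smul, Complex.I_mul_I, one_smul] at h0 h1 h2 h3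
  rw [h0, h1] at h2 h3
  simp only [smul_add, smul_neg, smul_smul, Complex.I_mul_I, neg_smul, one_smul, neg_neg] at h3
  have e2 : star (φ (star a)) + star (φ a) = φ (star a) + φ a := by
    have := congrArg (fun z => z - φ (star a * a) - φ 1) h2
    calc _ = _ := by abel
      _ = _ := this
      _ = _ := by abel
  have e3 : -(Complex.I • star (φ (star a))) + Complex.I • star (φ a) = Complex.I • φ (star a) - Complex.I • φ a := by
    have := congrArg (fun z => z - φ (star a * a) - φ 1) h3
    calc _ = _ := by abel
      _ = _ := this
      _ = _ := by abel
  have e4 : -star (φ (star a)) + star (φ a) = φ (star a) - φ a := by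
    have := congrArg (fun z => (-Complex.I) • z) e3
    simpa [smul_add, smul_sub, smul_smul] using this
  have e5 : (2 : ℂ) • star (φ a) = (2 : ℂ) • φ (star a) := by
    rw [two_smul, two_smul]
    calc _ = (star (φ (star a)) + star (φ a)) + (-star (φ (star a)) + star (φ a)) := by abel
      _ = _ := by rw [e2, e4]; abel
  have := congrArg (fun z => (2 : ℂ)⁻¹ • z) e5
  simpa [smul_smul] using this.symm

theorem CPM.ks {φ : A →ₗ[ℂ] B} (h : CPM φ) (h1 : φ 1 = 1) (a : A) :
    ∃ (m : ℕ) (c : Fin m → B), φ (star a * a) = star (φ a) * φ a + ∑ t, star (c t) * c t := by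
  obtain ⟨m, c, hc⟩ := h 2 ![a, 1] ![1, -φ a]
  refine ⟨m, c, ?_⟩
  rw [← hc]
  simp [Fin.sum_univ_two, h1, h.map_star]

end CPM2

section Contr
variable {A D : Type*} [CStarAlgebra A] [PartialOrder A] [StarOrderedRing A] [CStarAlgebra D] [PartialOrder D] [StarOrderedRing D]
  {C : Type*} [Ring C] [StarRing C] [Algebra ℂ C] [StarModule ℂ C]

theorem sos_nonneg {m : ℕ} (c : Fin m → D) : 0 ≤ ∑ t, star (c t) * c t :=
  Finset.sum_nonneg fun t _ => star_mul_self_nonneg _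

theorem CPM.nonneg {φ : C →ₗ[ℂ] D} (h : CPM φ) (c : C) : 0 ≤ φ (star c * c) := by
  obtain ⟨m, d, hd⟩ := h.sos c
  rw [hd]; exact sos_nonneg d

theorem CPM.nonneg_sum {φ : C →ₗ[ℂ] D} (h : CPM φ) {m : ℕ} (c : Fin m → C) : 0 ≤ φ (∑ t, star (c t) * c t) := by
  rw [map_sum]
  exact Finset.sum_nonneg fun t _ => h.nonneg _

theorem ucp_contr {ψ : A →ₗ[ℂ] C} {φ : C →ₗ[ℂ] D} (hψ : CPM ψ) (hψ1 : ψ 1 = 1) (hφ : CPM φ) (hφ1 : φ 1 = 1) (a : A) :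
    ‖φ (ψ a)‖ ≤ ‖a‖ := by
  rcases subsingleton_or_nontrivial D with hD | hD
  · rw [Subsingleton.elim (φ (ψ a)) 0, norm_zero]; exact norm_nonneg _
  obtain ⟨m1, c1, h1⟩ := hφ.ks hφ1 (ψ a)
  obtain ⟨m2, c2, h2⟩ := hψ.ks hψ1 a
  have h3 : 0 ≤ algebraMap ℝ A (‖a‖ ^ 2) - star a * a := sub_nonneg.2 CStarAlgebra.star_mul_le_algebraMap_norm_sq
  obtain ⟨ρ, hρ⟩ := CStarAlgebra.nonneg_iff_eq_star_mul_self.1 h3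
  obtain ⟨m3, c3, h4⟩ := hψ.sos ρ
  have e1 : star a * a = ((‖a‖ ^ 2 : ℝ) : ℂ) • (1 : A) - star ρ * ρ := by
    rw [← hρ, Algebra.algebraMap_eq_smul_one, Complex.coe_smul]; abel
  have e2 : star (φ (ψ a)) * φ (ψ a) ≤ ((‖a‖ ^ 2 : ℝ) : ℂ) • (1 : D) := by
    calc star (φ (ψ a)) * φ (ψ a) ≤ φ (star (ψ a) * ψ a) := by
          rw [h1]; exact le_add_of_nonneg_right (sos_nonneg c1)
      _ ≤ φ (ψ (star a * a)) := by
          rw [h2, map_add]; exact le_add_of_nonneg_right (hφ.nonneg_sum c2)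
      _ ≤ _ := by
          rw [e1, map_sub, map_smul, hψ1, map_sub, map_smul, hφ1, h4]
          exact sub_le_self _ (hφ.nonneg_sum c3)
  have e3 := CStarAlgebra.norm_le_norm_of_nonneg_of_le (star_mul_self_nonneg _) e2
  rw [CStarRing.norm_star_mul_self, norm_smul, norm_one, mul_one, Complex.norm_real, Real.norm_of_nonneg (by positivity)] at e3
  exact abs_le_of_sq_le_sq' (by nlinarith) (norm_nonneg _) |>.2

end Contr

section BlkIn
open Matrix
variable {A : Type*} [Ring A] [StarRing A] [Algebra ℂ A] [StarModule ℂ A]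

def blkIn {t : ℕ} {d : Fin t → ℕ} (k : Fin t → (A →ₗ[ℂ] ℂ)) (c : ∀ s, Fin (d s) → A) : A →ₗ[ℂ] Blk d where
  toFun a := fun s => Matrix.of fun p q => k s (star (c s p) * a * c s q)
  map_add' a b := by funext s; ext p q; simp [mul_add, add_mul]
  map_smul' z a := by funext s; ext p q; simp

theorem cpm_blkIn {t : ℕ} {d : Fin t → ℕ} (k : Fin t → (A →ₗ[ℂ] ℂ)) (hk : ∀ s a, 0 ≤ k s (star a * a)) (c : ∀ s, Fin (d s) → A) :
    CPM (blkIn k c) := by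
  refine cpm_of_form _ fun s n a w => ?_
  convert hk s (∑ j, ∑ q, w j q • (a j * c s q)) using 1
  simp only [star_sum, Finset.sum_mul_sum, map_sum]
  refine Finset.sum_congr rfl fun i _ => Finset.sum_congr rfl fun j _ => ?_
  simp only [blkIn, LinearMap.coe_mk, AddHom.coe_mk, dotProduct, mulVec, Matrix.of_apply, Pi.star_apply, Finset.mul_sum]
  refine Finset.sum_congr rfl fun p _ => Finset.sum_congr rfl fun q _ => ?_
  simp only [star_smul, star_mul, smul_mul_assoc, mul_smul_comm, map_smul, smul_eq_mul, mul_assoc]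
  ring_nf

def blkSc {t : ℕ} (d : Fin t → ℕ) (k : A →ₗ[ℂ] ℂ) : A →ₗ[ℂ] Blk d where
  toFun a := k a • 1
  map_add' a b := by simp [add_smul]
  map_smul' z a := by simp [mul_smul]

theorem cpm_blkSc {t : ℕ} (d : Fin t → ℕ) (k : A →ₗ[ℂ] ℂ) (hk : ∀ a, 0 ≤ k (star a * a)) : CPM (blkSc d k) := by
  refine cpm_of_form _ fun s n a w => ?_
  have : 0 ≤ ∑ m, k (star (∑ j, w j m • a j) * (∑ j, w j m • a j)) := Finset.sum_nonneg fun m _ => hk _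
  convert this using 1
  simp only [star_sum, Finset.sum_mul_sum, map_sum]
  conv_rhs => rw [Finset.sum_comm]
  refine Finset.sum_congr rfl fun i _ => ?_
  conv_rhs => rw [Finset.sum_comm]
  refine Finset.sum_congr rfl fun j _ => ?_
  simp only [blkSc, LinearMap.coe_mk, AddHom.coe_mk, Pi.smul_apply, Pi.one_apply, smul_mulVec, one_mulVec, dotProduct, Pi.star_apply, smul_eq_mul]
  refine Finset.sum_congr rfl fun m _ => ?_
  simp only [star_smul, smul_mul_assoc, mul_smul_comm, map_smul, smul_eq_mul]
  ring

theorem Theta.blocks {θ : A → A} (hθ : θ ∈ Theta A) : ∃ (t : ℕ) (d : Fin t → ℕ) (ψ : A →ₗ[ℂ] Blk d) (φ : Blk d →ₗ[ℂ] A),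
    CPM ψ ∧ CPM φ ∧ ∀ a, θ a = φ (ψ a) := by
  obtain ⟨L, hL, rfl⟩ := AddSubmonoid.exists_list_of_mem_closure hθ
  have hL' : ∀ i : Fin L.length, L.get i ∈ ThetaGen A := fun i => hL _ (List.get_mem _ _)
  choose ι hι k c y hk hθ' using hL'
  let d : Fin L.length → ℕ := fun s => Fintype.card (ι s)
  let e : ∀ s, Fin (d s) ≃ ι s := fun s => (Fintype.equivFin (ι s)).symm
  refine ⟨L.length, d, blkIn k (fun s p => c s (e s p)), blkOut (fun s p => y s (e s p)), cpm_blkIn _ hk _, cpm_blkOut _, fun a => ?_⟩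
  have h1 : L.sum a = ∑ s : Fin L.length, L.get s a := by
    rw [← Finset.sum_apply]
    congr 1
    conv_lhs => rw [← List.ofFn_get L, List.sum_ofFn]
  rw [h1]
  simp only [blkOut, blkIn, LinearMap.coe_mk, AddHom.coe_mk, Matrix.of_apply]
  refine Finset.sum_congr rfl fun s _ => ?_
  rw [hθ' s]
  beta_reduce
  rw [← Equiv.sum_comp (e s)]
  refine Finset.sum_congr rfl fun p _ => ?_
  rw [← Equiv.sum_comp (e s)]

end BlkIn
end Part12

section Part13
set_option linter.unusedSectionVars false
set_option linter.unusedVariables false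
set_option linter.unusedSimpArgs false

open scoped ComplexOrder InnerProductSpace ComplexConjugate

section EvalSec
variable {B : Type*} [Ring B] [StarRing B] [Algebra ℂ B] [StarModule ℂ B]

def blkEv {t : ℕ} {d : Fin t → ℕ} (s : Fin t) (x : Fin (d s)) (R : B) : Blk d →ₗ[ℂ] B where
  toFun Y := Y s x x • (star R * R)
  map_add' a b := by simp [add_smul]
  map_smul' z a := by simp [mul_smul]

theorem blkEv_apply {t : ℕ} {d : Fin t → ℕ} (s : Fin t) (x : Fin (d s)) (R : B) (Y : Blk d) :
    blkEv s x R Y = Y s x x • (star R * R) := rfl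

theorem cpm_blkEv {t : ℕ} {d : Fin t → ℕ} (s : Fin t) (x : Fin (d s)) (R : B) : CPM (blkEv (d := d) s x R) := by
  apply CPM.of_fintype
  intro n Y b
  refine ⟨Fin (d s), inferInstance, fun m => ∑ j, Y j s m x • (R * b j), ?_⟩
  simp only [star_sum, Finset.sum_mul_sum]
  conv_rhs => rw [Finset.sum_comm]
  refine Finset.sum_congr rfl fun i _ => ?_
  conv_rhs => rw [Finset.sum_comm]
  refine Finset.sum_congr rfl fun j _ => ?_
  simp only [blkEv_apply, Pi.mul_apply, Pi.star_apply, Matrix.mul_apply, Matrix.star_apply, Finset.sum_smul, Finset.mul_sum,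
    Finset.sum_mul, star_smul, star_mul, smul_mul_assoc, mul_smul_comm, smul_smul]
  refine Finset.sum_congr rfl fun m _ => ?_
  rw [mul_comm (star (Y i s m x))]
  simp only [mul_assoc]
end EvalSec

section Norm
variable {A : Type*} [CStarAlgebra A] [PartialOrder A] [StarOrderedRing A] [Nontrivial A]

theorem state_exists : ∃ k : A →ₗ[ℂ] ℂ, (∀ a, 0 ≤ k (star a * a)) ∧ k 1 = 1 := by
  obtain ⟨g, hg⟩ := posfun_exists_norm (A := A)
  refine ⟨(g 1)⁻¹ • g.toLinearMap, fun a => ?_, ?_⟩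
  · rw [LinearMap.smul_apply, smul_eq_mul]
    exact mul_nonneg (inv_nonneg.2 hg.le) (g.map_nonneg (star_mul_self_nonneg a))
  · rw [LinearMap.smul_apply, smul_eq_mul]
    exact inv_mul_cancel₀ hg.ne'

theorem normalise {t : ℕ} {d : Fin t → ℕ} (ψ : A →ₗ[ℂ] Blk d) (φ : Blk d →ₗ[ℂ] A) (hψ : CPM ψ) (hφ : CPM φ)
    {N : Type} [Fintype N] (a : N → A) (M η : ℝ) (hM : ∀ n, ‖a n‖ ≤ M) (hη : 0 < η) (hη1 : η < 1)
    (h : ∀ n, ‖φ (ψ (a n)) - a n‖ < η) (h1 : ‖φ (ψ 1) - 1‖ < η) :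
    ∃ (ψ' : A →ₗ[ℂ] Blk d) (φ' : Blk d →ₗ[ℂ] A), (ψ' 1 = 1 ∧ CPM ψ') ∧ (φ' 1 = 1 ∧ CPM φ') ∧
      ∀ n, ‖φ' (ψ' (a n)) - a n‖ ≤ η * (1 + 3 * M) := by
  obtain ⟨k, hk, hk1⟩ := state_exists (A := A)
  -- perturbation
  have hev : ∀ x : A, ‖φ (ψ x) - x‖ < η → ∀ᶠ δ : ℝ in nhdsWithin 0 (Set.Ioi 0), ‖φ (ψ x) + (δ : ℂ) • k x • φ 1 - x‖ < η := by
    intro x hx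
    have hc : Continuous fun δ : ℝ => ‖φ (ψ x) + (δ : ℂ) • k x • φ 1 - x‖ := by fun_prop
    have := hc.tendsto 0
    simp only [Complex.ofReal_zero, zero_smul, add_zero] at this
    exact (this.mono_left nhdsWithin_le_nhds).eventually (gt_mem_nhds hx)
  obtain ⟨δ, ⟨hδn, hδ1⟩, hδ0⟩ := (((Filter.eventually_all.2 fun n => hev (a n) (h n)).and (hev 1 h1)).and
    self_mem_nhdsWithin).exists
  have hδ : 0 < δ := hδ0
  let ψ1 : A →ₗ[ℂ] Blk d := ψ + (δ : ℂ) • blkSc d k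
  have hψ1 : CPM ψ1 := hψ.add ((cpm_blkSc d k hk).smul hδ.le)
  have hφψ1 : ∀ x, φ (ψ1 x) = φ (ψ x) + (δ : ℂ) • k x • φ 1 := by
    intro x
    simp [ψ1, blkSc]
  -- ψ1 1 is invertible
  have hPD : ∀ s, (ψ1 1 s).PosDef := by
    intro s
    have e : ψ1 1 s = ψ 1 s + (δ : ℂ) • 1 := by simp [ψ1, blkSc, hk1]
    rw [e]
    refine Matrix.PosDef.posSemidef_add (form_of_cpm_psd hψ s) (Matrix.PosDef.smul Matrix.PosDef.one ?_)
    exact_mod_cast hδ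
  obtain ⟨B, hB⟩ := blk_sqrt (ψ1 1) fun s => (hPD s).posSemidef
  have hBu : ∀ s, IsUnit (B s).det := by
    intro s
    have h1 : IsUnit (ψ1 1 s).det := (Matrix.isUnit_iff_isUnit_det _).1 (hPD s).isUnit
    have h2 : ψ1 1 s = star (B s) * B s := congrFun hB s
    rw [h2, Matrix.det_mul] at h1
    exact isUnit_of_mul_isUnit_right h1
  let Bi : Blk d := fun s => (B s)⁻¹
  have hBi1 : B * Bi = 1 := funext fun s => Matrix.mul_nonsing_inv _ (hBu s)
  have hBi2 : Bi * B = 1 := funext fun s => Matrix.nonsing_inv_mul _ (hBu s)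
  let ψ2 : A →ₗ[ℂ] Blk d := (conjL Bi).comp ψ1
  have hψ2 : CPM ψ2 := hψ1.conj_out Bi
  have hψ21 : ψ2 1 = 1 := by
    change star Bi * ψ1 1 * Bi = 1
    rw [hB]
    calc star Bi * (star B * B) * Bi = star (B * Bi) * (B * Bi) := by rw [star_mul]; simp only [mul_assoc]
      _ = 1 := by rw [hBi1]; simp
  let φ1 : Blk d →ₗ[ℂ] A := φ.comp (conjL B)
  have hφ1 : CPM φ1 := hφ.conj_in B
  have hφψ2 : ∀ x, φ1 (ψ2 x) = φ (ψ1 x) := by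
    intro x
    change φ (star B * (star Bi * ψ1 x * Bi) * B) = _
    congr 1
    calc _ = star (Bi * B) * ψ1 x * (Bi * B) := by rw [star_mul]; simp only [mul_assoc]
      _ = _ := by rw [hBi2]; simp
  have hQ : ‖φ1 1 - 1‖ < η := by
    rw [← hψ21, hφψ2, hφψ1]
    exact hδ1
  -- nonempty
  have hne : ∃ s : Fin t, 0 < d s := by
    by_contra hcon
    push Not at hcon
    have : (1 : Blk d) = 0 := by
      funext s
      have := Nat.le_zero.1 (hcon s)
      ext p
      exact absurd p.2 (by omega)
    rw [this, map_zero, zero_sub, norm_neg, norm_one] at hQ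
    linarith
  obtain ⟨s0, hs0⟩ := hne
  let x0 : Fin (d s0) := ⟨0, hs0⟩
  let τ : ℝ := 1 / (1 + η)
  have hτ0 : 0 < τ := by positivity
  have hτ1 : τ ≤ 1 := by rw [div_le_one (by positivity)]; linarith
  have hτη : τ * (1 + η) = 1 := by simp only [τ]; field_simp
  have hsaQ : IsSelfAdjoint (φ1 1 - 1) := by
    have := hφ1.map_star 1
    rw [star_one] at this
    change star _ = _
    rw [star_sub, ← this, star_one]
  have hQle : 0 ≤ 1 - (τ : ℂ) • φ1 1 := by
    have h1 := hsaQ.le_algebraMap_norm_self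
    have h2 : φ1 1 ≤ (1 + η) • (1 : A) := by
      have h3 : algebraMap ℝ A ‖φ1 1 - 1‖ ≤ algebraMap ℝ A η := algebraMap_mono _ hQ.le
      have := h1.trans h3
      rw [sub_le_iff_le_add, Algebra.algebraMap_eq_smul_one] at this
      rw [add_smul, one_smul, add_comm]
      exact this
    have h4 := smul_le_smul_of_nonneg_left h2 hτ0.le
    rw [smul_smul, hτη, one_smul] at h4
    rw [Complex.coe_smul]
    exact sub_nonneg.2 h4
  obtain ⟨R, hR⟩ := CStarAlgebra.nonneg_iff_eq_star_mul_self.1 hQle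
  let φ2 : Blk d →ₗ[ℂ] A := (τ : ℂ) • φ1 + blkEv s0 x0 R
  refine ⟨ψ2, φ2, ⟨hψ21, hψ2⟩, ⟨?_, (hφ1.smul hτ0.le).add (cpm_blkEv _ _ _)⟩, fun n => ?_⟩
  · simp only [φ2, LinearMap.add_apply, LinearMap.smul_apply, blkEv_apply, ← hR]
    simp
  · have hσ : ‖ψ2 (a n) s0 x0 x0‖ ≤ ‖a n‖ := by
      have := ucp_contr (D := ℂ) hψ2 hψ21 (cpm_blkEv (B := ℂ) s0 x0 1) (by simp [blkEv_apply]) (a n)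
      simpa [blkEv_apply] using this
    have e : φ2 (ψ2 (a n)) - a n = (τ : ℂ) • (φ (ψ1 (a n)) - a n) - ((1 - τ : ℝ) : ℂ) • a n
        + ψ2 (a n) s0 x0 x0 • (1 - (τ : ℂ) • φ1 1) := by
      simp only [φ2, LinearMap.add_apply, LinearMap.smul_apply, blkEv_apply, ← hR, hφψ2, smul_sub, Complex.ofReal_sub, sub_smul,
        Complex.ofReal_one, one_smul]
      abel
    have hRn : ‖1 - (τ : ℂ) • φ1 1‖ ≤ 2 * η := by
      have : 1 - (τ : ℂ) • φ1 1 = ((1 - τ : ℝ) : ℂ) • (1 : A) - (τ : ℂ) • (φ1 1 - 1) := by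
        simp only [Complex.ofReal_sub, sub_smul, smul_sub, Complex.ofReal_one, one_smul]; abel
      rw [this]
      refine (norm_sub_le _ _).trans ?_
      rw [norm_smul, norm_smul, Complex.norm_real, Complex.norm_real, Real.norm_of_nonneg (by linarith), Real.norm_of_nonneg hτ0.le, norm_one]
      nlinarith [norm_nonneg (φ1 1 - 1)]
    rw [e]
    refine (norm_add_le _ _).trans ((add_le_add_left (norm_sub_le _ _) _).trans ?_)
    rw [norm_smul, norm_smul, norm_smul, Complex.norm_real, Complex.norm_real, Real.norm_of_nonneg hτ0.le, Real.norm_of_nonneg (sub_nonneg.2 hτ1)]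
    have h5 : ‖φ (ψ1 (a n)) - a n‖ < η := by rw [hφψ1]; exact hδn n
    have hMn := hM n
    have hM0 : 0 ≤ M := (norm_nonneg _).trans hMn
    have t1 : τ * ‖φ (ψ1 (a n)) - a n‖ ≤ 1 * η := mul_le_mul hτ1 h5.le (norm_nonneg _) zero_le_one
    have t2 : (1 - τ) * ‖a n‖ ≤ η * M := mul_le_mul (by nlinarith) hMn (norm_nonneg _) hη.le
    have t3 : ‖ψ2 (a n) s0 x0 x0‖ * ‖1 - (τ : ℂ) • φ1 1‖ ≤ M * (2 * η) := mul_le_mul (hσ.trans hMn) hRn (norm_nonneg _) hM0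
    linarith

variable {r : ℕ} {Λ : HigherRankGraph r} [Fintype Λ.Obj] [DecidableEq Λ.Obj] [∀ l, Fintype (Λ.Mor l)]
  [∀ l, DecidableEq (Λ.Mor l)] {s : ∀ l : Fin r → ℕ, Λ.Mor l → A}

theorem nuclear_fin (hs : CKF Λ s) {N : Type} [Fintype N] (dg : N → Fin r → ℤ) (a : N → A)
    (ha : ∀ n, a n ∈ CKF.gr s (dg n)) (ε : ℝ) (hε : 0 < ε) :
    ∃ (t : ℕ) (d : Fin t → ℕ) (ψ : A →ₗ[ℂ] Blk d) (φ : Blk d →ₗ[ℂ] A), (ψ 1 = 1 ∧ CPM ψ) ∧ (φ 1 = 1 ∧ CPM φ) ∧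
      ∀ n, ‖φ (ψ (a n)) - a n‖ < ε := by
  let M : ℝ := ∑ n, ‖a n‖
  have hM : ∀ n, ‖a n‖ ≤ M := fun n => Finset.single_le_sum (f := fun n => ‖a n‖) (fun _ _ => norm_nonneg _) (Finset.mem_univ n)
  have hM0 : 0 ≤ M := Finset.sum_nonneg fun _ _ => norm_nonneg _
  obtain ⟨η, hη0, hη1, hη2⟩ : ∃ η : ℝ, 0 < η ∧ η < 1 ∧ η * (1 + 3 * M) < ε := by
    refine ⟨min (1 / 2) (ε / (2 * (1 + 3 * M))), by positivity, ?_, ?_⟩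
    · exact (min_le_left _ _).trans_lt (by norm_num)
    · calc _ ≤ ε / (2 * (1 + 3 * M)) * (1 + 3 * M) := by gcongr; exact min_le_right _ _
        _ = ε / 2 := by field_simp
        _ < ε := by linarith
  obtain ⟨θ, hθ, h⟩ := theta_norm hs (N := Option N) (fun o => o.elim 0 dg) (fun o => o.elim 1 a) (by
    rintro (_ | n)
    · exact hs.one_mem
    · exact ha n) η hη0
  obtain ⟨t, d, ψ, φ, hψ, hφ, hφψ⟩ := Theta.blocks hθ
  obtain ⟨ψ', φ', h1, h2, h3⟩ := normalise ψ φ hψ hφ a M η hM hη0 hη1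
    (fun n => by rw [← hφψ]; exact h (some n)) (by rw [← hφψ]; exact h none)
  exact ⟨t, d, ψ', φ', h1, h2, fun n => (h3 n).trans_lt hη2⟩
end Norm
end Part13

section Part14
set_option linter.unusedSectionVars false
set_option linter.unusedVariables false
set_option linter.unusedSimpArgs false

open scoped ComplexOrder InnerProductSpace ComplexConjugate

namespace CKF
section Alg
variable {r : ℕ} {Λ : HigherRankGraph r} [Fintype Λ.Obj] [DecidableEq Λ.Obj] [∀ l, Fintype (Λ.Mor l)]
  [∀ l, DecidableEq (Λ.Mor l)] {A : Type*} [Ring A] [StarRing A] [Algebra ℂ A] [StarModule ℂ A]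
  {s : ∀ l : Fin r → ℕ, Λ.Mor l → A}

theorem sum_comp (hs : CKF Λ s) {E : Type*} [AddCommMonoid E] (g : A → E) (h0 : g 0 = 0) (k q : Fin r → ℕ) :
    ∑ w : Λ.Mor (k + q), g (s _ w) = ∑ β : Λ.Mor k, ∑ w : Λ.Mor q, g (s k β * s q w) := by
  classical
  rw [← Finset.sum_product', ← Finset.sum_filter_add_sum_filter_not (Finset.univ ×ˢ Finset.univ) (fun x : Λ.Mor k × Λ.Mor q => Λ.tgt x.1 = Λ.src x.2)]
  rw [Finset.sum_eq_zero (s := Finset.filter (fun x : Λ.Mor k × Λ.Mor q => ¬ Λ.tgt x.1 = Λ.src x.2) _), add_zero]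
  · symm
    refine Finset.sum_bij (fun x hx => Λ.comp x.1 x.2 (Finset.mem_filter.1 hx).2) ?_ ?_ ?_ ?_
    · intros; exact Finset.mem_univ _
    · rintro ⟨u, v⟩ h1 ⟨u', v'⟩ h2 h
      obtain ⟨x, hx, hu⟩ := Λ.factor k q (Λ.comp u v (Finset.mem_filter.1 h1).2)
      have e1 := hu ⟨u, v, (Finset.mem_filter.1 h1).2⟩ rfl
      have e2 := hu ⟨u', v', (Finset.mem_filter.1 h2).2⟩ h.symm
      have e := e1.trans e2.symm
      simp only [PSigma.mk.injEq] at e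
      obtain ⟨rfl, e⟩ := e
      have : v = v' := by
        have := eq_of_heq e
        simp only [PSigma.mk.injEq] at this
        exact this.1
      rw [this]
    · intro w _
      obtain ⟨⟨u, v, h⟩, huv, -⟩ := Λ.factor k q w
      exact ⟨(u, v), by simp [h], huv⟩
    · rintro ⟨u, v⟩ h1
      rw [hs.comp]
  · rintro ⟨u, v⟩ h
    rw [hs.mul_ne u v (Finset.mem_filter.1 h).2, h0]

/-- the canonical shift as a linear map -/
def shL (s : ∀ l : Fin r → ℕ, Λ.Mor l → A) (q : Fin r → ℕ) : A →ₗ[ℂ] A where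
  toFun X := ∑ w : Λ.Mor q, s q w * X * star (s q w)
  map_add' a b := by simp only [mul_add, add_mul, Finset.sum_add_distrib]
  map_smul' z a := by simp only [mul_smul_comm, smul_mul_assoc, Finset.smul_sum, RingHom.id_apply]

theorem shL_apply (q : Fin r → ℕ) (X : A) : shL s q X = ∑ w : Λ.Mor q, s q w * X * star (s q w) := rfl

theorem shL_one (hs : CKF Λ s) (q : Fin r → ℕ) : shL s q 1 = 1 := by
  rw [shL_apply]; simp only [mul_one]; exact hs.sum_range q

theorem shL_cpm (q : Fin r → ℕ) : CPM (shL s q) := by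
  apply CPM.of_fintype
  intro n a b
  refine ⟨Fin (Fintype.card (Λ.Mor q)), inferInstance, fun x => ∑ j, a j * star (s q ((Fintype.equivFin _).symm x)) * b j, ?_⟩
  rw [Equiv.sum_comp (Fintype.equivFin (Λ.Mor q)).symm fun w => star (∑ j, a j * star (s q w) * b j) * ∑ j, a j * star (s q w) * b j]
  simp only [star_sum, Finset.sum_mul_sum]
  conv_rhs => rw [Finset.sum_comm]
  refine Finset.sum_congr rfl fun i _ => ?_
  conv_rhs => rw [Finset.sum_comm]
  refine Finset.sum_congr rfl fun j _ => ?_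
  rw [shL_apply, Finset.mul_sum, Finset.sum_mul]
  refine Finset.sum_congr rfl fun w _ => ?_
  simp only [star_mul, star_star, mul_assoc]

/-- the amplified approximation -/
def CH (s : ∀ l : Fin r → ℕ, Λ.Mor l → A) (χ : A →ₗ[ℂ] A) (e e' : Fin r → ℕ) (z : A) : A :=
  ∑ w : Λ.Mor e, ∑ w' : Λ.Mor e', s e w * χ (star (s e w) * z * s e' w') * star (s e' w')

theorem CH_split (hs : CKF Λ s) (χ : A →ₗ[ℂ] A) (k k' e e' : Fin r → ℕ) (z : A) :
    CH s χ (k + e) (k' + e') z = ∑ β : Λ.Mor k, ∑ β' : Λ.Mor k', s k β * CH s χ e e' (star (s k β) * z * s k' β') * star (s k' β') := by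
  rw [CH]
  rw [hs.sum_comp (fun x => ∑ w', x * χ (star x * z * s (k' + e') w') * star (s (k' + e') w')) (by simp)]
  refine Finset.sum_congr rfl fun β _ => ?_
  have : ∀ w, ∑ w', s k β * s e w * χ (star (s k β * s e w) * z * s (k' + e') w') * star (s (k' + e') w') =
      ∑ β' : Λ.Mor k', ∑ w' : Λ.Mor e', s k β * s e w * χ (star (s k β * s e w) * z * (s k' β' * s e' w')) * star (s k' β' * s e' w') := by
    intro w
    rw [hs.sum_comp (fun x => s k β * s e w * χ (star (s k β * s e w) * z * x) * star x) (by simp)]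
  simp only [this]
  rw [Finset.sum_comm]
  refine Finset.sum_congr rfl fun β' _ => ?_
  rw [CH, Finset.mul_sum, Finset.sum_mul]
  refine Finset.sum_congr rfl fun w _ => ?_
  rw [Finset.mul_sum, Finset.sum_mul]
  refine Finset.sum_congr rfl fun w' _ => ?_
  simp only [star_mul, mul_assoc]

theorem s_CH_proj (hs : CKF Λ s) (χ : A →ₗ[ℂ] A) {k k' : Fin r → ℕ} (β : Λ.Mor k) (β' : Λ.Mor k') (e e' : Fin r → ℕ) (z : A) :
    s k β * CH s χ e e' (s 0 (Λ.id' (Λ.tgt β)) * z * s 0 (Λ.id' (Λ.tgt β'))) * star (s k' β') =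
      s k β * CH s χ e e' z * star (s k' β') := by
  simp only [CH, Finset.mul_sum, Finset.sum_mul]
  refine Finset.sum_congr rfl fun w _ => Finset.sum_congr rfl fun w' _ => ?_
  by_cases h : Λ.tgt β = Λ.src w
  · by_cases h' : Λ.tgt β' = Λ.src w'
    · have e1 : star (s e w) * s 0 (Λ.id' (Λ.tgt β)) = star (s e w) := by
        rw [h, ← hs.sa, ← star_mul, hs.unitl]
      have e2 : s 0 (Λ.id' (Λ.tgt β')) * s e' w' = s e' w' := by rw [h', hs.unitl]
      have : star (s e w) * (s 0 (Λ.id' (Λ.tgt β)) * z * s 0 (Λ.id' (Λ.tgt β'))) * s e' w' =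
          (star (s e w) * s 0 (Λ.id' (Λ.tgt β))) * z * (s 0 (Λ.id' (Λ.tgt β')) * s e' w') := by simp only [mul_assoc]
      rw [this, e1, e2]
    · have := congrArg star (hs.mul_ne β' w' h')
      rw [star_mul, star_zero] at this
      simp only [mul_assoc, this, mul_zero]
  · simp only [← mul_assoc, hs.mul_ne β w h, zero_mul]

theorem CH_zero (χ : A →ₗ[ℂ] A) (e e' : Fin r → ℕ) : CH s χ e e' 0 = 0 := by
  simp [CH]

theorem CH_shift (hs : CKF Λ s) (χ : A →ₗ[ℂ] A) (k e e' : Fin r → ℕ) (z : A) :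
    CH s χ (k + e) (k + e') (shL s k z) = shL s k (CH s χ e e' z) := by
  rw [hs.CH_split, shL_apply k (CH s χ e e' z)]
  refine Finset.sum_congr rfl fun β _ => ?_
  have key : ∀ β' : Λ.Mor k, star (s k β) * shL s k z * s k β' =
      if β = β' then s 0 (Λ.id' (Λ.tgt β)) * z * s 0 (Λ.id' (Λ.tgt β)) else 0 := by
    intro β'
    rw [shL_apply, Finset.mul_sum, Finset.sum_mul, Finset.sum_eq_single β]
    · calc _ = (star (s k β) * s k β) * z * (star (s k β) * s k β') := by simp only [mul_assoc]
        _ = _ := by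
          rw [hs.star_mul_same, hs.star_mul_same]
          split_ifs <;> simp_all
    · intro w _ hw
      calc _ = (star (s k β) * s k w) * (z * star (s k w) * s k β') := by simp only [mul_assoc]
        _ = 0 := by rw [hs.orth β w (Ne.symm hw), zero_mul]
    · intro h; exact absurd (Finset.mem_univ _) h
  rw [Finset.sum_eq_single β]
  · rw [key, if_pos rfl, hs.s_CH_proj]
  · intro β' _ h
    rw [key, if_neg (Ne.symm h), CH_zero, mul_zero, zero_mul]
  · intro h; exact absurd (Finset.mem_univ _) h

theorem CH_gen (hs : CKF Λ s) (χ : A →ₗ[ℂ] A) {lu lv : Fin r → ℕ} (u : Λ.Mor lu) (v : Λ.Mor lv) (e e' : Fin r → ℕ) :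
    CH s χ (lu + e) (lv + e') (s lu u * star (s lv v)) = s lu u * CH s χ e e' 1 * star (s lv v) := by
  rw [hs.CH_split]
  have key : ∀ (β : Λ.Mor lu) (β' : Λ.Mor lv), star (s lu β) * (s lu u * star (s lv v)) * s lv β' =
      (star (s lu β) * s lu u) * 1 * (star (s lv v) * s lv β') := by intros; simp only [mul_assoc, one_mul]
  rw [Finset.sum_eq_single u]
  · rw [Finset.sum_eq_single v]
    · rw [key, hs.isom, hs.isom, hs.s_CH_proj]
    · intro β' _ h
      rw [key, hs.orth v β' (Ne.symm h), mul_zero, CH_zero, mul_zero, zero_mul]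
    · intro h; exact absurd (Finset.mem_univ _) h
  · intro β _ h
    refine Finset.sum_eq_zero fun β' _ => ?_
    rw [key, hs.orth β u h, zero_mul, zero_mul, CH_zero, mul_zero, zero_mul]
  · intro h; exact absurd (Finset.mem_univ _) h

theorem CH_iter (hs : CKF Λ s) (χ : A →ₗ[ℂ] A) (p q : Fin r → ℕ) (j : ℕ) (z : A) :
    CH s χ (j • p + q) (j • p + q) ((shL s p)^[j] z) = (shL s p)^[j] (CH s χ q q z) := by
  induction j generalizing q with
  | zero => simp
  | succ j ih =>
    have : (j + 1) • p + q = p + (j • p + q) := by rw [add_smul, one_smul]; abel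
    rw [this, Function.iterate_succ_apply', Function.iterate_succ_apply', hs.CH_shift, ih]

theorem CH_sub_one (hs : CKF Λ s) (χ : A →ₗ[ℂ] A) (e e' : Fin r → ℕ) :
    CH s χ e e' 1 - 1 = ∑ w : Λ.Mor e, ∑ w' : Λ.Mor e', s e w * (χ (star (s e w) * s e' w') - star (s e w) * s e' w') * star (s e' w') := by
  have : (1 : A) = ∑ w : Λ.Mor e, ∑ w' : Λ.Mor e', s e w * (star (s e w) * s e' w') * star (s e' w') := by
    calc (1 : A) = (∑ w : Λ.Mor e, s e w * star (s e w)) * (∑ w' : Λ.Mor e', s e' w' * star (s e' w')) := by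
          rw [hs.sum_range, hs.sum_range, mul_one]
      _ = _ := by rw [Finset.sum_mul_sum]; simp only [mul_assoc]
  have h2 : CH s χ e e' 1 - 1 = CH s χ e e' 1 - ∑ w : Λ.Mor e, ∑ w' : Λ.Mor e', s e w * (star (s e w) * s e' w') * star (s e' w') :=
    congrArg (fun x => CH s χ e e' 1 - x) this
  rw [h2, CH, ← Finset.sum_sub_distrib]
  refine Finset.sum_congr rfl fun w _ => ?_
  rw [← Finset.sum_sub_distrib]
  refine Finset.sum_congr rfl fun w' _ => ?_
  rw [mul_sub, sub_mul, mul_one]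

end Alg
end CKF
end Part14

section Part15
set_option linter.unusedSectionVars false
set_option linter.unusedVariables false
set_option linter.unusedSimpArgs false

open scoped ComplexOrder InnerProductSpace ComplexConjugate

section Expl
variable {A : Type*} [Ring A] [StarRing A] [Algebra ℂ A] [StarModule ℂ A]

theorem Theta.explicit {θ : A → A} (hθ : θ ∈ Theta A) : ∃ (t : ℕ) (d : Fin t → ℕ) (k : Fin t → (A →ₗ[ℂ] ℂ))
    (c y : ∀ s, Fin (d s) → A), (∀ s a, 0 ≤ k s (star a * a)) ∧ ∀ a, θ a = blkOut y (blkIn k c a) := by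
  obtain ⟨L, hL, rfl⟩ := AddSubmonoid.exists_list_of_mem_closure hθ
  have hL' : ∀ i : Fin L.length, L.get i ∈ ThetaGen A := fun i => hL _ (List.get_mem _ _)
  choose ι hι k c y hk hθ' using hL'
  let d : Fin L.length → ℕ := fun s => Fintype.card (ι s)
  let e : ∀ s, Fin (d s) ≃ ι s := fun s => (Fintype.equivFin (ι s)).symm
  refine ⟨L.length, d, k, (fun s p => c s (e s p)), (fun s p => y s (e s p)), hk, fun a => ?_⟩
  have h1 : L.sum a = ∑ s : Fin L.length, L.get s a := by
    rw [← Finset.sum_apply]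
    congr 1
    conv_lhs => rw [← List.ofFn_get L, List.sum_ofFn]
  rw [h1]
  simp only [blkOut, blkIn, LinearMap.coe_mk, AddHom.coe_mk, Matrix.of_apply]
  refine Finset.sum_congr rfl fun s _ => ?_
  rw [hθ' s]
  beta_reduce
  rw [← Equiv.sum_comp (e s)]
  refine Finset.sum_congr rfl fun p _ => ?_
  rw [← Equiv.sum_comp (e s)]

variable {r : ℕ} {Λ : HigherRankGraph r} [Fintype Λ.Obj] [DecidableEq Λ.Obj] [∀ l, Fintype (Λ.Mor l)]
  [∀ l, DecidableEq (Λ.Mor l)] {s : ∀ l : Fin r → ℕ, Λ.Mor l → A}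

theorem CH_blocks {t : ℕ} {d : Fin t → ℕ} (k : Fin t → (A →ₗ[ℂ] ℂ)) (c y : ∀ i, Fin (d i) → A)
    (hk : ∀ i a, 0 ≤ k i (star a * a)) (m : Fin r → ℕ) :
    ∃ (ψ : A →ₗ[ℂ] Blk (fun i => Fintype.card (Λ.Mor m) * d i)) (φ : Blk (fun i => Fintype.card (Λ.Mor m) * d i) →ₗ[ℂ] A),
      CPM ψ ∧ CPM φ ∧ ∀ x, φ (ψ x) = CKF.CH s ((blkOut y).comp (blkIn k c)) m m x := by
  let e : ∀ i, Λ.Mor m × Fin (d i) ≃ Fin (Fintype.card (Λ.Mor m) * d i) := fun i =>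
    ((Fintype.equivFin (Λ.Mor m)).prodCongr (Equiv.refl _)).trans finProdFinEquiv
  refine ⟨blkIn k (fun i z => s m ((e i).symm z).1 * c i ((e i).symm z).2),
    blkOut (fun i z => y i ((e i).symm z).2 * star (s m ((e i).symm z).1)), cpm_blkIn _ hk _, cpm_blkOut _, fun x => ?_⟩
  simp only [CKF.CH, blkOut, blkIn, LinearMap.coe_mk, AddHom.coe_mk, Matrix.of_apply, LinearMap.comp_apply]
  simp only [Finset.mul_sum, Finset.sum_mul]
  have h1 : ∀ i : Fin t, ∀ F : Λ.Mor m × Fin (d i) → Λ.Mor m × Fin (d i) → A,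
      ∑ p, ∑ q, F ((e i).symm p) ((e i).symm q) = ∑ w, ∑ p, ∑ w', ∑ q, F (w, p) (w', q) := by
    intro i F
    rw [Equiv.sum_comp (e i).symm (fun p => ∑ q, F p ((e i).symm q)), Fintype.sum_prod_type]
    refine Finset.sum_congr rfl fun w _ => Finset.sum_congr rfl fun p _ => ?_
    rw [Equiv.sum_comp (e i).symm (fun q => F (w, p) q), Fintype.sum_prod_type]
  have h2 : ∀ i : Fin t, _ := fun i => h1 i (fun z z' => k i (star (s m z.1 * c i z.2) * x * (s m z'.1 * c i z'.2)) •
    (star (y i z.2 * star (s m z.1)) * (y i z'.2 * star (s m z'.1))))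
  simp only [h2]
  rw [Finset.sum_comm]
  refine Finset.sum_congr rfl fun w _ => ?_
  conv_rhs => rw [Finset.sum_comm]
  refine Finset.sum_congr rfl fun i _ => ?_
  conv_rhs => rw [Finset.sum_comm]
  refine Finset.sum_congr rfl fun p _ => Finset.sum_congr rfl fun w' _ => Finset.sum_congr rfl fun q _ => ?_
  simp only [star_mul, star_star, mul_assoc, mul_smul_comm, smul_mul_assoc]

end Expl

namespace CKF
section Est
variable {A : Type*} [CStarAlgebra A] [PartialOrder A] [StarOrderedRing A]
variable {r : ℕ} {Λ : HigherRankGraph r} [Fintype Λ.Obj] [DecidableEq Λ.Obj] [∀ l, Fintype (Λ.Mor l)]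
  [∀ l, DecidableEq (Λ.Mor l)] {s : ∀ l : Fin r → ℕ, Λ.Mor l → A}

theorem norm_s (hs : CKF Λ s) {l : Fin r → ℕ} (u : Λ.Mor l) : ‖s l u‖ ≤ 1 := by
  have h1 : ‖s 0 (Λ.id' (Λ.tgt u))‖ ≤ 1 := by
    have := CStarRing.norm_star_mul_self (x := s 0 (Λ.id' (Λ.tgt u)))
    rw [hs.sa, hs.idem] at this
    by_contra h
    push Not at h
    nlinarith
  have h2 := CStarRing.norm_star_mul_self (x := s l u)
  rw [hs.isom] at h2
  by_contra h
  push Not at h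
  nlinarith

theorem cpm_id : CPM (LinearMap.id : A →ₗ[ℂ] A) := by
  intro n a b
  refine ⟨1, fun _ => ∑ j, a j * b j, ?_⟩
  simp only [Finset.univ_unique, Finset.sum_singleton, star_sum, Finset.sum_mul_sum, star_mul, LinearMap.id_apply, mul_assoc]

theorem shL_contr (hs : CKF Λ s) (q : Fin r → ℕ) (x : A) : ‖shL s q x‖ ≤ ‖x‖ :=
  ucp_contr (ψ := LinearMap.id) (φ := shL s q) cpm_id rfl (shL_cpm q) (hs.shL_one q) x

theorem shL_iter_contr (hs : CKF Λ s) (q : Fin r → ℕ) (j : ℕ) (x : A) : ‖(shL s q)^[j] x‖ ≤ ‖x‖ := by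
  induction j with
  | zero => exact le_rfl
  | succ j ih => rw [Function.iterate_succ_apply']; exact (hs.shL_contr q _).trans ih

theorem norm_gen (hs : CKF Λ s) {lu lv : Fin r → ℕ} (u : Λ.Mor lu) (v : Λ.Mor lv) (x : A) :
    ‖s lu u * x * star (s lv v)‖ ≤ ‖x‖ := by
  calc _ ≤ ‖s lu u‖ * ‖x‖ * ‖star (s lv v)‖ := (norm_mul_le _ _).trans (by gcongr; exact norm_mul_le _ _)
    _ ≤ 1 * ‖x‖ * 1 := by
      have := hs.norm_s v
      rw [← norm_star] at this
      gcongr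
      exact hs.norm_s u
    _ = ‖x‖ := by ring

theorem CH_sub_one_norm (hs : CKF Λ s) (χ : A →ₗ[ℂ] A) (a b : Fin r → ℕ) (δ : ℝ)
    (h : ∀ (α : Λ.Mor a) (β : Λ.Mor b), ‖χ (star (s a α) * s b β) - star (s a α) * s b β‖ ≤ δ) :
    ‖CH s χ a b 1 - 1‖ ≤ Fintype.card (Λ.Mor a) * Fintype.card (Λ.Mor b) * δ := by
  rw [hs.CH_sub_one]
  calc _ ≤ ∑ w : Λ.Mor a, ∑ w' : Λ.Mor b, δ := by
        refine norm_sum_le_of_le _ fun w _ => norm_sum_le_of_le _ fun w' _ => ?_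
        exact (hs.norm_gen _ _ _).trans (h w w')
    _ = _ := by simp [mul_assoc]

theorem iter_sub (p : Fin r → ℕ) (j : ℕ) (x y : A) : (shL s p)^[j] x - (shL s p)^[j] y = (shL s p)^[j] (x - y) := by
  rw [← Module.End.pow_apply, ← Module.End.pow_apply, ← Module.End.pow_apply, map_sub]

theorem iter_one (hs : CKF Λ s) (p : Fin r → ℕ) (j : ℕ) : (shL s p)^[j] 1 = 1 := by
  induction j with
  | zero => rfl
  | succ j ih => rw [Function.iterate_succ_apply', ih, hs.shL_one]

theorem CH_gen_norm (hs : CKF Λ s) (χ : A →ₗ[ℂ] A) (p l' : Fin r → ℕ) (η : ℝ)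
    (h : ∀ a b : Fin r → ℕ, a ≤ l' → b ≤ l' → ‖CH s χ a b 1 - 1‖ < η)
    (n j : ℕ) (hj : j ≤ n) {lu lv : Fin r → ℕ} (u : Λ.Mor lu) (v : Λ.Mor lv) (hu : lu ≤ l') (hv : lv ≤ l') :
    ‖CH s χ (n • p + l') (n • p + l') ((shL s p)^[j] (s lu u * star (s lv v))) - (shL s p)^[j] (s lu u * star (s lv v))‖ < η := by
  obtain ⟨i, rfl⟩ := Nat.exists_eq_add_of_le hj
  have e0 : (j + i) • p + l' = j • p + (i • p + l') := by rw [add_smul, add_assoc]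
  rw [e0, hs.CH_iter, iter_sub]
  refine (hs.shL_iter_contr _ _ _).trans_lt ?_
  set q := i • p + l' with hq
  have hlq : l' ≤ q := by rw [hq]; exact le_add_of_nonneg_left (by intro x; simp)
  set e := q - lu with he
  set e' := q - lv with he'
  have e1 : q = lu + e := by
    funext x; have h9 : lu x ≤ q x := (hu x).trans (hlq x); simp only [he, Pi.add_apply, Pi.sub_apply]; omega
  have e2 : q = lv + e' := by
    funext x; have h9 : lv x ≤ q x := (hv x).trans (hlq x); simp only [he', Pi.add_apply, Pi.sub_apply]; omega
  obtain ⟨g, a, b, ha, hb, hea, heb⟩ : ∃ g a b : Fin r → ℕ, a ≤ l' ∧ b ≤ l' ∧ e = g + a ∧ e' = g + b := by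
    refine ⟨fun x => min (e x) (e' x), fun x => e x - min (e x) (e' x), fun x => e' x - min (e x) (e' x), ?_, ?_, ?_, ?_⟩
    · intro x; have := hu x; have := hv x; have := congrFun e1 x; have := congrFun e2 x; simp only [Pi.add_apply] at *; omega
    · intro x; have := hu x; have := hv x; have := congrFun e1 x; have := congrFun e2 x; simp only [Pi.add_apply] at *; omega
    · funext x; simp only [Pi.add_apply]; omega
    · funext x; simp only [Pi.add_apply]; omega
  have e3 : CH s χ q q (s lu u * star (s lv v)) - s lu u * star (s lv v) = s lu u * (CH s χ e e' 1 - 1) * star (s lv v) := by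
    have : CH s χ q q (s lu u * star (s lv v)) = CH s χ (lu + e) (lv + e') (s lu u * star (s lv v)) := by rw [← e1, ← e2]
    rw [this, hs.CH_gen, mul_sub, sub_mul, mul_one]
  have e4 : CH s χ e e' 1 - 1 = shL s g (CH s χ a b 1 - 1) := by
    rw [map_sub, hs.shL_one, ← hs.CH_shift, hs.shL_one, hea, heb]
  rw [e3, e4]
  exact ((hs.norm_gen _ _ _).trans (hs.shL_contr _ _)).trans_lt (h a b ha hb)

theorem rank_est [Nontrivial A] (hs : CKF Λ s) (p l' : Fin r → ℕ) (η : ℝ) (hη : 0 < η) :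
    ∃ K : ℕ, ∀ n : ℕ, ∃ (t : ℕ) (d : Fin t → ℕ) (ψ : A →ₗ[ℂ] Blk d) (φ : Blk d →ₗ[ℂ] A),
      (ψ 1 = 1 ∧ CPM ψ) ∧ (φ 1 = 1 ∧ CPM φ) ∧
      (∀ j ≤ n, ∀ (lu lv : Fin r → ℕ) (u : Λ.Mor lu) (v : Λ.Mor lv), lu ≤ l' → lv ≤ l' →
        ‖φ (ψ ((shL s p)^[j] (s lu u * star (s lv v)))) - (shL s p)^[j] (s lu u * star (s lv v))‖ ≤ η) ∧
      ∑ i, d i = Fintype.card (Λ.Mor (n • p + l')) * K := by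
  classical
  set η0 : ℝ := min (η / 4) (1 / 2) with hη0
  have hη0p : 0 < η0 := lt_min (by positivity) (by norm_num)
  let I := Finset.Icc (0 : Fin r → ℕ) l'
  set D : ℝ := 1 + ∑ a ∈ I, ∑ b ∈ I, (Fintype.card (Λ.Mor a) * Fintype.card (Λ.Mor b) : ℝ) with hD
  have hDp : 0 < D := by positivity
  have hDl : ∀ a ∈ I, ∀ b ∈ I, (Fintype.card (Λ.Mor a) * Fintype.card (Λ.Mor b) : ℝ) < D := by
    intro a ha b hb
    have h1 := Finset.single_le_sum (f := fun b => (Fintype.card (Λ.Mor a) * Fintype.card (Λ.Mor b) : ℝ)) (fun _ _ => by positivity) hb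
    have h2 := Finset.single_le_sum (f := fun a => ∑ b ∈ I, (Fintype.card (Λ.Mor a) * Fintype.card (Λ.Mor b) : ℝ)) (fun _ _ => by positivity) ha
    linarith
  let N : Type := Σ (a : I) (b : I), Λ.Mor a.1 × Λ.Mor b.1
  obtain ⟨θ, hθ, hap⟩ := theta_norm hs (N := N) (fun x => -dz x.1.1 + dz x.2.1.1)
    (fun x => star (s _ x.2.2.1) * s _ x.2.2.2) (fun x => hs.mul_gr (star_gr (hs.s_mem _)) (hs.s_mem _)) (η0 / D) (by positivity)
  obtain ⟨t, d, k, c, y, hk, hθe⟩ := Theta.explicit hθ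
  set χ : A →ₗ[ℂ] A := (blkOut y).comp (blkIn k c) with hχ
  have hχ1 : ∀ a b : Fin r → ℕ, a ≤ l' → b ≤ l' → ‖CH s χ a b 1 - 1‖ < η0 := by
    intro a b ha hb
    have ha' : a ∈ I := Finset.mem_Icc.2 ⟨by intro x; simp, ha⟩
    have hb' : b ∈ I := Finset.mem_Icc.2 ⟨by intro x; simp, hb⟩
    refine (hs.CH_sub_one_norm χ a b (η0 / D) fun α β => ?_).trans_lt ?_
    · have := hap ⟨⟨a, ha'⟩, ⟨b, hb'⟩, α, β⟩
      rw [hθe] at this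
      exact this.le
    · have := hDl a ha' b hb'
      calc _ < D * (η0 / D) := by gcongr
        _ = η0 := by field_simp
  refine ⟨∑ i, d i, fun n => ?_⟩
  obtain ⟨ψ, φ, hψ, hφ, hCH⟩ := CH_blocks (s := s) k c y hk (n • p + l')
  let N' : Type := Fin (n + 1) × N
  obtain ⟨ψ', φ', h1, h2, h3⟩ := normalise ψ φ hψ hφ (N := Fin (n + 1) × N)
    (fun x => (shL s p)^[x.1] (s _ x.2.2.2.1 * star (s _ x.2.2.2.2))) 1 η0
    (fun x => (hs.shL_iter_contr _ _ _).trans (by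
      have := hs.norm_gen x.2.2.2.1 x.2.2.2.2 1
      rw [mul_one, norm_one] at this; exact this)) hη0p
    ((min_le_right _ _).trans_lt (by norm_num))
    (fun x => by
      rw [hCH]
      exact hs.CH_gen_norm χ p l' η0 hχ1 n x.1 (Nat.lt_succ_iff.1 x.1.2) _ _ (Finset.mem_Icc.1 x.2.1.2).2 (Finset.mem_Icc.1 x.2.2.1.2).2)
    (by
      rw [hCH]
      have h0 : ‖CH s χ 0 0 1 - 1‖ < η0 := hχ1 0 0 (by intro x; simp) (by intro x; simp)
      have e := hs.CH_shift χ (n • p + l') 0 0 1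
      rw [hs.shL_one, add_zero] at e
      have : CH s χ (n • p + l') (n • p + l') 1 - 1 = shL s (n • p + l') (CH s χ 0 0 1 - 1) := by
        rw [map_sub, hs.shL_one, e]
      rw [this]
      exact (hs.shL_contr _ _).trans_lt h0)
  refine ⟨t, _, ψ', φ', h1, h2, ?_, (Finset.mul_sum _ _ _).symm⟩
  intro j hj lu lv u v hu hv
  refine (h3 (⟨j, Nat.lt_succ_of_le hj⟩, ⟨⟨lu, Finset.mem_Icc.2 ⟨by intro x; simp, hu⟩⟩, ⟨lv, Finset.mem_Icc.2 ⟨by intro x; simp, hv⟩⟩, u, v⟩)).trans ?_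
  have := min_le_left (η / 4) (1 / 2)
  rw [← hη0] at this
  linarith

end Est
end CKF
end Part15

section Part16
set_option linter.unusedSectionVars false
set_option linter.unusedVariables false
set_option linter.unusedSimpArgs false

open scoped ComplexOrder InnerProductSpace ComplexConjugate

namespace CKF
section Rcp
variable {A : Type*} [CStarAlgebra A] [PartialOrder A] [StarOrderedRing A]
variable {r : ℕ} {Λ : HigherRankGraph r} [Fintype Λ.Obj] [DecidableEq Λ.Obj] [∀ l, Fintype (Λ.Mor l)]
  [∀ l, DecidableEq (Λ.Mor l)] {s : ∀ l : Fin r → ℕ, Λ.Mor l → A}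

theorem span_ctrl (y : A) (hy : y ∈ Submodule.span ℂ {a : A | ∃ (lu lw : Fin r → ℕ) (u : Λ.Mor lu) (v : Λ.Mor lw),
    a = s lu u * star (s lw v)}) :
    ∃ (l0 : Fin r → ℕ) (K : ℝ), 0 ≤ K ∧ ∀ l', l0 ≤ l' → ∀ (η : ℝ), 0 ≤ η → ∀ E : A →ₗ[ℂ] A,
      (∀ (lu lv : Fin r → ℕ) (u : Λ.Mor lu) (v : Λ.Mor lv), lu ≤ l' → lv ≤ l' → ‖E (s lu u * star (s lv v))‖ ≤ η) →
      ‖E y‖ ≤ K * η := by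
  induction hy using Submodule.span_induction with
  | mem x hx =>
    obtain ⟨lu, lv, u, v, rfl⟩ := hx
    refine ⟨lu ⊔ lv, 1, zero_le_one, fun l' hl η hη E hE => ?_⟩
    rw [one_mul]
    exact hE _ _ _ _ (le_sup_left.trans hl) (le_sup_right.trans hl)
  | zero => exact ⟨0, 0, le_rfl, fun l' hl η hη E hE => by simp⟩
  | add x y _ _ hx hy =>
    obtain ⟨l1, K1, h1, H1⟩ := hx
    obtain ⟨l2, K2, h2, H2⟩ := hy
    refine ⟨l1 ⊔ l2, K1 + K2, by positivity, fun l' hl η hη E hE => ?_⟩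
    rw [map_add, add_mul]
    exact (norm_add_le _ _).trans (add_le_add (H1 l' (le_sup_left.trans hl) η hη E hE) (H2 l' (le_sup_right.trans hl) η hη E hE))
  | smul z x _ hx =>
    obtain ⟨l1, K1, h1, H1⟩ := hx
    refine ⟨l1, ‖z‖ * K1, by positivity, fun l' hl η hη E hE => ?_⟩
    rw [map_smul, norm_smul, mul_assoc]
    exact mul_le_mul_of_nonneg_left (H1 l' hl η hη E hE) (norm_nonneg _)

theorem rcp_bound (hs : CKF Λ s)
    (htotal : (Submodule.span ℂ {a : A | ∃ (lu lw : Fin r → ℕ) (u : Λ.Mor lu) (v : Λ.Mor lw),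
      a = s lu u * star (s lw v)}).topologicalClosure = ⊤) (p : Fin r → ℕ) (Ω : Finset A) (ε : ℝ) (hε : 0 < ε) :
    ∃ (K : ℕ) (l' : Fin r → ℕ), ∀ n : ℕ,
      rcp A (⋃ j ∈ Finset.range (n + 1), (shL s p)^[j] '' (Ω : Set A)) ε ≤ K * Fintype.card (Λ.Mor (n • p + l')) := by
  classical
  rcases subsingleton_or_nontrivial A with hA | hA
  · refine ⟨0, 0, fun n => ?_⟩
    rw [zero_mul]
    refine Nat.sInf_le ⟨0, Fin.elim0, 0, 0, ⟨Subsingleton.elim _ _, ?_⟩, ⟨Subsingleton.elim _ _, ?_⟩, ?_, by simp⟩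
    · intro n a b; exact ⟨0, Fin.elim0, Subsingleton.elim _ _⟩
    · intro n a b; exact ⟨0, Fin.elim0, Subsingleton.elim _ _⟩
    · intro a _
      rw [Subsingleton.elim (_ - a) 0, norm_zero]; exact hε
  have hap : ∀ x : A, ∃ y ∈ Submodule.span ℂ {a : A | ∃ (lu lw : Fin r → ℕ) (u : Λ.Mor lu) (v : Λ.Mor lw),
      a = s lu u * star (s lw v)}, ‖x - y‖ < ε / 4 := by
    intro x
    have hx : x ∈ (Submodule.span ℂ {a : A | ∃ (lu lw : Fin r → ℕ) (u : Λ.Mor lu) (v : Λ.Mor lw),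
      a = s lu u * star (s lw v)}).topologicalClosure := by rw [htotal]; trivial
    obtain ⟨y, hy, h⟩ := Metric.mem_closure_iff.1 hx (ε / 4) (by positivity)
    exact ⟨y, hy, by rwa [dist_eq_norm] at h⟩
  choose y hy hxy using hap
  choose l0 Ky hKy hctrl using fun x => span_ctrl (y x) (hy x)
  set l' : Fin r → ℕ := ∑ x ∈ Ω, l0 x with hl'
  set D : ℝ := 1 + ∑ x ∈ Ω, Ky x with hD
  have hDp : 0 < D := by have := Finset.sum_nonneg (s := Ω) fun x _ => hKy x; linarith
  obtain ⟨K, hK⟩ := hs.rank_est p l' (ε / 4 / D) (by positivity)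
  refine ⟨K, l', fun n => ?_⟩
  obtain ⟨t, d, ψ, φ, hψ, hφ, hest, hd⟩ := hK n
  rw [mul_comm, ← hd]
  refine Nat.sInf_le ⟨t, d, ψ, φ, hψ, hφ, ?_, rfl⟩
  intro a ha
  simp only [Set.mem_iUnion, Finset.mem_range] at ha
  obtain ⟨j, hj, x, hx, rfl⟩ := ha
  let E : A →ₗ[ℂ] A := (φ ∘ₗ ψ - LinearMap.id) ∘ₗ ((shL s p) ^ j : A →ₗ[ℂ] A)
  have hE : ∀ z, E z = φ (ψ ((shL s p)^[j] z)) - (shL s p)^[j] z := by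
    intro z
    simp only [E, LinearMap.comp_apply, LinearMap.sub_apply, LinearMap.id_apply, Module.End.pow_apply]
  have h1 : ‖E (y x)‖ ≤ ε / 4 := by
    have := hctrl x l' (Finset.single_le_sum (f := l0) (fun _ _ => by intro i; simp) hx) (ε / 4 / D) (by positivity) E (by
      intro lu lv u v hu hv
      rw [hE]
      exact hest j (by omega) lu lv u v hu hv)
    refine this.trans ?_
    have h2 := Finset.single_le_sum (f := Ky) (fun x _ => hKy x) hx
    calc _ ≤ D * (ε / 4 / D) := by gcongr; linarith
      _ = _ := by field_simp
  have h2 : ‖E (x - y x)‖ ≤ 2 * (ε / 4) := by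
    rw [hE]
    have h3 := hs.shL_iter_contr p j (x - y x)
    have h4 := ucp_contr hψ.2 hψ.1 hφ.2 hφ.1 ((shL s p)^[j] (x - y x))
    have h5 := hxy x
    refine (norm_sub_le _ _).trans ?_
    linarith
  rw [← hE]
  have : E x = E (x - y x) + E (y x) := by rw [map_sub, sub_add_cancel]
  rw [this]
  refine (norm_add_le _ _).trans_lt ?_
  linarith

end Rcp

section Count
variable {r : ℕ} (Λ : HigherRankGraph r) [Fintype Λ.Obj] [DecidableEq Λ.Obj] [∀ l, Fintype (Λ.Mor l)]
  [∀ l, DecidableEq (Λ.Mor l)]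

theorem card_add_le (a b : Fin r → ℕ) : Fintype.card (Λ.Mor (a + b)) ≤ Fintype.card (Λ.Mor a) * Fintype.card (Λ.Mor b) := by
  rw [← Fintype.card_prod]
  have h := fun w => (Λ.factor a b w).exists
  choose f hf using h
  refine Fintype.card_le_of_injective (fun w => ((f w).1, (f w).2.1)) ?_
  intro w w' h
  rw [Prod.mk.injEq] at h
  obtain ⟨h1, h2⟩ := h
  rw [← hf w, ← hf w']
  generalize f w = z at *
  generalize f w' = z' at *
  obtain ⟨u, v, h⟩ := z
  obtain ⟨u', v', h'⟩ := z'
  simp only at h1 h2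
  subst h1 h2
  rfl

theorem card_le_add (hnosrc : ∀ (a : Λ.Obj) (m : Fin r → ℕ), ∃ v : Λ.Mor m, Λ.src v = a) (a b : Fin r → ℕ) :
    Fintype.card (Λ.Mor a) ≤ Fintype.card (Λ.Mor (a + b)) := by
  choose f hf using hnosrc
  refine Fintype.card_le_of_injective (fun w => Λ.comp w (f (Λ.tgt w) b) (hf _ _).symm) ?_
  intro w w' h
  obtain ⟨x, hx, hu⟩ := Λ.factor a b (Λ.comp w (f (Λ.tgt w) b) (hf _ _).symm)
  have e1 := hu ⟨w, _, (hf _ _).symm⟩ rfl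
  have e2 := hu ⟨w', _, (hf _ _).symm⟩ h.symm
  have e := e1.trans e2.symm
  simp only [PSigma.mk.injEq] at e
  exact e.1

theorem card_shift (hnosrc : ∀ (a : Λ.Obj) (m : Fin r → ℕ), ∃ v : Λ.Mor m, Λ.src v = a) (l l' q : Fin r → ℕ) :
    Fintype.card (Λ.Mor (q + l')) ≤ Fintype.card (Λ.Mor (l + q)) * Fintype.card (Λ.Mor l') := by
  refine (card_add_le Λ q l').trans (Nat.mul_le_mul_right _ ?_)
  rw [add_comm l q]
  exact card_le_add Λ hnosrc q l

theorem card_iter (l p : Fin r → ℕ) (n : ℕ) :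
    Fintype.card (Λ.Mor (l + n • p)) ≤ Fintype.card (Λ.Mor l) * Fintype.card (Λ.Mor p) ^ n := by
  induction n with
  | zero => simp
  | succ n ih =>
    have : l + (n + 1) • p = (l + n • p) + p := by rw [add_smul, one_smul, add_assoc]
    rw [this, pow_succ, ← mul_assoc]
    exact (card_add_le Λ _ _).trans (Nat.mul_le_mul_right _ ih)

end Count

section Lim
theorem limsup_cmp (f w : ℕ → ℕ) (K a b : ℕ) (hf : ∀ n, f n ≤ K * w n) (hw : ∀ n, w n ≤ a * b ^ n) :
    Filter.limsup (fun n : ℕ => (1 / n : ℝ) * Real.log (f n)) Filter.atTop ≤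
      Filter.limsup (fun n : ℕ => (1 / n : ℝ) * Real.log (w n)) Filter.atTop ∧
    0 ≤ Filter.limsup (fun n : ℕ => (1 / n : ℝ) * Real.log (w n)) Filter.atTop := by
  have hn0 : ∀ f : ℕ → ℕ, ∀ n : ℕ, 0 ≤ (1 / n : ℝ) * Real.log (f n) := fun f n =>
    mul_nonneg (by positivity) (Real.log_natCast_nonneg _)
  have hmul : ∀ x y z : ℕ, x ≤ y * z → Real.log x ≤ Real.log y + Real.log z := by
    intro x y z h
    rcases Nat.eq_zero_or_pos x with rfl | hx
    · simpa using add_nonneg (Real.log_natCast_nonneg y) (Real.log_natCast_nonneg z)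
    have hyz : 0 < y * z := hx.trans_le h
    have hy : 0 < y := Nat.pos_of_mul_pos_right hyz
    have hz : 0 < z := Nat.pos_of_mul_pos_left hyz
    rw [← Real.log_mul (by positivity) (by positivity)]
    exact Real.log_le_log (by positivity) (by exact_mod_cast h)
  have hfw : ∀ n : ℕ, (1 / n : ℝ) * Real.log (f n) ≤ (1 / n : ℝ) * Real.log K + (1 / n : ℝ) * Real.log (w n) := by
    intro n
    rw [← mul_add]
    exact mul_le_mul_of_nonneg_left (hmul _ _ _ (hf n)) (by positivity)
  have hwb : ∀ n : ℕ, (1 / n : ℝ) * Real.log (w n) ≤ Real.log a + Real.log b := by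
    intro n
    rcases Nat.eq_zero_or_pos n with rfl | hn
    · simpa using add_nonneg (Real.log_natCast_nonneg a) (Real.log_natCast_nonneg b)
    have h1 := hmul _ _ _ (hw n)
    push_cast at h1
    rw [Real.log_pow] at h1
    have hn1 : (1 : ℝ) ≤ n := by exact_mod_cast hn
    have ha := Real.log_natCast_nonneg a
    rw [one_div, inv_mul_le_iff₀ (by positivity)]
    nlinarith
  have hwB : Filter.IsBoundedUnder (· ≤ ·) Filter.atTop (fun n : ℕ => (1 / n : ℝ) * Real.log (w n)) :=
    Filter.isBoundedUnder_of ⟨_, hwb⟩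
  have hwC : ∀ f : ℕ → ℕ, Filter.IsCoboundedUnder (· ≤ ·) Filter.atTop (fun n : ℕ => (1 / n : ℝ) * Real.log (f n)) := fun f =>
    (Filter.isBoundedUnder_of ⟨0, hn0 f⟩ : Filter.IsBoundedUnder (· ≥ ·) Filter.atTop _).isCoboundedUnder_le
  refine ⟨?_, Filter.le_limsup_of_frequently_le (Filter.Frequently.of_forall (hn0 w)) hwB⟩
  refine le_of_forall_pos_lt_add fun ε hε => ?_
  have hlt := Filter.eventually_lt_of_limsup_lt (lt_add_of_pos_right (Filter.limsup (fun n : ℕ => (1 / n : ℝ) * Real.log (w n)) Filter.atTop) (by positivity : 0 < ε / 3)) hwB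
  have ht : Filter.Tendsto (fun n : ℕ => (1 / n : ℝ) * Real.log K) Filter.atTop (nhds 0) := by
    have := tendsto_one_div_atTop_nhds_zero_nat (𝕜 := ℝ)
    simpa using this.mul_const (Real.log K)
  have ht' := ht.eventually (gt_mem_nhds (by positivity : 0 < ε / 3))
  have : Filter.limsup (fun n : ℕ => (1 / n : ℝ) * Real.log (f n)) Filter.atTop ≤
      Filter.limsup (fun n : ℕ => (1 / n : ℝ) * Real.log (w n)) Filter.atTop + ε / 3 + ε / 3 := by
    refine Filter.limsup_le_of_le (hwC f) ?_
    filter_upwards [hlt, ht'] with n h1 h2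
    have := hfw n
    linarith
  linarith
end Lim

section Main
variable {A : Type*} [CStarAlgebra A] [PartialOrder A] [StarOrderedRing A]
variable {r : ℕ} {Λ : HigherRankGraph r} [Fintype Λ.Obj] [DecidableEq Λ.Obj] [∀ l, Fintype (Λ.Mor l)]
  [∀ l, DecidableEq (Λ.Mor l)] {s : ∀ l : Fin r → ℕ, Λ.Mor l → A}

theorem orth_of
    (sa : ∀ a : Λ.Obj, star (s 0 (Λ.id' a)) = s 0 (Λ.id' a))
    (orthp : ∀ a b : Λ.Obj, a ≠ b → s 0 (Λ.id' a) * s 0 (Λ.id' b) = 0)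
    (isom : ∀ {l : Fin r → ℕ} (u : Λ.Mor l), star (s l u) * s l u = s 0 (Λ.id' (Λ.tgt u)))
    (unitl : ∀ {l : Fin r → ℕ} (u : Λ.Mor l), s 0 (Λ.id' (Λ.src u)) * s l u = s l u)
    (unitr : ∀ {l : Fin r → ℕ} (u : Λ.Mor l), s l u * s 0 (Λ.id' (Λ.tgt u)) = s l u)
    (ck : ∀ (a : Λ.Obj) (n : Fin r → ℕ),
      s 0 (Λ.id' a) = ∑ u : Λ.Mor n, if Λ.src u = a then s n u * star (s n u) else 0)
    {l : Fin r → ℕ} (u v : Λ.Mor l) (huv : u ≠ v) : star (s l u) * s l v = 0 := by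
  by_cases hsrc : Λ.src u = Λ.src v
  · have h1 : star (s l v) * s 0 (Λ.id' (Λ.src v)) * s l v = star (s l v) * s l v := by rw [mul_assoc, unitl]
    rw [ck _ l, Finset.mul_sum, Finset.sum_mul] at h1
    rw [← Finset.add_sum_erase _ _ (Finset.mem_univ v), if_pos rfl] at h1
    have h2 : star (s l v) * (s l v * star (s l v)) * s l v = star (s l v) * s l v := by
      calc _ = star (s l v) * (s l v * (star (s l v) * s l v)) := by simp only [mul_assoc]
        _ = _ := by rw [isom v, unitr, isom]
    rw [h2, add_eq_left] at h1
    have h3 : ∀ w ∈ Finset.univ.erase v, 0 ≤ star (s l v) * (if Λ.src w = Λ.src v then s l w * star (s l w) else 0) * s l v := by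
      intro w _
      split_ifs
      · have : star (s l v) * (s l w * star (s l w)) * s l v = star (star (s l w) * s l v) * (star (s l w) * s l v) := by
          simp only [star_mul, star_star, mul_assoc]
        rw [this]
        exact star_mul_self_nonneg _
      · simp
    have h4 := (Finset.sum_eq_zero_iff_of_nonneg h3).1 h1 u (Finset.mem_erase.2 ⟨huv, Finset.mem_univ _⟩)
    rw [if_pos hsrc] at h4
    have : star (s l v) * (s l u * star (s l u)) * s l v = star (star (s l u) * s l v) * (star (s l u) * s l v) := by
      simp only [star_mul, star_star, mul_assoc]
    rw [this] at h4
    exact (CStarRing.star_mul_self_eq_zero_iff _).1 h4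
  · rw [← unitl u, ← unitl v, star_mul, sa]
    calc _ = star (s l u) * (s 0 (Λ.id' (Λ.src u)) * s 0 (Λ.id' (Λ.src v))) * s l v := by simp only [mul_assoc]
      _ = 0 := by rw [orthp _ _ hsrc]; simp

theorem main_cstar (hs : CKF Λ s)
    (hnosrc : ∀ (a : Λ.Obj) (m : Fin r → ℕ), ∃ v : Λ.Mor m, Λ.src v = a)
    (htotal : (Submodule.span ℂ {a : A | ∃ (lu lw : Fin r → ℕ) (u : Λ.Mor lu) (v : Λ.Mor lw),
      a = s lu u * star (s lw v)}).topologicalClosure = ⊤) (p l : Fin r → ℕ) :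
    sSup {h : ℝ | ∃ (Ω : Finset A) (ε : ℝ), 0 < ε ∧
        h = Filter.limsup (fun n : ℕ => (1 / n : ℝ) * Real.log
            (rcp A (⋃ j ∈ Finset.range (n + 1), (shL s p)^[j] '' (Ω : Set A)) ε))
          Filter.atTop} ≤
      Filter.limsup (fun n : ℕ =>
        (1 / n : ℝ) * Real.log (Fintype.card (Λ.Mor (l + n • p)))) Filter.atTop := by
  refine Real.sSup_le ?_ (limsup_cmp (fun _ => 0) (fun n => Fintype.card (Λ.Mor (l + n • p))) 0 _ _ (by simp) (card_iter Λ l p)).2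
  rintro _ ⟨Ω, ε, hε, rfl⟩
  obtain ⟨K, l', hK⟩ := hs.rcp_bound htotal p Ω ε hε
  refine (limsup_cmp (fun n => rcp A (⋃ j ∈ Finset.range (n + 1), (shL s p)^[j] '' (Ω : Set A)) ε)
    (fun n => Fintype.card (Λ.Mor (l + n • p))) (K * Fintype.card (Λ.Mor l')) _ _ (fun n => ?_) (card_iter Λ l p)).1
  refine (hK n).trans ?_
  rw [mul_assoc]
  refine Nat.mul_le_mul_left _ ?_
  rw [mul_comm]
  exact card_shift Λ hnosrc l l' (n • p)

end Main
end CKF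
end Part16

/-- for the canonical shift `Φ^p` on a higher-rank graph algebra, given the
approximation estimate `rcp(ω_l^{(n)}, δ) ≤ C_l · w_{n+l}` (and totality of the standard
generators), Voiculescu's topological entropy satisfies
`ht(Φ^p) ≤ lim sup_n (1/n) log w_{l̄+np}`. -/
theorem entropy_upper_bound_from_rcp_estimate {r : ℕ} (Λ : HigherRankGraph r)
    [Fintype Λ.Obj] [DecidableEq Λ.Obj] [∀ l, Fintype (Λ.Mor l)] [∀ l, DecidableEq (Λ.Mor l)]
    {A : Type*} [NormedRing A] [StarRing A] [CStarRing A] [NormedAlgebra ℂ A]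
    [StarModule ℂ A] [CompleteSpace A]
    (s : ∀ {l : Fin r → ℕ}, Λ.Mor l → A)
    (horth : ∀ a b : Λ.Obj, a ≠ b → s (Λ.id' a) * s (Λ.id' b) = 0)
    (hproj : ∀ a : Λ.Obj,
      s (Λ.id' a) * s (Λ.id' a) = s (Λ.id' a) ∧ star (s (Λ.id' a)) = s (Λ.id' a))
    (hsum1 : ∑ a : Λ.Obj, s (Λ.id' a) = 1)
    (hcomp : ∀ {l m : Fin r → ℕ} (u : Λ.Mor l) (v : Λ.Mor m) (h : Λ.tgt u = Λ.src v),
      s (Λ.comp u v h) = s u * s v)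
    (hisom : ∀ {l : Fin r → ℕ} (u : Λ.Mor l), star (s u) * s u = s (Λ.id' (Λ.tgt u)))
    (hunitl : ∀ {l : Fin r → ℕ} (u : Λ.Mor l), s (Λ.id' (Λ.src u)) * s u = s u)
    (hunitr : ∀ {l : Fin r → ℕ} (u : Λ.Mor l), s u * s (Λ.id' (Λ.tgt u)) = s u)
    (hck : ∀ (a : Λ.Obj) (n : Fin r → ℕ),
      s (Λ.id' a) = ∑ u : Λ.Mor n, if Λ.src u = a then s u * star (s u) else 0)
    (hnosrc : ∀ (a : Λ.Obj) (m : Fin r → ℕ), ∃ v : Λ.Mor m, Λ.src v = a)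
    (htotal : (Submodule.span ℂ
        {a : A | ∃ (lu lw : Fin r → ℕ) (u : Λ.Mor lu) (v : Λ.Mor lw),
          a = s u * star (s v)}).topologicalClosure = ⊤)
    (Φ : (Fin r → ℕ) → A → A)
    (hΦ : ∀ (q : Fin r → ℕ) (X : A), Φ q X = ∑ w : Λ.Mor q, s w * X * star (s w))
    (ω : (Fin r → ℕ) → Set A)
    (hω : ∀ l, ω l = {a : A | ∃ (lu lw : Fin r → ℕ) (u : Λ.Mor lu) (v : Λ.Mor lw),
      lu ≤ l ∧ lw ≤ l ∧ a = s u * star (s v)})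
    (hest : ∀ (l : Fin r → ℕ) (δ : ℝ), 0 < δ → ∃ C : ℝ, ∀ n : Fin r → ℕ,
      (rcp A {a : A | ∃ k : Fin r → ℕ, k ≤ n ∧ a ∈ Φ k '' ω l} δ : ℝ) ≤
        C * (Fintype.card (Λ.Mor (n + l)) : ℝ))
    (p : Fin r → ℕ) (l : Fin r → ℕ) :
    sSup {h : ℝ | ∃ (Ω : Finset A) (ε : ℝ), 0 < ε ∧
        h = Filter.limsup (fun n : ℕ => (1 / n : ℝ) * Real.log
            (rcp A (⋃ j ∈ Finset.range (n + 1), (Φ p)^[j] '' (Ω : Set A)) ε))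
          Filter.atTop} ≤
      Filter.limsup (fun n : ℕ =>
        (1 / n : ℝ) * Real.log (Fintype.card (Λ.Mor (l + n • p)))) Filter.atTop := by
  letI : CStarAlgebra A := {}
  letI : PartialOrder A := CStarAlgebra.spectralOrder A
  haveI : StarOrderedRing A := CStarAlgebra.spectralOrderedRing A
  have hs : CKF Λ (fun l (u : Λ.Mor l) => s u) :=
    { orthp := horth
      idem := fun a => (hproj a).1
      sa := fun a => (hproj a).2
      sum1 := hsum1
      comp := fun u v h => hcomp u v h
      isom := fun u => hisom u
      unitl := fun u => hunitl u
      unitr := fun u => hunitr u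
      ck := hck
      orth := fun u v h => CKF.orth_of (s := fun l (u : Λ.Mor l) => s u) (fun a => (hproj a).2) horth
        (fun u => hisom u) (fun u => hunitl u) (fun u => hunitr u) hck u v h }
  have hΦp : Φ p = ⇑(CKF.shL (fun l (u : Λ.Mor l) => s u) p) := funext fun X => hΦ p X
  rw [hΦp]
  exact CKF.main_cstar hs hnosrc htotal p l
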